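/- arXiv:2202.08767 — 4 statements merged into one kernel-verified Lean document; each statement's English description precedes it below -/
import Mathlib

section
/- Let F be an algebraically closed field, P(x) ∈ F[x] with deg P = d ≥ 2 such that P(x) ≠ ω(x+c)^d for all ω, c ∈ F, and let k ≥ 2 with |Z_P| > k. Suppose lines l₁,…,l_k, l'₁,…,l'_k satisfy (*). Then for every i ∈ {1,…,k} there exists j ∈ {1,…,k} such that l'_i ∘ l_j^{−1} ∈ L(Z_P). -/
open Polynomial

/-- A line (invertible affine map) `g` belongs to `L(Z)` if its graph contains at least
two points of `Z × Z`. -/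
def memLinesOf {F : Type} [Field F] (Z : Set F) (g : F → F) : Prop :=
  ∃ z₁ z₂ : F, z₁ ∈ Z ∧ z₂ ∈ Z ∧ z₁ ≠ z₂ ∧ g z₁ ∈ Z ∧ g z₂ ∈ Z

/-- **Lemma 3.1, part 1).** Let `F` be an algebraically closed field, `P ∈ F[x]` of
degree `d ≥ 2` with `P ≠ ω(x+c)^d` for all `ω, c ∈ F`, let `k ≥ 2` with `|Z_P| > k`, and
suppose the lines `l_i(t) = a_i t + b_i`, `l'_i(t) = a'_i t + b'_i` satisfy
`∏_i P(l_i(t)) = ∏_i P(l'_i(t))` for all `t`. Then for every `i` there is `j` with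
`l'_i ∘ l_j⁻¹ ∈ L(Z_P)`. -/
theorem lines_in_variety_part_one
    {F : Type} [Field F] [IsAlgClosed F]
    (P : Polynomial F) (d : ℕ) (hd : 2 ≤ d) (hdeg : P.natDegree = d)
    (hform : ¬ ∃ ω c : F, P = C ω * (X + C c) ^ d)
    (k : ℕ) (hk : 2 ≤ k) (hZ : k < Set.ncard {z : F | P.IsRoot z})
    (a b a' b' : Fin k → F) (ha : ∀ i, a i ≠ 0) (ha' : ∀ i, a' i ≠ 0)
    (hstar : ∀ t : F,
      ∏ i, P.eval (a i * t + b i) = ∏ i, P.eval (a' i * t + b' i)) :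
    ∀ i : Fin k, ∃ j : Fin k,
      memLinesOf {z : F | P.IsRoot z}
        (fun t => a' i * ((t - b j) / a j) + b' i) := by
  intro i
  have hroot : ∀ z : F, P.IsRoot z →
      ∃ j : Fin k, P.IsRoot (a j * ((z - b' i) / a' i) + b j) := by
    intro z hz
    have h := hstar ((z - b' i) / a' i)
    rw [Finset.prod_eq_zero (f := fun m => P.eval (a' m * ((z - b' i) / a' i) + b' m))
      (Finset.mem_univ i)
      (by rw [mul_div_cancel₀ _ (ha' i), sub_add_cancel]; exact hz)] at h
    obtain ⟨j, -, hj⟩ := Finset.prod_eq_zero_iff.mp h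
    exact ⟨j, hj⟩
  have hne : Nonempty (Fin k) := ⟨i⟩
  choose! f hf using hroot
  obtain ⟨z₁, hz₁, z₂, hz₂, hz, hfz⟩ :=
    Set.exists_ne_map_eq_of_ncard_lt_of_maps_to (t := (Set.univ : Set (Fin k)))
      (by simpa [Set.ncard_univ] using hZ) (f := f) (fun z _ => Set.mem_univ (f z))
  have hinv : ∀ z : F,
      a' i * ((a (f z) * ((z - b' i) / a' i) + b (f z) - b (f z)) / a (f z)) + b' i = z := by
    intro z
    have h₁ := ha (f z)
    have h₂ := ha' i
    field_simp
    ring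
  refine ⟨f z₁, a (f z₁) * ((z₁ - b' i) / a' i) + b (f z₁),
    a (f z₁) * ((z₂ - b' i) / a' i) + b (f z₁), hf z₁ hz₁, ?_, ?_, ?_, ?_⟩
  · rw [hfz]
    exact hf z₂ hz₂
  · intro h
    apply hz
    rw [← hinv z₁, ← hinv z₂, h, hfz]
  · simp only [hinv]
    exact hz₁
  · simp only [hfz, hinv]
    exact hz₂
end

section
/- (Bombieri–Pila.) Let F(x,y) ∈ ℤ[x,y] be an absolutely irreducible polynomial (i.e., irreducible as an element of ℂ[x,y]) of total degree d ≥ 2, and let N be a real number with N ≥ exp(d⁶). Then the number of integral points (x,y) ∈ ℤ² with 0 ≤ x ≤ N, 0 ≤ y ≤ N and F(x,y) = 0 is at most N^{1/d} · exp(12 · √(d · log N · log log N)). -/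
open Polynomial Finset in
theorem Polynomial.exists_eval_congr_of_evalEval_eq_zero (H : ℤ[X][X]) {p : ℕ} (hp : p.Prime)
    (x₀ y₀ : ℤ) (hu : ¬ (p : ℤ) ∣ (derivative H).evalEval x₀ y₀) (m : ℕ) :
    ∃ f : ℤ[X], ∀ x y : ℤ, x ≡ x₀ [ZMOD p] → y ≡ y₀ [ZMOD p] → H.evalEval x y = 0 →
      (p : ℤ) ^ (m + 1) ∣ y - f.eval x := by
  obtain ⟨w, hw⟩ : ∃ w : ℤ, (p : ℤ) ∣ w * (derivative H).evalEval x₀ y₀ - 1 := by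
    have hco : IsCoprime (p : ℤ) ((derivative H).evalEval x₀ y₀) :=
      (Nat.prime_iff_prime_int.mp hp).coprime_iff_not_dvd.mpr hu
    obtain ⟨a, b, hab⟩ := hco
    exact ⟨b, -a, by linear_combination hab⟩
  induction m with
  | zero =>
    refine ⟨C y₀, fun x y _ hy _ ↦ ?_⟩
    simpa using (Int.modEq_iff_dvd.mp hy.symm)
  | succ m ih =>
    obtain ⟨f, hf⟩ := ih
    refine ⟨f - C w * H.eval f, fun x y hx hy hH ↦ ?_⟩
    obtain ⟨z, hz⟩ := hf x y hx hy hH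
    obtain ⟨k, hk⟩ := binomExpansion (H.map (evalRingHom x)) (f.eval x) ((p : ℤ) ^ (m + 1) * z)
    have hyf : y ≡ f.eval x [ZMOD p] :=
      (Int.modEq_iff_dvd.mpr ((dvd_pow_self _ (Nat.succ_ne_zero m)).trans ⟨z, hz⟩)).symm
    have hder : (derivative H).evalEval x (f.eval x) ≡
        (derivative H).evalEval x₀ y₀ [ZMOD p] := by
      have h1 : ∀ (G : ℤ[X][X]) (a b c e : ℤ), a ≡ c [ZMOD p] → b ≡ e [ZMOD p] →
          G.evalEval a b ≡ G.evalEval c e [ZMOD p] := by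
        intro G a b c e hac hbe
        have hac' := Int.modEq_iff_dvd.mp hac.symm
        have hbe' := Int.modEq_iff_dvd.mp hbe.symm
        refine (Int.modEq_iff_dvd.mpr ?_).symm
        have e1 : (p : ℤ) ∣ (G.eval (C b)).eval a - (G.eval (C b)).eval c :=
          hac'.trans (sub_dvd_eval_sub _ _ _)
        have e2 : (p : ℤ) ∣ (G.eval (C b)).eval c - (G.eval (C e)).eval c := by
          obtain ⟨r, hr⟩ := sub_dvd_eval_sub (C b) (C e) G
          have h2 := congrArg (eval c) hr
          simp only [eval_sub, eval_mul, eval_C] at h2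
          exact h2 ▸ hbe'.mul_right _
        have := dvd_add e1 e2
        rwa [sub_add_sub_cancel] at this
      exact h1 _ _ _ _ _ hx (hyf.symm.trans hy)
    have hHf : (H.eval f).eval x = H.evalEval x (f.eval x) := by
      rw [← map_evalRingHom_eval, eval_map, ← coe_evalRingHom, eval₂_hom]
    have hHy : (H.map (evalRingHom x)).eval (f.eval x + (p : ℤ) ^ (m + 1) * z) = 0 := by
      rw [← hz, add_sub_cancel, map_evalRingHom_eval, hH]
    rw [hHy, derivative_map, map_evalRingHom_eval, map_evalRingHom_eval] at hk
    obtain ⟨v, hv⟩ := hw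
    obtain ⟨u, hu'⟩ := Int.modEq_iff_dvd.mp hder.symm
    rw [eval_sub, eval_mul, eval_C, hHf]
    refine ⟨-(z * v) - w * u * z - w * k * (p : ℤ) ^ m * z ^ 2, ?_⟩
    generalize evalEval x (eval x f) (derivative H) = D at *
    generalize evalEval x₀ y₀ (derivative H) = D₀ at *
    generalize evalEval x (eval x f) H = E at *
    have hD : D = D₀ + p * u := by linear_combination hu'
    subst hD
    have : y = eval x f + (p : ℤ) ^ (m + 1) * z := by linear_combination hz
    subst this
    linear_combination -w * hk - (p : ℤ) ^ (m + 1) * z * hv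

open Finset in
theorem Finset.card_choose_two_le_sum (s : Finset ℕ) : (#s).choose 2 ≤ ∑ i ∈ s, i := by
  induction s using Finset.induction_on_max with
  | empty => simp
  | insert a s ha ih =>
    have hna : a ∉ s := fun h ↦ (ha a h).false
    have hle : #s ≤ a := by
      simpa using card_le_card (fun x hx ↦ mem_range.mpr (ha x hx) : s ⊆ range a)
    rw [card_insert_of_notMem hna, sum_insert hna, Nat.choose_succ_succ' _ 1, Nat.choose_one_right]
    exact Nat.add_le_add hle ih

open Polynomial Finset in
theorem Polynomial.pow_choose_two_dvd_det_eval {ι : Type*} [Fintype ι] [DecidableEq ι]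
    (P : ι → ℤ[X]) (x : ι → ℤ) (q x₀ : ℤ) (hx : ∀ i, q ∣ x i - x₀) :
    q ^ (Fintype.card ι).choose 2 ∣ (Matrix.of fun i j ↦ (P j).eval (x i)).det := by
  choose u hu using hx
  let Q : ι → ℤ[X] := fun j ↦ (P j).comp (X + C x₀)
  let K := univ.sup fun j ↦ (Q j).natDegree + 1
  have hQ : ∀ i j, (P j).eval (x i) = ∑ k : Fin K, (Q j).coeff k * (q * u i) ^ (k : ℕ) := by
    intro i j
    have h1 : (P j).eval (x i) = (Q j).eval (q * u i) := by
      simp only [Q, eval_comp, eval_add, eval_X, eval_C]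
      rw [← hu i, sub_add_cancel]
    have hK : (Q j).natDegree < K :=
      Nat.lt_of_succ_le (Finset.le_sup (f := fun j ↦ (Q j).natDegree + 1) (mem_univ j))
    rw [h1, eval_eq_sum_range' hK, sum_range]
  have hdet : (Matrix.of fun i j ↦ (P j).eval (x i)).det =
      ∑ r : ι → Fin K, (Matrix.of fun j i ↦ (Q j).coeff (r j) * (q * u i) ^ (r j : ℕ)).det := by
    rw [← Matrix.det_transpose]
    have h2 := (Matrix.detRowAlternating (R := ℤ) (n := ι)).toMultilinearMap.map_sum
      (fun j (k : Fin K) ↦ fun i ↦ (Q j).coeff k * (q * u i) ^ (k : ℕ))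
    refine Eq.trans ?_ h2
    change Matrix.det _ = Matrix.det _
    congr 1
    ext j i
    simp [hQ, Finset.sum_apply]
  rw [hdet]
  refine dvd_sum fun r _ ↦ ?_
  have hfac : (Matrix.of fun j i ↦ (Q j).coeff (r j) * (q * u i) ^ (r j : ℕ)).det =
      (∏ j, (Q j).coeff (r j) * q ^ (r j : ℕ)) * (Matrix.of fun j i ↦ u i ^ (r j : ℕ)).det := by
    rw [← Matrix.det_mul_column]
    congr 1
    ext j i
    simp [mul_pow, mul_assoc]
  rw [hfac]
  by_cases hr : Function.Injective r
  · refine Dvd.dvd.mul_right ?_ _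
    rw [prod_mul_distrib, prod_pow_eq_pow_sum]
    refine Dvd.dvd.mul_left (pow_dvd_pow _ ?_) _
    have h3 := Finset.card_choose_two_le_sum (univ.image fun j ↦ (r j : ℕ))
    have hinj : Function.Injective fun j ↦ (r j : ℕ) := Fin.val_injective.comp hr
    rwa [card_image_of_injective _ hinj, sum_image (fun a _ b _ h ↦ hinj h), card_univ] at h3
  · obtain ⟨a, b, hab, hne⟩ := Function.not_injective_iff.mp hr
    rw [Matrix.det_zero_of_row_eq hne (by ext i; simp [hab]), mul_zero]
    exact dvd_zero _

open Polynomial in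
theorem Polynomial.pow_dvd_det_of_evalEval_eq_zero {ι : Type*} [Fintype ι] [DecidableEq ι]
    (H : ℤ[X][X]) {p : ℕ} (hp : p.Prime) {e : ℕ} (he : e ≠ 0) (x₀ y₀ : ℤ)
    (hu : ¬ (p : ℤ) ∣ (derivative H).evalEval x₀ y₀) (x y : ι → ℤ) (a b : ι → ℕ)
    (hx : ∀ i, x i ≡ x₀ [ZMOD (p : ℤ) ^ e]) (hy : ∀ i, y i ≡ y₀ [ZMOD p])
    (hH : ∀ i, H.evalEval (x i) (y i) = 0) :
    ((p : ℤ) ^ e) ^ (Fintype.card ι).choose 2 ∣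
      (Matrix.of fun i j ↦ x i ^ a j * y i ^ b j).det := by
  obtain ⟨f, hf⟩ := exists_eval_congr_of_evalEval_eq_zero H hp x₀ y₀ hu
    (e * (Fintype.card ι).choose 2)
  have hdvd := pow_choose_two_dvd_det_eval (fun j ↦ (X ^ a j * f ^ b j : ℤ[X])) x
    ((p : ℤ) ^ e) x₀ (fun i ↦ Int.modEq_iff_dvd.mp (hx i).symm)
  rw [← pow_mul] at hdvd ⊢
  have hmod : ∀ i, y i ≡ f.eval (x i) [ZMOD (p : ℤ) ^ (e * (Fintype.card ι).choose 2)] :=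
    fun i ↦ (Int.modEq_iff_dvd.mpr ((pow_dvd_pow _ (Nat.le_succ _)).trans
      (hf _ _ ((hx i).of_dvd (dvd_pow_self _ he)) (hy i) (hH i)))).symm
  have hcongr : (Matrix.of fun i j ↦ x i ^ a j * y i ^ b j).det ≡
      (Matrix.of fun i j ↦ (X ^ a j * f ^ b j : ℤ[X]).eval (x i)).det
        [ZMOD (p : ℤ) ^ (e * (Fintype.card ι).choose 2)] := by
    rw [Matrix.det_apply', Matrix.det_apply']
    refine Int.ModEq.sum fun σ _ ↦ Int.ModEq.mul_left _ (Int.ModEq.prod fun i _ ↦ ?_)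
    simpa using ((hmod (σ i)).pow (b i)).mul_left _
  exact hcongr.dvd_iff.mpr hdvd

open Polynomial in
theorem Polynomial.natDegree_det_le_of_forall {R n : Type*} [CommRing R] [Fintype n] [DecidableEq n]
    (A : Matrix n n R[X]) {D : ℕ} (hA : ∀ i j, (A i j).natDegree ≤ D) :
    A.det.natDegree ≤ Fintype.card n * D := by
  rw [Matrix.det_apply]
  refine natDegree_sum_le_of_forall_le _ _ fun σ _ ↦ ?_
  refine (natDegree_smul_le _ _).trans ((natDegree_prod_le _ _).trans ?_)
  refine (Finset.sum_le_card_nsmul _ _ D fun i _ ↦ hA _ _).trans ?_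
  simp

open Polynomial in
theorem Polynomial.natDegree_resultant_le_of_forall {R : Type*} [CommRing R] (F G : R[X][X])
    {m n D : ℕ} (hF : ∀ j, (F.coeff j).natDegree ≤ D) (hG : ∀ j, (G.coeff j).natDegree ≤ D) :
    (F.resultant G m n).natDegree ≤ (m + n) * D := by
  have := natDegree_det_le_of_forall (sylvester F G m n) (D := D) (fun i j ↦ ?_)
  · simpa [resultant] using this
  · induction j using Fin.addCases <;> simp only [sylvester, Matrix.of_apply, Fin.addCases_left,
      Fin.addCases_right] <;> split_ifs <;> simp [hF, hG]

open Polynomial in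
theorem Polynomial.resultant_ne_zero_of_irreducible {K : Type*} [Field K] {F G : K[X][X]}
    (hF : Irreducible F) (hG : G ≠ 0) (hdeg : G.natDegree < F.natDegree) :
    F.resultant G ≠ 0 := by
  have hF' : Irreducible (F.map (algebraMap K[X] (FractionRing K[X]))) :=
    (hF.isPrimitive (by omega)).irreducible_iff_irreducible_map_fraction_map.mp hF
  have hinj : Function.Injective (algebraMap K[X] (FractionRing K[X])) :=
    FaithfulSMul.algebraMap_injective _ _
  intro h0
  have h1 := resultant_map_map F G F.natDegree G.natDegree (algebraMap K[X] (FractionRing K[X]))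
  rw [h0, map_zero] at h1
  have h2 : resultant (F.map (algebraMap K[X] (FractionRing K[X])))
      (G.map (algebraMap K[X] (FractionRing K[X]))) = 0 := by
    rw [natDegree_map_eq_of_injective hinj, natDegree_map_eq_of_injective hinj, h1]
  refine (resultant_eq_zero_iff.mp h2).2 ((hF'.coprime_iff_not_dvd).mpr fun hdvd ↦ ?_)
  have h3 := natDegree_le_of_dvd hdvd ((Polynomial.map_ne_zero_iff hinj).mpr hG)
  rw [natDegree_map_eq_of_injective hinj, natDegree_map_eq_of_injective hinj] at h3
  omega

open Polynomial Finset in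
theorem Polynomial.card_common_zeros_le {K : Type*} [Field K] {F G : K[X][X]} {d n : ℕ} {c : K}
    (hF : Irreducible F) (hd : F.natDegree = d) (hc : F.leadingCoeff = C c)
    (hFX : ∀ j, (F.coeff j).natDegree ≤ d) (hG : G ≠ 0) (hGd : G.natDegree < d)
    (hGX : ∀ j, (G.coeff j).natDegree ≤ n) (T : Finset (K × K))
    (hTF : ∀ P ∈ T, F.evalEval P.1 P.2 = 0) (hTG : ∀ P ∈ T, G.evalEval P.1 P.2 = 0) :
    #T ≤ 2 * d ^ 2 * (d + n) := by
  classical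
  have hc0 : c ≠ 0 := by
    rintro rfl
    rw [map_zero, leadingCoeff_eq_zero] at hc
    exact hF.ne_zero hc
  have hR := resultant_ne_zero_of_irreducible hF hG (hd ▸ hGd)
  have hRdeg := natDegree_resultant_le_of_forall F G (m := F.natDegree) (n := G.natDegree)
    (D := d + n) (fun j ↦ (hFX j).trans (by omega)) (fun j ↦ (hGX j).trans (by omega))
  obtain ⟨p, q, -, -, hpq⟩ := exists_mul_add_mul_eq_C_resultant F G le_rfl le_rfl
    (Or.inl (by omega : F.natDegree ≠ 0))
  have hroot : ∀ P ∈ T, P.1 ∈ (F.resultant G).roots.toFinset := by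
    intro P hP
    rw [Multiset.mem_toFinset, mem_roots hR, IsRoot, ← evalEval_C P.1 P.2, ← hpq]
    simp [evalEval_add, evalEval_mul, hTF P hP, hTG P hP]
  have hfib : ∀ a ∈ (F.resultant G).roots.toFinset, #{P ∈ T | P.1 = a} ≤ d := by
    intro a _
    have hcoeff : (F.map (evalRingHom a)).coeff d = c := by
      rw [coeff_map, ← hd, coeff_natDegree, hc, coe_evalRingHom, eval_C]
    have hFa : F.map (evalRingHom a) ≠ 0 := fun h ↦ hc0 (by rw [← hcoeff, h, coeff_zero])
    have hsub : ({P ∈ T | P.1 = a}.image Prod.snd) ⊆ (F.map (evalRingHom a)).roots.toFinset := by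
      intro b hb
      obtain ⟨P, hP, rfl⟩ := mem_image.mp hb
      obtain ⟨hPT, rfl⟩ := mem_filter.mp hP
      rw [Multiset.mem_toFinset, mem_roots hFa, IsRoot, map_evalRingHom_eval, hTF P hPT]
    rw [← card_image_of_injOn (f := Prod.snd) (s := {P ∈ T | P.1 = a})]
    · refine (card_le_card hsub).trans ((Multiset.toFinset_card_le _).trans
        ((card_roots' _).trans (natDegree_map_le.trans hd.le)))
    · intro P hP Q hQ h
      simp only [coe_filter, Set.mem_ofPred_eq] at hP hQ
      exact Prod.ext (hP.2.trans hQ.2.symm) h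
  calc #T ≤ d * #(F.resultant G).roots.toFinset := card_le_mul_card_image_of_maps_to hroot d hfib
    _ ≤ d * ((d + d) * (d + n)) := by
      refine Nat.mul_le_mul_left _ ((Multiset.toFinset_card_le _).trans
        ((card_roots' _).trans (hRdeg.trans ?_)))
      exact Nat.mul_le_mul_right _ (by omega)
    _ = 2 * d ^ 2 * (d + n) := by ring

theorem LinearMap.eq_zero_of_span_eq_top {K ι κ : Type*} [Field K] [Fintype ι] {w : κ → ι → K}
    (hw : Submodule.span K (Set.range w) = ⊤) (c : ι → K)
    (hc : ∀ i, ∑ j, c j * w i j = 0) : c = 0 := by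
  classical
  have h : Fintype.linearCombination K c = 0 := by
    refine LinearMap.ext_on_range hw fun i ↦ ?_
    simpa [Fintype.linearCombination_apply, mul_comm] using hc i
  ext j
  simpa using LinearMap.congr_fun h (Pi.single j 1)

open Finset in
theorem Matrix.exists_det_ne_zero_of_forall {K ι α : Type*} [Field K] [Fintype ι] [DecidableEq ι]
    (S : Finset α) (V : α → ι → K)
    (h : ∀ c : ι → K, (∀ P ∈ S, ∑ j, c j * V P j = 0) → c = 0) :
    ∃ g : ι → α, (∀ i, g i ∈ S) ∧ (Matrix.of fun i j ↦ V (g i) j).det ≠ 0 := by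
  obtain ⟨κ, a, ha, hspan, hli⟩ := exists_linearIndependent' K fun P : S ↦ V P
  have htop : Submodule.span K (Set.range fun P : S ↦ V P) = ⊤ := by
    by_contra hne
    obtain ⟨f, hf0, hf⟩ := Submodule.exists_le_ker_of_lt_top _ (lt_top_iff_ne_top.mpr hne)
    have hfe : ∀ v, f v = ∑ j, f (Pi.single j 1) * v j := by
      intro v
      conv_lhs => rw [pi_eq_sum_univ' v]
      simp [mul_comm]
    refine hf0 (LinearMap.ext fun v ↦ ?_)
    have hc := h (fun j ↦ f (Pi.single j 1)) fun P hP ↦ by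
      rw [← hfe]
      exact hf (Submodule.subset_span ⟨⟨P, hP⟩, rfl⟩)
    rw [hfe]
    exact Finset.sum_eq_zero fun j _ ↦ by rw [congrFun hc j]; simp
  let b := Module.Basis.mk hli (by rw [hspan, htop])
  let e : κ ≃ ι := b.indexEquiv (Pi.basisFun K ι)
  refine ⟨fun i ↦ a (e.symm i), fun i ↦ (a (e.symm i)).2, ?_⟩
  have hli' := hli.comp e.symm e.symm.injective
  have := (Matrix.linearIndependent_rows_iff_isUnit
    (A := Matrix.of fun i j ↦ V (a (e.symm i)) j)).mp hli'
  exact ((Matrix.isUnit_iff_isUnit_det _).mp this).ne_zero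

open Finset in
theorem Int.exists_small_solution {ι α : Type*} [Fintype ι] (S : Finset α) (V : α → ι → ℤ) {A : ℕ}
    (hA : 1 ≤ A) (hV : ∀ P ∈ S, ∀ j, |V P j| ≤ A) (c : ι → ℂ) (hc : c ≠ 0)
    (hcV : ∀ P ∈ S, ∑ j, c j * (V P j : ℂ) = 0) :
    ∃ t : ι → ℤ, t ≠ 0 ∧ (∀ P ∈ S, ∑ j, t j * V P j = 0) ∧
      ∀ j, |t j| ≤ (Fintype.card ι * A : ℕ) ^ Fintype.card ι := by
  classical
  obtain ⟨κ, a, ha, hspan, hli⟩ :=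
    exists_linearIndependent' ℂ fun (P : S) (j : ι) ↦ (V P j : ℂ)
  have hfin : Finite κ := Finite.of_injective a ha
  have := Fintype.ofFinite κ
  obtain ⟨j₀, -⟩ := Function.ne_iff.mp hc
  have hι : 0 < Fintype.card ι := Fintype.card_pos_iff.mpr ⟨j₀⟩
  have hlt : Fintype.card κ < Fintype.card ι := by
    refine lt_of_le_of_ne ?_ fun heq ↦ hc ?_
    · simpa using hli.fintype_card_le_finrank
    · refine LinearMap.eq_zero_of_span_eq_top (w := fun (P : S) j ↦ (V P j : ℂ)) ?_ c
        fun P ↦ hcV P P.2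
      rw [← hspan]
      exact hli.span_eq_top_of_card_eq_finrank' (by simpa using heq)
  obtain ⟨t, ht0, htV, htb⟩ : ∃ t : ι → ℤ, t ≠ 0 ∧
      (∀ i : κ, ∑ j, t j * V (a i) j = 0) ∧
      ∀ j, |t j| ≤ (Fintype.card ι * A : ℕ) ^ Fintype.card ι := by
    rcases Nat.eq_zero_or_pos (Fintype.card κ) with h0 | hpos
    · have := Fintype.card_eq_zero_iff.mp h0
      refine ⟨fun _ ↦ 1, fun h ↦ one_ne_zero (congrFun h j₀), fun i ↦ isEmptyElim i, fun j ↦ ?_⟩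
      have : 1 ≤ (Fintype.card ι * A) ^ Fintype.card ι := Nat.one_le_pow _ _ (Nat.mul_pos hι hA)
      rw [abs_one]
      exact_mod_cast this
    · obtain ⟨t, ht0, htV, htb⟩ := Int.Matrix.exists_ne_zero_int_vec_norm_le
        (Matrix.of fun (i : κ) j ↦ V (a i) j) hlt hpos
      refine ⟨t, ht0, fun i ↦ ?_, fun j ↦ ?_⟩
      · simpa [Matrix.mulVec, dotProduct, mul_comm] using congrFun htV i
      · have hA' : (1 : ℝ) ≤ A := by exact_mod_cast hA
        have hc1 : (1 : ℝ) ≤ Fintype.card ι := by exact_mod_cast hι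
        let : SeminormedAddCommGroup (Matrix κ ι ℤ) := Matrix.seminormedAddCommGroup
        have hn : max 1 ‖(Matrix.of fun (i : κ) j ↦ V (a i) j)‖ ≤ (A : ℝ) := by
          refine max_le hA' ((Matrix.norm_le_iff (by positivity)).mpr fun i j ↦ ?_)
          rw [Int.norm_eq_abs]
          exact_mod_cast hV _ (a i).2 j
        have h1 : ‖t j‖ ≤ ((Fintype.card ι : ℝ) * A) ^ (Fintype.card ι : ℝ) := by
          refine (norm_le_pi_norm t j).trans (htb.trans ?_)
          refine (Real.rpow_le_rpow (by positivity) (mul_le_mul_of_nonneg_left hn (by positivity))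
            ?_).trans (Real.rpow_le_rpow_of_exponent_le (one_le_mul_of_one_le_of_one_le hc1 hA') ?_)
          · exact div_nonneg (by positivity) (sub_nonneg.mpr (by exact_mod_cast hlt.le))
          · have h2 : (Fintype.card κ : ℝ) + 1 ≤ Fintype.card ι := by exact_mod_cast hlt
            refine (div_le_self (by positivity) (by linarith)).trans (by linarith)
        rw [Real.rpow_natCast, Int.norm_eq_abs] at h1
        exact_mod_cast h1
  refine ⟨t, ht0, fun P hP ↦ ?_, htb⟩
  have hker : Submodule.span ℂ (Set.range fun (P : S) (j : ι) ↦ (V P j : ℂ)) ≤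
      LinearMap.ker (Fintype.linearCombination ℂ fun j ↦ (t j : ℂ)) := by
    rw [← hspan, Submodule.span_le]
    rintro _ ⟨i, rfl⟩
    have := congrArg (Int.cast : ℤ → ℂ) (htV i)
    simpa [Fintype.linearCombination_apply, mul_comm] using this
  have h3 : Fintype.linearCombination ℂ (fun j ↦ (t j : ℂ)) (fun j ↦ (V P j : ℂ)) = 0 :=
    hker (Submodule.subset_span ⟨⟨P, hP⟩, rfl⟩)
  simp only [Fintype.linearCombination_apply, smul_eq_mul] at h3
  have h4 : ((∑ j, t j * V P j : ℤ) : ℂ) = 0 := by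
    push_cast
    simpa [mul_comm] using h3
  exact_mod_cast h4

open Finset in
theorem Matrix.abs_det_mul_pow_le {ι : Type*} [Fintype ι] [DecidableEq ι] (x y : ι → ℤ)
    (a b : ι → ℕ) {B : ℕ} (hx : ∀ i, |x i| ≤ B) (hy : ∀ i, |y i| ≤ B) :
    |(Matrix.of fun i j ↦ x i ^ a j * y i ^ b j).det| ≤
      (Fintype.card ι).factorial * (B : ℤ) ^ ∑ j, (a j + b j) := by
  rw [Matrix.det_apply]
  refine (abs_sum_le_sum_abs _ _).trans ((sum_le_card_nsmul _ _
    ((B : ℤ) ^ ∑ j, (a j + b j)) fun σ _ ↦ ?_).trans ?_)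
  · rw [Units.smul_def, smul_eq_mul, abs_mul, Int.abs_eq_natAbs (σ.sign : ℤ), Int.units_natAbs,
      Nat.cast_one, one_mul, abs_prod, ← prod_pow_eq_pow_sum]
    refine prod_le_prod (fun _ _ ↦ abs_nonneg _) fun j _ ↦ ?_
    rw [Matrix.of_apply, abs_mul, abs_pow, abs_pow, pow_add]
    exact mul_le_mul (pow_le_pow_left₀ (abs_nonneg _) (hx _) _)
      (pow_le_pow_left₀ (abs_nonneg _) (hy _) _) (by positivity) (by positivity)
  · simp [Fintype.card_perm]

open Polynomial Finset in
theorem Polynomial.exists_interpolation {n d : ℕ} (H : ℤ[X][X]) {p : ℕ} (hp : p.Prime) {e : ℕ}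
    (he : e ≠ 0) (x₀ y₀ : ℤ) (hu : ¬ (p : ℤ) ∣ (derivative H).evalEval x₀ y₀) {B : ℕ}
    (hB : (n * d).factorial * B ^ (∑ j : Fin n × Fin d, (j.1 + j.2 : ℕ)) <
      (p ^ e) ^ (n * d).choose 2)
    (S : Finset (ℤ × ℤ)) (hS : ∀ P ∈ S, |P.1| ≤ B ∧ |P.2| ≤ B ∧ H.evalEval P.1 P.2 = 0 ∧
      P.1 ≡ x₀ [ZMOD (p : ℤ) ^ e] ∧ P.2 ≡ y₀ [ZMOD p]) :
    ∃ c : Fin n × Fin d → ℂ, c ≠ 0 ∧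
      ∀ P ∈ S, ∑ j, c j * ((P.1 : ℂ) ^ (j.1 : ℕ) * (P.2 : ℂ) ^ (j.2 : ℕ)) = 0 := by
  by_contra! hcon
  obtain ⟨g, hgS, hg⟩ := Matrix.exists_det_ne_zero_of_forall S
    (fun P (j : Fin n × Fin d) ↦ (P.1 : ℂ) ^ (j.1 : ℕ) * (P.2 : ℂ) ^ (j.2 : ℕ)) fun c hc ↦ by
      by_contra hc0
      obtain ⟨P, hP, hne⟩ := hcon c hc0
      exact hne (hc P hP)
  set M : Matrix (Fin n × Fin d) (Fin n × Fin d) ℤ :=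
    Matrix.of fun i j ↦ (g i).1 ^ (j.1 : ℕ) * (g i).2 ^ (j.2 : ℕ) with hM
  have hM0 : M.det ≠ 0 := by
    intro h0
    have h1 := (Int.castRingHom ℂ).map_det M
    rw [h0, map_zero] at h1
    refine hg (Eq.trans ?_ h1.symm)
    congr 1
    ext i j
    simp [hM]
  have hdvd := pow_dvd_det_of_evalEval_eq_zero H hp he x₀ y₀ hu (fun i ↦ (g i).1)
    (fun i ↦ (g i).2) (fun j : Fin n × Fin d ↦ (j.1 : ℕ)) (fun j ↦ (j.2 : ℕ))
    (fun i ↦ (hS _ (hgS i)).2.2.2.1) (fun i ↦ (hS _ (hgS i)).2.2.2.2)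
    (fun i ↦ (hS _ (hgS i)).2.2.1)
  have hle := Matrix.abs_det_mul_pow_le (fun i ↦ (g i).1)
    (fun i ↦ (g i).2) (fun j : Fin n × Fin d ↦ (j.1 : ℕ)) (fun j ↦ (j.2 : ℕ))
    (fun i ↦ (hS _ (hgS i)).1) (fun i ↦ (hS _ (hgS i)).2.1)
  have h2 := Int.le_of_dvd (abs_pos.mpr hM0) ((dvd_abs _ _).mpr hdvd)
  simp only [Fintype.card_prod, Fintype.card_fin] at h2 hle
  have h3 := h2.trans hle
  have h4 : (p ^ e) ^ (n * d).choose 2 ≤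
      (n * d).factorial * B ^ (∑ j : Fin n × Fin d, (j.1 + j.2 : ℕ)) := by exact_mod_cast h3
  omega

/-- The bivariate polynomial `∑ c (a, b) X ^ a Y ^ b` with prescribed coefficients in a box. -/
noncomputable def Polynomial.ofCoeffs {R : Type*} [CommRing R] {n d : ℕ}
    (c : Fin n × Fin d → R) : Polynomial (Polynomial R) :=
  ∑ j, Polynomial.monomial (j.2 : ℕ) (Polynomial.monomial (j.1 : ℕ) (c j))

namespace Polynomial

section ofCoeffs

variable {R : Type*} [CommRing R] {n d : ℕ} (c : Fin n × Fin d → R)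

theorem coeff_coeff_ofCoeffs (j : Fin n × Fin d) :
    ((ofCoeffs c).coeff (j.2 : ℕ)).coeff (j.1 : ℕ) = c j := by
  rw [ofCoeffs, finsetSum_coeff, finsetSum_coeff, Finset.sum_eq_single j]
  · simp
  · intro i _ hi
    rw [coeff_monomial]
    split_ifs with h2
    · rw [coeff_monomial, if_neg]
      exact fun h1 ↦ hi (Prod.ext (Fin.ext h1) (Fin.ext h2))
    · simp
  · simp

theorem ofCoeffs_ne_zero (hc : c ≠ 0) : ofCoeffs c ≠ 0 := by
  intro h
  refine hc (_root_.funext fun j ↦ ?_)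
  rw [← coeff_coeff_ofCoeffs c j, h]
  simp

theorem natDegree_ofCoeffs_lt (hd : 0 < d) : (ofCoeffs c).natDegree < d := by
  have : (ofCoeffs c).natDegree ≤ d - 1 :=
    natDegree_sum_le_of_forall_le _ _ fun j _ ↦
      (natDegree_monomial_le _).trans (Nat.le_sub_one_of_lt j.2.2)
  omega

theorem natDegree_coeff_ofCoeffs_le (k : ℕ) : ((ofCoeffs c).coeff k).natDegree ≤ n - 1 := by
  rw [ofCoeffs, finsetSum_coeff]
  refine natDegree_sum_le_of_forall_le _ _ fun j _ ↦ ?_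
  rw [coeff_monomial]
  split_ifs
  · exact (natDegree_monomial_le _).trans (Nat.le_sub_one_of_lt j.1.2)
  · simp

theorem evalEval_ofCoeffs (x y : R) :
    (ofCoeffs c).evalEval x y = ∑ j, c j * (x ^ (j.1 : ℕ) * y ^ (j.2 : ℕ)) := by
  rw [ofCoeffs, evalEval_finsetSum]
  refine Finset.sum_congr rfl fun j _ ↦ ?_
  simp only [evalEval, eval_monomial, eval_mul, eval_pow, eval_C]
  ring

end ofCoeffs

/-- All monomials `X ^ i Y ^ j` of `G` satisfy `i + j ≤ k`. -/
def TotalDegreeLE {R : Type*} [CommRing R] (G : R[X][X]) (k : ℕ) : Prop :=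
  ∀ i j, k < i + j → (G.coeff j).coeff i = 0

section TotalDegreeLE

variable {R : Type*} [CommRing R] {G G' : R[X][X]} {k l : ℕ}

theorem TotalDegreeLE.mul (h : TotalDegreeLE G k) (h' : TotalDegreeLE G' l) :
    TotalDegreeLE (G * G') (k + l) := by
  intro i j hij
  rw [coeff_mul, finsetSum_coeff]
  refine Finset.sum_eq_zero fun u hu ↦ ?_
  rw [coeff_mul]
  refine Finset.sum_eq_zero fun v hv ↦ ?_
  rw [Finset.HasAntidiagonal.mem_antidiagonal] at hu hv
  rcases lt_or_ge k (v.1 + u.1) with h1 | h1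
  · rw [h _ _ h1, zero_mul]
  · rw [h' v.2 u.2 (by omega), mul_zero]

theorem TotalDegreeLE.pow (h : TotalDegreeLE G k) (m : ℕ) : TotalDegreeLE (G ^ m) (m * k) := by
  induction m with
  | zero =>
    intro i j hij
    rw [pow_zero, coeff_one]
    split_ifs with hj
    · rw [coeff_one, if_neg (by omega)]
    · simp
  | succ m ih => rw [pow_succ, Nat.succ_mul]; exact ih.mul h

theorem TotalDegreeLE.sum {ι : Type*} {s : Finset ι} {f : ι → R[X][X]}
    (h : ∀ i ∈ s, TotalDegreeLE (f i) k) : TotalDegreeLE (∑ i ∈ s, f i) k := by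
  intro i j hij
  rw [finsetSum_coeff, finsetSum_coeff]
  exact Finset.sum_eq_zero fun a ha ↦ h a ha i j hij

theorem TotalDegreeLE.mono (h : TotalDegreeLE G k) (hkl : k ≤ l) : TotalDegreeLE G l :=
  fun i j hij ↦ h i j (by omega)

theorem TotalDegreeLE.natDegree_le (h : TotalDegreeLE G k) : G.natDegree ≤ k :=
  natDegree_le_iff_coeff_eq_zero.mpr fun j hj ↦ ext fun i ↦ by simpa using h i j (by omega)

theorem TotalDegreeLE.natDegree_coeff_le (h : TotalDegreeLE G k) (j : ℕ) :
    (G.coeff j).natDegree ≤ k - j :=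
  natDegree_le_iff_coeff_eq_zero.mpr fun i hi ↦ h i j (by omega)

theorem totalDegreeLE_CC (r : R) : TotalDegreeLE (C (C r) : R[X][X]) 0 := by
  intro i j hij
  rw [coeff_C]
  split_ifs with hj
  · rw [coeff_C, if_neg (by omega)]
  · simp

theorem totalDegreeLE_linear (r : R) : TotalDegreeLE (C X + C (C r) * X : R[X][X]) 1 := by
  intro i j hij
  rw [coeff_add, coeff_C_mul, coeff_X, coeff_C, coeff_add]
  split_ifs with h1 h2 h2
  · omega
  · rw [coeff_X, if_neg (by omega)]; simp
  · simp [coeff_C]; omega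
  · simp

theorem totalDegreeLE_X : TotalDegreeLE (X : R[X][X]) 1 := by
  intro i j hij
  rw [coeff_X]
  split_ifs with h1
  · rw [coeff_one, if_neg (by omega)]
  · simp

end TotalDegreeLE

end Polynomial

open Polynomial Finset in
theorem MvPolynomial.exists_shear_coeff_ne_zero (F : MvPolynomial (Fin 2) ℤ) {d : ℕ}
    (hdeg : F.totalDegree = d) (hF : F ≠ 0) :
    ∃ t ∈ range (d + 1),
      ∑ m ∈ F.support with m 0 + m 1 = d, F.coeff m * (t : ℤ) ^ m 0 ≠ 0 := by
  let Q : ℤ[X] := ∑ m ∈ F.support with m 0 + m 1 = d, Polynomial.monomial (m 0) (F.coeff m)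
  have hQ : Q ≠ 0 := by
    obtain ⟨m, hm, hmd⟩ := exists_mem_eq_sup F.support (support_nonempty.mpr hF)
      fun s : Fin 2 →₀ ℕ ↦ s.sum fun _ e ↦ e
    have hm' : m 0 + m 1 = d := by
      rw [← hdeg, totalDegree, hmd, Finsupp.sum_fintype _ _ (by simp), Fin.sum_univ_two]
    intro h0
    have h1 : Q.coeff (m 0) = F.coeff m := by
      simp only [Q, finsetSum_coeff]
      rw [sum_eq_single m]
      · simp
      · intro b hb hne
        rw [Polynomial.coeff_monomial, if_neg]
        intro hbm
        refine hne (Finsupp.ext fun i ↦ ?_)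
        have := (mem_filter.mp hb).2
        fin_cases i <;> simp <;> omega
      · intro h
        exact absurd (mem_filter.mpr ⟨hm, hm'⟩) h
    rw [h0, Polynomial.coeff_zero] at h1
    exact mem_support_iff.mp hm h1.symm
  have hdegQ : Q.natDegree ≤ d := by
    refine natDegree_sum_le_of_forall_le _ _ fun m hm ↦ (natDegree_monomial_le _).trans ?_
    have := (mem_filter.mp hm).2
    omega
  by_contra! hcon
  refine hQ (eq_zero_of_natDegree_lt_card_of_eval_eq_zero' Q
    ((range (d + 1)).image fun t : ℕ ↦ (t : ℤ)) ?_ ?_)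
  · intro x hx
    obtain ⟨t, ht, rfl⟩ := mem_image.mp hx
    simp only [Q, eval_finsetSum, Polynomial.eval_monomial]
    exact hcon t ht
  · rw [card_image_of_injective _ Nat.cast_injective, card_range]
    omega

open Polynomial in
/-- The ring isomorphism `F(x, y) ↦ F(x + t y, y)` onto iterated polynomials. -/
noncomputable def MvPolynomial.shearEquiv {R : Type*} [CommRing R] (t : R) :
    MvPolynomial (Fin 2) R ≃ₐ[R] R[X][X] :=
  .ofAlgHom (aeval ![Polynomial.C Polynomial.X + Polynomial.C (Polynomial.C t) * Polynomial.X,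
      Polynomial.X])
    (aevalAeval (X 0 - C t * X 1) (X 1))
    (by ext <;> simp [← MvPolynomial.algebraMap_eq, ← Polynomial.algebraMap_eq])
    (by ext i; fin_cases i <;> simp [← MvPolynomial.algebraMap_eq, ← Polynomial.algebraMap_eq])

open Polynomial Finset in
theorem MvPolynomial.shearEquiv_eq_sum {R : Type*} [CommRing R] (t : R)
    (F : MvPolynomial (Fin 2) R) :
    shearEquiv t F = ∑ m ∈ F.support, Polynomial.C (Polynomial.C (F.coeff m)) *
      (Polynomial.C Polynomial.X + Polynomial.C (Polynomial.C t) * Polynomial.X) ^ m 0 *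
        Polynomial.X ^ m 1 := by
  change aeval _ F = _
  rw [aeval_def, eval₂_eq']
  refine sum_congr rfl fun m _ ↦ ?_
  simp [Fin.prod_univ_two, mul_assoc, ← Polynomial.algebraMap_eq]

open Polynomial Finset in
theorem MvPolynomial.evalEval_shearEquiv {R : Type*} [CommRing R] (t : R)
    (F : MvPolynomial (Fin 2) R) (x y : R) :
    (shearEquiv t F).evalEval x y = eval ![x + t * y, y] F := by
  rw [shearEquiv_eq_sum, evalEval_finsetSum, eval_eq']
  refine sum_congr rfl fun m _ ↦ ?_
  simp [evalEval_mul, evalEval_pow, evalEval_add, evalEval_C, Fin.prod_univ_two, mul_assoc]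

open Polynomial Finset in
theorem MvPolynomial.totalDegreeLE_shearEquiv {R : Type*} [CommRing R] (t : R)
    (F : MvPolynomial (Fin 2) R) : TotalDegreeLE (shearEquiv t F) F.totalDegree := by
  rw [shearEquiv_eq_sum]
  refine TotalDegreeLE.sum fun m hm ↦ ?_
  refine (((totalDegreeLE_CC _).mul ((totalDegreeLE_linear t).pow _)).mul (totalDegreeLE_X.pow
    _)).mono ?_
  have := le_totalDegree hm
  rw [Finsupp.sum_fintype _ _ (by simp), Fin.sum_univ_two] at this
  omega

open Polynomial Finset in
theorem MvPolynomial.eval_zero_coeff_shearEquiv {R : Type*} [CommRing R] (t : R)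
    (F : MvPolynomial (Fin 2) R) (d : ℕ) :
    ((shearEquiv t F).coeff d).eval 0 =
      ∑ m ∈ F.support with m 0 + m 1 = d, F.coeff m * t ^ m 0 := by
  rw [← coe_evalRingHom, ← Polynomial.coeff_map, shearEquiv_eq_sum, Polynomial.map_sum,
    finsetSum_coeff, sum_filter]
  refine sum_congr rfl fun m _ ↦ ?_
  simp only [Polynomial.map_mul, Polynomial.map_pow, Polynomial.map_add, Polynomial.map_C,
    coe_evalRingHom, Polynomial.eval_C, Polynomial.eval_X, Polynomial.map_X, map_zero, zero_add,
    mul_pow, ← Polynomial.C_pow]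
  rw [mul_assoc, mul_assoc, ← pow_add, ← mul_assoc, ← Polynomial.C_mul,
    Polynomial.coeff_C_mul,
    Polynomial.coeff_X_pow]
  simp [eq_comm]

open Polynomial Finset in
theorem MvPolynomial.exists_shear (F : MvPolynomial (Fin 2) ℤ) {d : ℕ}
    (hdeg : F.totalDegree = d) (hirr : Irreducible (map (Int.castRingHom ℂ) F)) :
    ∃ t : ℕ, t ≤ d ∧ ∃ G : ℤ[X][X], Irreducible (G.map (mapRingHom (Int.castRingHom ℂ))) ∧
      G.natDegree = d ∧ (∃ c : ℤ, G.leadingCoeff = Polynomial.C c) ∧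
      (∀ j, (G.coeff j).natDegree ≤ d) ∧
      ∀ x y, G.evalEval x y = eval ![x + t * y, y] F := by
  have hF : F ≠ 0 := by
    rintro rfl
    exact hirr.ne_zero (map_zero _)
  obtain ⟨t, ht, hne⟩ := exists_shear_coeff_ne_zero F hdeg hF
  rw [← eval_zero_coeff_shearEquiv] at hne
  have hbi := totalDegreeLE_shearEquiv (t : ℤ) F
  rw [hdeg] at hbi
  have hnat : (shearEquiv (t : ℤ) F).natDegree = d :=
    le_antisymm hbi.natDegree_le (le_natDegree_of_ne_zero fun h ↦
      hne (by rw [h, Polynomial.eval_zero]))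
  refine ⟨t, by simpa [Nat.lt_succ_iff] using ht, shearEquiv (t : ℤ) F, ?_, hnat,
    ⟨_, eq_C_of_natDegree_le_zero ?_⟩,
    fun j ↦ (hbi.natDegree_coeff_le j).trans (Nat.sub_le _ _), evalEval_shearEquiv _ _⟩
  · have hmap : (shearEquiv (t : ℤ) F).map (mapRingHom (Int.castRingHom ℂ)) =
        shearEquiv (t : ℂ) (map (Int.castRingHom ℂ) F) := by
      rw [shearEquiv_eq_sum, shearEquiv_eq_sum, support_map_of_injective _
        (Int.castRingHom ℂ).injective_int, Polynomial.map_sum]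
      refine sum_congr rfl fun m _ ↦ ?_
      simp only [Polynomial.map_mul, Polynomial.map_pow, Polynomial.map_add, Polynomial.map_C,
        Polynomial.map_X, coe_mapRingHom, coeff_map, Int.coe_castRingHom, Int.cast_natCast]
    rw [hmap]
    exact (MulEquiv.irreducible_iff (shearEquiv (t : ℂ))).mpr hirr
  · have := hbi.natDegree_coeff_le d
    rwa [Nat.sub_self, ← hnat] at this

open Polynomial Finset in
theorem Polynomial.card_int_common_zeros_le {G : ℤ[X][X]} {H : ℂ[X][X]} {d n : ℕ} {c : ℤ}
    (hG : Irreducible (G.map (mapRingHom (Int.castRingHom ℂ)))) (hd : G.natDegree = d)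
    (hc : G.leadingCoeff = C c) (hGX : ∀ j, (G.coeff j).natDegree ≤ d) (hH : H ≠ 0)
    (hHd : H.natDegree < d) (hHX : ∀ j, (H.coeff j).natDegree ≤ n) (T : Finset (ℤ × ℤ))
    (hTG : ∀ P ∈ T, G.evalEval P.1 P.2 = 0)
    (hTH : ∀ P ∈ T, H.evalEval (P.1 : ℂ) (P.2 : ℂ) = 0) :
    #T ≤ 2 * d ^ 2 * (d + n) := by
  classical
  have hinj : Function.Injective (mapRingHom (Int.castRingHom ℂ)) :=
    Polynomial.map_injective _ (Int.castRingHom ℂ).injective_int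
  have hinj' : Function.Injective (Prod.map ((↑) : ℤ → ℂ) ((↑) : ℤ → ℂ)) :=
    Int.cast_injective.prodMap Int.cast_injective
  rw [← card_image_of_injective T hinj']
  refine card_common_zeros_le (c := (c : ℂ)) hG (by rw [natDegree_map_eq_of_injective hinj, hd]) ?_
    (fun j ↦ ?_) hH hHd hHX _ ?_ ?_
  · rw [leadingCoeff_map_of_injective hinj, hc]
    simp
  · rw [coeff_map]
    exact natDegree_map_le.trans (hGX j)
  · simp only [forall_mem_image, Prod.map_fst, Prod.map_snd]
    intro P hP
    have := map_mapRingHom_evalEval (Int.castRingHom ℂ) G P.1 P.2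
    rw [hTG P hP, map_zero] at this
    exact this
  · simpa only [forall_mem_image, Prod.map_fst, Prod.map_snd] using hTH

open Polynomial Finset in
theorem Polynomial.ofCoeffs_coeff {R : Type*} [CommRing R] {G : R[X][X]} {n d : ℕ}
    (hG : G.natDegree < d) (hGX : ∀ j, (G.coeff j).natDegree < n) :
    ofCoeffs (fun j : Fin n × Fin d ↦ (G.coeff j.2).coeff j.1) = G := by
  have hd : 0 < d := by omega
  have hn : 0 < n := lt_of_le_of_lt (Nat.zero_le _) (hGX 0)
  ext j i
  by_cases hj : j < d
  · by_cases hi : i < n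
    · exact coeff_coeff_ofCoeffs (fun j : Fin n × Fin d ↦ (G.coeff j.2).coeff j.1)
        (⟨i, hi⟩, ⟨j, hj⟩)
    · rw [coeff_eq_zero_of_natDegree_lt ((hGX j).trans_le (not_lt.mp hi)),
        coeff_eq_zero_of_natDegree_lt]
      exact (natDegree_coeff_ofCoeffs_le _ j).trans_lt (by omega)
  · rw [coeff_eq_zero_of_natDegree_lt (hG.trans_le (not_lt.mp hj)),
      coeff_eq_zero_of_natDegree_lt ((natDegree_ofCoeffs_lt _ hd).trans_le (not_lt.mp hj))]

open Polynomial Finset in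
theorem Polynomial.abs_evalEval_derivative_ofCoeffs_le {d A B : ℕ} (hB : 1 ≤ B)
    (t : Fin (d + 1) × Fin (d + 1) → ℤ) (ht : ∀ j, |t j| ≤ A) {x y : ℤ} (hx : |x| ≤ B)
    (hy : |y| ≤ B) :
    |(derivative (ofCoeffs t)).evalEval x y| ≤ ((d + 1) ^ 2 * (A * (d * B ^ (2 * d))) : ℕ) := by
  have h : (derivative (ofCoeffs t)).evalEval x y =
      ∑ j, t j * ((j.2 : ℕ) * (x ^ (j.1 : ℕ) * y ^ (j.2 - 1 : ℕ))) := by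
    rw [ofCoeffs, derivative_sum, evalEval_finsetSum]
    refine sum_congr rfl fun j _ ↦ ?_
    rw [derivative_monomial]
    simp only [evalEval, eval_monomial, eval_mul, eval_pow, eval_C, eval_natCast]
    ring
  have hB' : (1 : ℤ) ≤ B := by exact_mod_cast hB
  rw [h]
  refine (abs_sum_le_sum_abs _ _).trans ((sum_le_card_nsmul _ _
    ((A : ℤ) * (d * B ^ (2 * d))) fun j _ ↦ ?_).trans (le_of_eq ?_))
  · rw [abs_mul, abs_mul, abs_mul, abs_pow, abs_pow, Nat.abs_cast]
    have h1 : ((j.2 : ℕ) : ℤ) ≤ d := by exact_mod_cast Nat.lt_succ_iff.mp j.2.2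
    have h2 : |x| ^ (j.1 : ℕ) * |y| ^ (j.2 - 1 : ℕ) ≤ (B : ℤ) ^ (2 * d) := by
      calc |x| ^ (j.1 : ℕ) * |y| ^ (j.2 - 1 : ℕ)
          ≤ (B : ℤ) ^ (j.1 : ℕ) * (B : ℤ) ^ (j.2 - 1 : ℕ) := by gcongr
        _ = (B : ℤ) ^ ((j.1 : ℕ) + (j.2 - 1 : ℕ)) := (pow_add _ _ _).symm
        _ ≤ (B : ℤ) ^ (2 * d) := pow_le_pow_right₀ hB' (by omega)
    have := ht j
    gcongr
  · simp [pow_two, mul_assoc]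

open Polynomial Finset in
/-- Integral points on a plane curve lie on an auxiliary curve of the same degree and controlled
height which meets the curve transversally to the second axis outside few points. -/
theorem Polynomial.exists_small_annihilator {G : ℤ[X][X]} {d : ℕ} {c : ℤ} (hd0 : d ≠ 0)
    (hG : Irreducible (G.map (mapRingHom (Int.castRingHom ℂ)))) (hd : G.natDegree = d)
    (hc : G.leadingCoeff = C c) (hGX : ∀ j, (G.coeff j).natDegree ≤ d) {B : ℕ} (hB : 1 ≤ B)
    (Z : Finset (ℤ × ℤ)) (hZ : ∀ P ∈ Z, |P.1| ≤ B ∧ |P.2| ≤ B ∧ G.evalEval P.1 P.2 = 0) :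
    ∃ H : ℤ[X][X], (∀ P ∈ Z, H.evalEval P.1 P.2 = 0) ∧
      #{P ∈ Z | (derivative H).evalEval P.1 P.2 = 0} ≤ 2 * d ^ 2 * (d + d) ∧
      ∀ P ∈ Z, |(derivative H).evalEval P.1 P.2| ≤
        ((d + 1) ^ 2 * (((d + 1) ^ 2 * B ^ (2 * d)) ^ (d + 1) ^ 2 * (d * B ^ (2 * d))) : ℕ) := by
  have hG0 : G ≠ 0 := by
    rintro rfl
    exact hG.ne_zero (Polynomial.map_zero _)
  have hGeq := ofCoeffs_coeff (n := d + 1) (d := d + 1) (G := G) (by omega)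
    (fun j ↦ Nat.lt_succ_of_le (hGX j))
  set γ : Fin (d + 1) × Fin (d + 1) → ℤ := fun j ↦ (G.coeff j.2).coeff j.1 with hγ
  have hγ0 : γ ≠ 0 := by
    intro h0
    refine hG0 ?_
    rw [← hGeq, h0]
    simp [ofCoeffs]
  obtain ⟨t, ht0, htZ, ht⟩ := Int.exists_small_solution Z
    (fun P (j : Fin (d + 1) × Fin (d + 1)) ↦ P.1 ^ (j.1 : ℕ) * P.2 ^ (j.2 : ℕ))
    (A := B ^ (2 * d)) (Nat.one_le_pow _ _ hB) (fun P hP j ↦ by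
      obtain ⟨h1, h2, -⟩ := hZ P hP
      rw [abs_mul, abs_pow, abs_pow]
      have hB' : (1 : ℤ) ≤ B := by exact_mod_cast hB
      calc |P.1| ^ (j.1 : ℕ) * |P.2| ^ (j.2 : ℕ) ≤ (B : ℤ) ^ (j.1 : ℕ) * (B : ℤ) ^ (j.2 : ℕ) := by
            gcongr
        _ = (B : ℤ) ^ ((j.1 : ℕ) + (j.2 : ℕ)) := (pow_add _ _ _).symm
        _ ≤ (B : ℤ) ^ (2 * d) := pow_le_pow_right₀ hB' (by omega)
        _ = _ := by push_cast; rfl)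
    (fun j ↦ (γ j : ℂ)) (fun h0 ↦ hγ0 (_root_.funext fun j ↦ by simpa using congr_fun h0 j))
    (fun P hP ↦ by
      have := (hZ P hP).2.2
      rw [← hGeq, evalEval_ofCoeffs] at this
      exact_mod_cast this)
  have htZ' : ∀ P ∈ Z, (ofCoeffs t).evalEval P.1 P.2 = 0 := fun P hP ↦ by
    rw [evalEval_ofCoeffs]
    exact htZ P hP
  have hH0 := ofCoeffs_ne_zero t ht0
  have hinj : Function.Injective (mapRingHom (Int.castRingHom ℂ)) :=
    Polynomial.map_injective _ (Int.castRingHom ℂ).injective_int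
  have key : ∀ H : ℤ[X][X], H ≠ 0 → H.natDegree < d → (∀ j, (H.coeff j).natDegree ≤ d) →
      ∀ T ⊆ Z, (∀ P ∈ T, H.evalEval P.1 P.2 = 0) → #T ≤ 2 * d ^ 2 * (d + d) := by
    intro H hH hHd hHX T hT hTH
    refine card_int_common_zeros_le (H := H.map (mapRingHom (Int.castRingHom ℂ))) hG hd hc hGX
      ((Polynomial.map_ne_zero_iff hinj).mpr hH)
      (by rwa [natDegree_map_eq_of_injective hinj]) (fun j ↦ ?_) T
      (fun P hP ↦ (hZ P (hT hP)).2.2) fun P hP ↦ ?_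
    · rw [coeff_map]
      exact natDegree_map_le.trans (hHX j)
    · have := map_mapRingHom_evalEval (Int.castRingHom ℂ) H P.1 P.2
      rw [hTH P hP, map_zero] at this
      exact this
  refine ⟨ofCoeffs t, htZ', ?_, fun P hP ↦ ?_⟩
  · by_cases h0 : (ofCoeffs t).natDegree = 0
    · exact key _ hH0 (by omega) (natDegree_coeff_ofCoeffs_le t) _ (filter_subset _ _)
        fun P hP ↦ htZ' P (mem_filter.mp hP).1
    · refine key (derivative (ofCoeffs t)) (fun h ↦ h0 (derivative_eq_zero.mp h))
        ((natDegree_derivative_lt h0).trans_le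
          (Nat.lt_succ_iff.mp (natDegree_ofCoeffs_lt t (Nat.succ_pos d)))) (fun j ↦ ?_) _
        (filter_subset _ _) fun P hP ↦ (mem_filter.mp hP).2
      rw [coeff_derivative, ← Nat.cast_succ, ← C_eq_natCast]
      exact (natDegree_mul_C_le _ _).trans (natDegree_coeff_ofCoeffs_le t _)
  · refine abs_evalEval_derivative_ofCoeffs_le hB t (fun j ↦ (ht j).trans (le_of_eq ?_))
      (hZ P hP).1 (hZ P hP).2.1
    simp [pow_two]

open Finset in
theorem Int.exists_prime_not_dvd_of_abs_lt {g : ℤ} (hg : g ≠ 0) {x : ℕ}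
    (hx : |g| < 2 ^ Nat.primeCounting x) : ∃ p ∈ Finset.range (x + 1), p.Prime ∧ ¬(p : ℤ) ∣ g := by
  by_contra! h
  have h1 : ∏ p ∈ Finset.range (x + 1) with p.Prime, p ∣ g.natAbs :=
    prod_primes_dvd _ (fun p hp ↦ (mem_filter.mp hp).2.prime) fun p hp ↦
      Int.natCast_dvd.mp (h p (mem_filter.mp hp).1 (mem_filter.mp hp).2)
  have h2 : 2 ^ Nat.primeCounting x ≤ ∏ p ∈ Finset.range (x + 1) with p.Prime, p := by
    rw [Nat.primeCounting, Nat.primeCounting', Nat.count_eq_card_filter_range]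
    exact pow_card_le_prod _ _ _ fun p hp ↦ (mem_filter.mp hp).2.two_le
  have h3 := h2.trans (Nat.le_of_dvd (Int.natAbs_pos.mpr hg) h1)
  zify at h3
  omega

open Polynomial Finset in
/-- The determinant method at a prime `p` at which the auxiliary curve `H` is smooth. -/
theorem Polynomial.card_le_of_prime {G H : ℤ[X][X]} {d n p e : ℕ} {c : ℤ}
    (hd0 : 0 < d) (hG : Irreducible (G.map (mapRingHom (Int.castRingHom ℂ))))
    (hd : G.natDegree = d) (hc : G.leadingCoeff = C c) (hGX : ∀ j, (G.coeff j).natDegree ≤ d)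
    (hp : p.Prime) (he : e ≠ 0) {B : ℕ}
    (hB : (n * d).factorial * B ^ (∑ j : Fin n × Fin d, (j.1 + j.2 : ℕ)) <
      (p ^ e) ^ (n * d).choose 2)
    (Z : Finset (ℤ × ℤ)) (hZ : ∀ P ∈ Z, |P.1| ≤ B ∧ |P.2| ≤ B ∧ G.evalEval P.1 P.2 = 0 ∧
      H.evalEval P.1 P.2 = 0 ∧ ¬(p : ℤ) ∣ (derivative H).evalEval P.1 P.2) :
    #Z ≤ p ^ e * p * (2 * d ^ 2 * (d + n)) := by
  classical
  have : NeZero p := ⟨hp.ne_zero⟩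
  have hcard : #(univ : Finset (ZMod (p ^ e) × ZMod p)) = p ^ e * p := by
    simp [ZMod.card]
  rw [← hcard, mul_comm]
  refine card_le_mul_card_image_of_maps_to
    (f := fun P : ℤ × ℤ ↦ ((P.1 : ZMod (p ^ e)), (P.2 : ZMod p)))
    (fun _ _ ↦ mem_univ _) _ fun r _ ↦ ?_
  rcases (Z.filter fun P : ℤ × ℤ ↦ ((P.1 : ZMod (p ^ e)), (P.2 : ZMod p)) = r).eq_empty_or_nonempty
    with h0 | ⟨P₀, hP₀⟩
  · simp [h0]
  obtain ⟨hP₀Z, hP₀r⟩ := mem_filter.mp hP₀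
  obtain ⟨c', hc', hZc'⟩ := exists_interpolation H hp he P₀.1 P₀.2 (hZ P₀ hP₀Z).2.2.2.2 hB
    (Z.filter fun P : ℤ × ℤ ↦ ((P.1 : ZMod (p ^ e)), (P.2 : ZMod p)) = r) fun P hP ↦ by
      obtain ⟨hPZ, hPr⟩ := mem_filter.mp hP
      obtain ⟨h1, h2, -, h3, -⟩ := hZ P hPZ
      rw [← hP₀r, Prod.mk.injEq, ZMod.intCast_eq_intCast_iff, ZMod.intCast_eq_intCast_iff] at hPr
      exact ⟨h1, h2, h3, by exact_mod_cast hPr.1, hPr.2⟩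
  exact card_int_common_zeros_le hG hd hc hGX (ofCoeffs_ne_zero c' hc')
    (natDegree_ofCoeffs_lt c' hd0)
    (fun j ↦ (natDegree_coeff_ofCoeffs_le c' j).trans (Nat.sub_le _ _)) _
    (fun P hP ↦ (hZ P (mem_filter.mp hP).1).2.2.1) fun P hP ↦ by
      rw [evalEval_ofCoeffs]
      exact hZc' P hP

open Polynomial Finset in
theorem Polynomial.card_integral_zeros_le {G : ℤ[X][X]} {d n x M B : ℕ} {c : ℤ} (hd0 : 0 < d)
    (hG : Irreducible (G.map (mapRingHom (Int.castRingHom ℂ)))) (hd : G.natDegree = d)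
    (hc : G.leadingCoeff = C c) (hGX : ∀ j, (G.coeff j).natDegree ≤ d) (hB : 1 ≤ B)
    (hx : (d + 1) ^ 2 * (((d + 1) ^ 2 * B ^ (2 * d)) ^ (d + 1) ^ 2 * (d * B ^ (2 * d))) <
      2 ^ Nat.primeCounting x) (hM0 : M ≠ 0) (hnd : 2 ≤ n * d)
    (hM : (n * d).factorial * B ^ (∑ j : Fin n × Fin d, (j.1 + j.2 : ℕ)) ≤ M ^ (n * d).choose 2)
    (Z : Finset (ℤ × ℤ)) (hZ : ∀ P ∈ Z, |P.1| ≤ B ∧ |P.2| ≤ B ∧ G.evalEval P.1 P.2 = 0) :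
    #Z ≤ 2 * d ^ 2 * (d + d) + x * (x ^ 2 * M * (2 * d ^ 2 * (d + n))) := by
  classical
  obtain ⟨H, hHZ, hH0, hHb⟩ := exists_small_annihilator hd0.ne' hG hd hc hGX hB Z hZ
  have hsub : Z ⊆ {P ∈ Z | (derivative H).evalEval P.1 P.2 = 0} ∪
      ((range (x + 1)).filter Nat.Prime).biUnion
        fun p ↦ {P ∈ Z | ¬(p : ℤ) ∣ (derivative H).evalEval P.1 P.2} := by
    intro P hP
    simp only [mem_union, mem_biUnion, mem_filter]
    by_cases h0 : (derivative H).evalEval P.1 P.2 = 0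
    · exact Or.inl ⟨hP, h0⟩
    · obtain ⟨p, hp, hpp, hpd⟩ := Int.exists_prime_not_dvd_of_abs_lt h0
        ((hHb P hP).trans_lt (by exact_mod_cast hx))
      exact Or.inr ⟨p, ⟨hp, hpp⟩, hP, hpd⟩
  refine (card_le_card hsub).trans ((card_union_le _ _).trans (add_le_add hH0 ?_))
  have hcount : #((range (x + 1)).filter Nat.Prime) ≤ x := by
    have : (range (x + 1)).filter Nat.Prime ⊆ Icc 1 x := fun p hp ↦ by
      simp only [mem_filter, mem_range] at hp
      exact mem_Icc.mpr ⟨hp.2.one_le, by omega⟩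
    simpa using card_le_card this
  refine (card_biUnion_le_card_mul _ _ (x ^ 2 * M * (2 * d ^ 2 * (d + n))) fun p hp ↦ ?_).trans
    (Nat.mul_le_mul_right _ hcount)
  simp only [mem_filter, mem_range] at hp
  have hlt := Nat.lt_pow_succ_log_self hp.2.one_lt M
  refine (card_le_of_prime (H := H) (e := Nat.log p M + 1) hd0 hG hd hc hGX hp.2
    (Nat.succ_ne_zero _) (hM.trans_lt (Nat.pow_lt_pow_left hlt (Nat.choose_pos hnd).ne')) _
    fun P hP ↦ ?_).trans (Nat.mul_le_mul_right _ ?_)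
  · obtain ⟨hPZ, hPp⟩ := mem_filter.mp hP
    obtain ⟨h1, h2, h3⟩ := hZ P hPZ
    exact ⟨h1, h2, h3, hHZ P hPZ, hPp⟩
  · calc p ^ (Nat.log p M + 1) * p = p ^ 2 * p ^ Nat.log p M := by ring
      _ ≤ x ^ 2 * M := Nat.mul_le_mul (Nat.pow_le_pow_left (by omega) _) (Nat.pow_log_le_self p hM0)

theorem Finset.two_mul_sum_fin_prod_add (n d : ℕ) :
    2 * ∑ j : Fin n × Fin d, (j.1 + j.2 : ℕ) + 2 * (n * d) = n * d * (n + d) := by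
  have h : ∀ m : ℕ, 2 * ∑ i : Fin m, (i : ℕ) + m = m * m := fun m ↦ by
    induction m with
    | zero => simp
    | succ m ih =>
      rw [Fin.sum_univ_castSucc]
      simp only [Fin.val_castSucc, Fin.val_last]
      linarith
  have hs : ∑ j : Fin n × Fin d, (j.1 + j.2 : ℕ) =
      d * ∑ i : Fin n, (i : ℕ) + n * ∑ i : Fin d, (i : ℕ) := by
    simp [Fintype.sum_prod_type, sum_add_distrib, mul_sum]
  rw [hs]
  linear_combination d * h n + n * h d

open Finset in
theorem Nat.factorial_mul_pow_sum_le {n d B M : ℕ} (hn : 0 < n) (hd : 0 < d) (hnd : 3 ≤ n * d)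
    (hB : 1 ≤ B) (hM : (n * d : ℝ) * (B : ℝ) ^ (1 / d + 1 / n : ℝ) ≤ M) :
    (n * d).factorial * B ^ (∑ j : Fin n × Fin d, (j.1 + j.2 : ℕ)) ≤ M ^ (n * d).choose 2 := by
  have hE := two_mul_sum_fin_prod_add n d
  set E := ∑ j : Fin n × Fin d, (j.1 + j.2 : ℕ)
  have hB' : (1 : ℝ) ≤ B := by exact_mod_cast hB
  have hchoose : (((n * d).choose 2 : ℕ) : ℝ) = n * d * (n * d - 1) / 2 := by
    rw [Nat.cast_choose_two]; push_cast; ring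
  have h1 : (n * d).factorial ≤ (n * d) ^ (n * d).choose 2 := by
    refine (Nat.factorial_le_pow _).trans (Nat.pow_le_pow_right (by omega) ?_)
    rw [Nat.choose_two_right, Nat.le_div_iff_mul_le two_pos]
    exact Nat.mul_le_mul_left _ (by omega)
  have h2 : (B : ℝ) ^ E ≤ ((B : ℝ) ^ (1 / d + 1 / n : ℝ)) ^ (n * d).choose 2 := by
    rw [← Real.rpow_natCast, ← Real.rpow_natCast, ← Real.rpow_mul (by positivity), hchoose]
    refine Real.rpow_le_rpow_of_exponent_le hB' ?_
    have hE' : (2 * E + 2 * (n * d) : ℝ) = n * d * (n + d) := by exact_mod_cast hE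
    have hn' : (1 : ℝ) ≤ n := by exact_mod_cast hn
    have hd' : (1 : ℝ) ≤ d := by exact_mod_cast hd
    have : (1 / d + 1 / n : ℝ) * (n * d * (n * d - 1) / 2) = (n + d) * (n * d - 1) / 2 := by
      field_simp
    rw [this]
    nlinarith [mul_nonneg (sub_nonneg.mpr hn') (sub_nonneg.mpr hd')]
  have h3 : ((n * d).factorial * B ^ E : ℝ) ≤ (M : ℝ) ^ (n * d).choose 2 :=
    calc ((n * d).factorial * B ^ E : ℝ)
        ≤ (n * d : ℝ) ^ (n * d).choose 2 * ((B : ℝ) ^ (1 / d + 1 / n : ℝ)) ^ (n * d).choose 2 := by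
          gcongr
          exact_mod_cast h1
      _ = ((n * d : ℝ) * (B : ℝ) ^ (1 / d + 1 / n : ℝ)) ^ (n * d).choose 2 := (mul_pow _ _ _).symm
      _ ≤ (M : ℝ) ^ (n * d).choose 2 := by gcongr
  exact_mod_cast h3

theorem Nat.le_primeCounting_sq {k : ℕ} (hk : 100 ≤ k) : k ≤ Nat.primeCounting (k ^ 2) := by
  have hk' : (100 : ℝ) ≤ k := by exact_mod_cast hk
  have hk0 : (0 : ℝ) < k := by linarith
  have hlog : Real.log k ≤ 2 * √k := by
    have := Real.log_le_sub_one_of_pos (Real.sqrt_pos.mpr hk0)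
    rw [Real.log_sqrt hk0.le] at this
    linarith
  have hlog0 : 0 < Real.log k := Real.log_pos (by linarith)
  have hsq : √(k : ℝ) ^ 2 = k := Real.sq_sqrt hk0.le
  have hs10 : (10 : ℝ) ≤ √k := Real.le_sqrt_of_sq_le (by linarith)
  have h1 := Chebyshev.pi_ge (k ^ 2)
  have h2 : Real.log ((k ^ 2 : ℕ) : ℝ) = 2 * Real.log k := by
    push_cast
    rw [Real.log_pow]
    norm_num
  have h3 : Real.log (((k ^ 2 : ℕ) : ℝ) + 1) ≤ 2 * k := by
    push_cast
    calc Real.log ((k : ℝ) ^ 2 + 1) ≤ Real.log (((k : ℝ) + 1) ^ 2) :=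
          Real.log_le_log (by positivity) (by nlinarith)
      _ = 2 * Real.log (k + 1) := by rw [Real.log_pow]; norm_num
      _ ≤ 2 * k := by
          have := Real.log_le_sub_one_of_pos (by linarith : (0 : ℝ) < k + 1)
          linarith
  rw [h2] at h1
  have h4 : (k : ℝ) ≤ (((k ^ 2 : ℕ) : ℝ) * Real.log 2 - Real.log (((k ^ 2 : ℕ) : ℝ) + 1)) /
      (2 * Real.log k) := by
    rw [le_div_iff₀ (by positivity)]
    have h5 := Real.log_two_gt_d9
    push_cast at h3 ⊢
    have h6 : 4 * √(k : ℝ) + 2 ≤ 0.69 * k := by nlinarith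
    nlinarith [mul_le_mul_of_nonneg_left h6 hk0.le, mul_le_mul_of_nonneg_left hlog hk0.le,
      mul_le_mul_of_nonneg_left h5.le (sq_nonneg (k : ℝ))]
  exact_mod_cast h4.trans h1

theorem Nat.height_lt_two_pow_of_le {d B k : ℕ} {R : ℝ} (hd : 2 ≤ d) (hR8 : 8 ≤ R)
    (hdR : 4 * (d : ℝ) ≤ R) (hB : 1 ≤ B) (hlogB : Real.log B ≤ 2 * R ^ 2) (hk : R ^ 5 ≤ k) :
    (d + 1) ^ 2 * (((d + 1) ^ 2 * B ^ (2 * d)) ^ (d + 1) ^ 2 * (d * B ^ (2 * d))) < 2 ^ k := by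
  have hd' : (2 : ℝ) ≤ d := by exact_mod_cast hd
  have hB' : (1 : ℝ) ≤ B := by exact_mod_cast hB
  have hlog : Real.log (((d + 1) ^ 2 * (((d + 1) ^ 2 * B ^ (2 * d)) ^ (d + 1) ^ 2 *
      (d * B ^ (2 * d))) : ℕ) : ℝ) = 2 * Real.log (d + 1) + ((d + 1) ^ 2 *
        (2 * Real.log (d + 1) + 2 * d * Real.log B) + (Real.log d + 2 * d * Real.log B)) := by
    push_cast
    rw [Real.log_mul (by positivity) (by positivity), Real.log_mul (by positivity) (by positivity),
      Real.log_pow, Real.log_pow, Real.log_mul (by positivity) (by positivity),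
      Real.log_mul (by positivity) (by positivity), Real.log_pow, Real.log_pow]
    push_cast
    ring
  have h1 : Real.log (d + 1) ≤ d := by
    have := Real.log_le_sub_one_of_pos (by linarith : (0 : ℝ) < d + 1)
    linarith
  have h2 : Real.log d ≤ d :=
    (Real.log_le_log (by linarith) (by linarith)).trans h1
  have h3 : 2 * (d : ℝ) * Real.log B ≤ R ^ 3 :=
    calc 2 * (d : ℝ) * Real.log B ≤ 2 * (R / 4) * (2 * R ^ 2) := by
          have := Real.log_nonneg hB'
          gcongr
          linarith
      _ = R ^ 3 := by ring
  have h4 : ((d : ℝ) + 1) ^ 2 ≤ R ^ 2 / 4 := by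
    have : (d : ℝ) + 1 ≤ R / 2 := by linarith
    calc ((d : ℝ) + 1) ^ 2 ≤ (R / 2) ^ 2 := by gcongr
      _ = R ^ 2 / 4 := by ring
  have h5 : ((d : ℝ) + 1) ^ 2 * (2 * Real.log (d + 1) + 2 * d * Real.log B) ≤
      R ^ 2 / 4 * (R / 2 + R ^ 3) := by
    refine mul_le_mul h4 (by linarith) ?_ (by positivity)
    have := Real.log_nonneg hB'
    have := Real.log_nonneg (by linarith : (1 : ℝ) ≤ d + 1)
    positivity
  have h6 : R / 2 + (R ^ 2 / 4 * (R / 2 + R ^ 3) + (R / 4 + R ^ 3)) ≤ R ^ 5 / 2 := by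
    have e1 : 8 * R ^ 4 ≤ R ^ 5 := by nlinarith [pow_pos (by linarith : 0 < R) 4]
    have e2 : 8 * R ^ 3 ≤ R ^ 4 := by nlinarith [pow_pos (by linarith : 0 < R) 3]
    have e3 : R ≤ R ^ 3 := le_self_pow₀ (by linarith) (by norm_num)
    nlinarith
  have hk0 : (0 : ℝ) < k := lt_of_lt_of_le (by positivity) hk
  have h7 : Real.log (((d + 1) ^ 2 * (((d + 1) ^ 2 * B ^ (2 * d)) ^ (d + 1) ^ 2 *
      (d * B ^ (2 * d))) : ℕ) : ℝ) < Real.log ((2 : ℝ) ^ k) := by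
    rw [hlog, Real.log_pow]
    nlinarith [Real.log_two_gt_d9]
  have h8 := (Real.log_lt_log_iff (by positivity) (by positivity)).mp h7
  exact_mod_cast h8

theorem Real.pow_mul_exp_sqrt_le {d : ℕ} {L : ℝ} (hd : 2 ≤ d) (hL : 64 ≤ L) :
    √L ^ 39 * Real.exp √L ≤ Real.exp (12 * √(d * L * Real.log L)) := by
  have hd' : (2 : ℝ) ≤ d := by exact_mod_cast hd
  have hR8 : 8 ≤ √L := Real.le_sqrt_of_sq_le (by linarith)
  have hlogL : 2 ≤ Real.log L := by
    rw [Real.le_log_iff_exp_le (by linarith)]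
    have h1 := Real.exp_one_lt_d9
    have h2 : Real.exp 2 = Real.exp 1 * Real.exp 1 := by rw [← Real.exp_add]; norm_num
    nlinarith [Real.exp_pos 1]
  have h1 : Real.log √L ≤ √L / 2 := by
    have h2 : 0 < √(√L) := Real.sqrt_pos.mpr (by linarith)
    have h3 := Real.log_le_sub_one_of_pos h2
    rw [Real.log_sqrt (by linarith)] at h3
    nlinarith [Real.sq_sqrt (by linarith : 0 ≤ √L), sq_nonneg (√(√L) - 2)]
  have h4 : 2 * √L ≤ √(d * L * Real.log L) := by
    refine Real.le_sqrt_of_sq_le ?_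
    rw [mul_pow, Real.sq_sqrt (by linarith)]
    nlinarith [mul_le_mul hd' hlogL (by norm_num) (by linarith)]
  rw [← Real.exp_log (by positivity : 0 < √L ^ 39), ← Real.exp_add, Real.exp_le_exp,
    Real.log_pow]
  push_cast
  linarith

theorem Real.mul_rpow_inv_add_inv_le {N R : ℝ} {d n B : ℕ} (hd : 2 ≤ d) (hn : 2 ≤ n)
    (hN : 1 ≤ N) (hdR : (d : ℝ) + 1 ≤ R) (hB : (B : ℝ) ≤ (d + 1) * N)
    (hnR : Real.log N ≤ R * n) :
    (B : ℝ) ^ (1 / d + 1 / n : ℝ) ≤ R * (N ^ (1 / d : ℝ) * Real.exp R) := by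
  have hd' : (2 : ℝ) ≤ d := by exact_mod_cast hd
  have hn' : (2 : ℝ) ≤ n := by exact_mod_cast hn
  have hR0 : 0 ≤ R := by linarith
  have hθ : (1 / d + 1 / n : ℝ) ≤ 1 := by
    have h1 : (1 / d : ℝ) ≤ 1 / 2 := by gcongr
    have h2 : (1 / n : ℝ) ≤ 1 / 2 := by gcongr
    linarith
  have h1 : ((d : ℝ) + 1) ^ (1 / d + 1 / n : ℝ) ≤ R :=
    (Real.rpow_le_rpow_of_exponent_le (by linarith) hθ).trans (by rwa [Real.rpow_one])
  have h2 : N ^ (1 / n : ℝ) ≤ Real.exp R := by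
    rw [Real.rpow_def_of_pos (by linarith), Real.exp_le_exp, mul_one_div, div_le_iff₀ (by linarith)]
    exact hnR
  calc (B : ℝ) ^ (1 / d + 1 / n : ℝ) ≤ ((d + 1) * N) ^ (1 / d + 1 / n : ℝ) := by gcongr
    _ = ((d : ℝ) + 1) ^ (1 / d + 1 / n : ℝ) * (N ^ (1 / d : ℝ) * N ^ (1 / n : ℝ)) := by
        rw [Real.mul_rpow (by positivity) (by positivity), Real.rpow_add (by linarith)]
        rw [Real.rpow_add (by linarith) (1 / d : ℝ)]
    _ ≤ R * (N ^ (1 / d : ℝ) * Real.exp R) := by gcongr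

theorem Real.determinant_count_le {d n k M : ℕ} {R W : ℝ} (hR8 : 8 ≤ R) (hdR : 4 * (d : ℝ) ≤ R)
    (hnR : (n : ℝ) ≤ 2 * R) (hk : (k : ℝ) ≤ 2 * R ^ 5) (hW : 1 ≤ W)
    (hM : (M : ℝ) ≤ n * d * W + 1) :
    ((2 * d ^ 2 * (d + d) + k ^ 2 * ((k ^ 2) ^ 2 * M * (2 * d ^ 2 * (d + n))) : ℕ) : ℝ) ≤
      R ^ 38 * W := by
  have hd4 : (d : ℝ) ≤ R / 4 := by linarith
  have hM' : (M : ℝ) ≤ R ^ 2 * W := by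
    have h1 : (n * d : ℝ) * W ≤ (2 * R * (R / 4)) * W := by gcongr
    have h2 : 64 ≤ R ^ 2 := by nlinarith
    nlinarith
  have h0 : (2 * d ^ 2 * (d + d) : ℝ) ≤ R ^ 3 * W :=
    calc (2 * d ^ 2 * (d + d) : ℝ) ≤ 2 * (R / 4) ^ 2 * (R / 4 + R / 4) := by gcongr
      _ ≤ R ^ 3 * 1 := by nlinarith [pow_pos (by linarith : 0 < R) 3]
      _ ≤ R ^ 3 * W := by gcongr
  have h1 : (2 * d ^ 2 * (d + n) : ℝ) ≤ R ^ 3 :=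
    calc (2 * d ^ 2 * (d + n) : ℝ) ≤ 2 * (R / 4) ^ 2 * (R / 4 + 2 * R) := by gcongr
      _ ≤ R ^ 3 := by nlinarith [pow_pos (by linarith : 0 < R) 3]
  push_cast
  calc (2 * d ^ 2 * (d + d) + k ^ 2 * ((k ^ 2) ^ 2 * M * (2 * d ^ 2 * (d + n))) : ℝ)
      ≤ R ^ 3 * W + (2 * R ^ 5) ^ 2 * (((2 * R ^ 5) ^ 2) ^ 2 * (R ^ 2 * W) * R ^ 3) := by gcongr
    _ = (R ^ 3 + 8 ^ 2 * R ^ 35) * W := by ring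
    _ ≤ R ^ 38 * W := by
        gcongr
        have h2 : R ^ 3 ≤ R ^ 35 := pow_le_pow_right₀ (by linarith) (by norm_num)
        have h3 : 8 ^ 3 * R ^ 35 ≤ R ^ 3 * R ^ 35 := by gcongr
        have h4 : R ^ 38 = R ^ 3 * R ^ 35 := by ring
        have h5 : 0 < R ^ 35 := by positivity
        linarith

/-- **Bombieri–Pila (Lemma 3.3).** If `F ∈ ℤ[x,y]` is absolutely irreducible of total
degree `d ≥ 2` and `N ≥ exp(d⁶)`, then the number of integral points `(x,y)` with
`0 ≤ x, y ≤ N` on the curve `F = 0` is at most `N^{1/d} exp(12√(d log N log log N))`. -/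
theorem bombieri_pila
    (F : MvPolynomial (Fin 2) ℤ) (d : ℕ) (hd : 2 ≤ d)
    (hdeg : F.totalDegree = d)
    (hirr : Irreducible (MvPolynomial.map (Int.castRingHom ℂ) F))
    (N : ℝ) (hN : Real.exp ((d : ℝ) ^ 6) ≤ N) :
    (Set.ncard {p : ℤ × ℤ | 0 ≤ p.1 ∧ (p.1 : ℝ) ≤ N ∧ 0 ≤ p.2 ∧ (p.2 : ℝ) ≤ N ∧
        MvPolynomial.eval ![p.1, p.2] F = 0} : ℝ) ≤
      N ^ (1 / (d : ℝ)) *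
        Real.exp (12 * Real.sqrt ((d : ℝ) * Real.log N * Real.log (Real.log N))) := by
  classical
  have hd' : (2 : ℝ) ≤ d := by exact_mod_cast hd
  have hN0 : 0 < N := (Real.exp_pos _).trans_le hN
  have hL6 : (d : ℝ) ^ 6 ≤ Real.log N := (Real.le_log_iff_exp_le hN0).mpr hN
  have hL : 64 ≤ Real.log N :=
    le_trans (by calc (64 : ℝ) = 2 ^ 6 := by norm_num
      _ ≤ (d : ℝ) ^ 6 := by gcongr) hL6
  have hN1 : 1 ≤ N := by
    by_contra! h
    linarith [Real.log_nonpos hN0.le h.le]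
  set R := √(Real.log N) with hRdef
  have hR8 : 8 ≤ R := Real.le_sqrt_of_sq_le (by linarith)
  have hRsq : R ^ 2 = Real.log N := Real.sq_sqrt (by linarith)
  have hd3 : (d : ℝ) ^ 3 ≤ R := Real.le_sqrt_of_sq_le (by rw [← pow_mul]; exact hL6)
  have hdR : 4 * (d : ℝ) ≤ R :=
    le_trans (by nlinarith [mul_self_nonneg ((d : ℝ) - 2)]) hd3
  obtain ⟨t, htd, G, hG, hGd, ⟨c, hGc⟩, hGX, hGF⟩ := MvPolynomial.exists_shear F hdeg hirr
  set N₀ := ⌊N⌋₊ with hN₀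
  have hN₀1 : 1 ≤ N₀ := (Nat.one_le_floor_iff N).mpr hN1
  have hN₀N : (N₀ : ℝ) ≤ N := Nat.floor_le hN0.le
  set B := (d + 1) * N₀ with hB
  have hB1 : 1 ≤ B := Nat.mul_pos (Nat.succ_pos d) hN₀1
  have hBN : (B : ℝ) ≤ (d + 1) * N := by
    rw [hB]
    push_cast
    gcongr
  have hlogB : Real.log B ≤ 2 * R ^ 2 := by
    have hB0 : (0 : ℝ) < B := by exact_mod_cast hB1
    have h1 := Real.log_le_log hB0 hBN
    rw [Real.log_mul (by positivity) hN0.ne', ← hRsq] at h1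
    have h2 := Real.log_le_sub_one_of_pos (by linarith : (0 : ℝ) < d + 1)
    nlinarith
  set n := ⌈R⌉₊ with hn
  have hRn : R ≤ n := Nat.le_ceil R
  have hnR : (n : ℝ) ≤ 2 * R := by
    have := Nat.ceil_lt_add_one (by linarith : 0 ≤ R)
    linarith
  have hn8 : 8 ≤ n := by exact_mod_cast hR8.trans hRn
  set k := ⌈R ^ 5⌉₊ with hk
  have hRk : R ^ 5 ≤ k := Nat.le_ceil _
  have hR5 : 100 ≤ R ^ 5 :=
    le_trans (by norm_num) (pow_le_pow_left₀ (by norm_num) hR8 5)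
  have hkR : (k : ℝ) ≤ 2 * R ^ 5 := by
    have := Nat.ceil_lt_add_one (by linarith : 0 ≤ R ^ 5)
    linarith
  have hk100 : 100 ≤ k := by exact_mod_cast hR5.trans hRk
  set W := (B : ℝ) ^ (1 / d + 1 / n : ℝ) with hW
  have hW1 : 1 ≤ W := Real.one_le_rpow (by exact_mod_cast hB1) (by positivity)
  set M := ⌈(n * d : ℝ) * W⌉₊ with hM
  have hnd : 3 ≤ n * d := by nlinarith
  have hM0 : M ≠ 0 := (Nat.ceil_pos.mpr (by positivity)).ne'
  set S := {p : ℤ × ℤ | 0 ≤ p.1 ∧ (p.1 : ℝ) ≤ N ∧ 0 ≤ p.2 ∧ (p.2 : ℝ) ≤ N ∧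
    MvPolynomial.eval ![p.1, p.2] F = 0} with hS
  have hSle : ∀ p ∈ S, 0 ≤ p.1 ∧ p.1 ≤ N₀ ∧ 0 ≤ p.2 ∧ p.2 ≤ N₀ := by
    rintro p ⟨h1, h2, h3, h4, -⟩
    have hfl : ∀ z : ℤ, 0 ≤ z → (z : ℝ) ≤ N → z ≤ N₀ := by
      intro z hz hzN
      rw [hN₀, Int.natCast_floor_eq_floor hN0.le]
      exact Int.le_floor.mpr hzN
    exact ⟨h1, hfl _ h1 h2, h3, hfl _ h3 h4⟩
  have hSfin : S.Finite :=
    (Set.finite_Icc ((0, 0) : ℤ × ℤ) (N₀, N₀)).subset fun p hp ↦ by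
      obtain ⟨h1, h2, h3, h4⟩ := hSle p hp
      exact ⟨⟨h1, h3⟩, ⟨h2, h4⟩⟩
  have hinj : Function.Injective fun p : ℤ × ℤ ↦ (p.1 - t * p.2, p.2) := by
    rintro ⟨a, b⟩ ⟨a', b'⟩ h
    obtain ⟨h1, rfl⟩ := Prod.mk.inj h
    simpa using h1
  have hmain := Polynomial.card_integral_zeros_le (x := k ^ 2) (by omega) hG hGd hGc hGX hB1
    ((Nat.height_lt_two_pow_of_le hd hR8 hdR hB1 hlogB hRk).trans_le
      (Nat.pow_le_pow_right two_pos (Nat.le_primeCounting_sq hk100))) hM0 (by omega)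
    (Nat.factorial_mul_pow_sum_le (by omega) (by omega) hnd hB1 (Nat.le_ceil _))
    (hSfin.toFinset.image fun p : ℤ × ℤ ↦ (p.1 - t * p.2, p.2)) (by
      simp only [Finset.forall_mem_image, Set.Finite.mem_toFinset]
      intro p hp
      obtain ⟨h1, h2, h3, h4⟩ := hSle p hp
      have ht : (t : ℤ) ≤ d := by exact_mod_cast htd
      have h5 : (t : ℤ) * p.2 ≤ d * N₀ := by gcongr
      have h6 : (0 : ℤ) ≤ t * p.2 := by positivity
      have h7 : (0 : ℤ) ≤ d * N₀ := by positivity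
      have hBZ : (B : ℤ) = d * N₀ + N₀ := by rw [hB]; push_cast; ring
      refine ⟨abs_le.mpr ⟨by linarith, by linarith⟩, abs_le.mpr ⟨by linarith, by linarith⟩, ?_⟩
      rw [hGF, sub_add_cancel]
      exact hp.2.2.2.2)
  rw [Finset.card_image_of_injective _ hinj, ← Set.ncard_eq_toFinset_card S hSfin] at hmain
  calc (S.ncard : ℝ) ≤ _ := Nat.cast_le.mpr hmain
    _ ≤ R ^ 38 * W := Real.determinant_count_le hR8 hdR hnR hkR hW1
        (Nat.ceil_lt_add_one (by positivity)).le
    _ ≤ R ^ 38 * (R * (N ^ (1 / d : ℝ) * Real.exp R)) := by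
        gcongr
        exact Real.mul_rpow_inv_add_inv_le hd (by omega) hN1 (by linarith) hBN
          (by rw [← hRsq, pow_two]; gcongr)
    _ = N ^ (1 / d : ℝ) * (R ^ 39 * Real.exp R) := by ring
    _ ≤ _ := by
        gcongr
        exact Real.pow_mul_exp_sqrt_le hd hL
end

section
/- (Normal comparison.) There exist absolute constants ε₀ > 0 and c > 0 such that the following holds. Let n ≥ 2 and 0 < ε ≤ ε₀. Let X₁, …, X_n be jointly Gaussian real random variables, each with mean zero and variance one, such that E(X_i·X_j) ≤ ε whenever i ≠ j. Then for any δ with 100·ε ≤ δ ≤ 1/100: P( max_{1 ≤ i ≤ n} X_i ≤ √((2 − δ)·log n) ) ≤ exp( −c · n^{δ/20} / √(log n) ) + n^{−δ²/(50ε)}. -/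
open MeasureTheory ProbabilityTheory Filter Topology

namespace NormalComparison

lemma abs_le_of_hasDerivAt_of_zero {g g' : ℝ → ℝ} {M : ℝ} (h : ∀ s, HasDerivAt g (g' s) s)
    (h0 : g 0 = 0) (hM : ∀ s ∈ Set.Icc (0 : ℝ) 1, |g' s| ≤ M) :
    ∀ s ∈ Set.Icc (0 : ℝ) 1, |g s| ≤ M := by
  intro s hs
  have hM0 : 0 ≤ M := (abs_nonneg _).trans (hM s hs)
  have := (convex_Icc (0 : ℝ) 1).norm_image_sub_le_of_norm_hasDerivWithin_le
    (fun x _ => (h x).hasDerivWithinAt) hM (Set.left_mem_Icc.2 zero_le_one) hs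
  simp only [h0, sub_zero, Real.norm_eq_abs, abs_of_nonneg hs.1] at this
  exact this.trans (mul_le_of_le_one_right hM0 hs.2)

lemma abs_sub_taylor_two_le {f f₁ f₂ f₃ : ℝ → ℝ} {M : ℝ}
    (h₁ : ∀ s, HasDerivAt f (f₁ s) s) (h₂ : ∀ s, HasDerivAt f₁ (f₂ s) s)
    (h₃ : ∀ s, HasDerivAt f₂ (f₃ s) s) (hM : ∀ s, |f₃ s| ≤ M) :
    |f 1 - (f 0 + f₁ 0 + f₂ 0 / 2)| ≤ M := by
  have b₂ := abs_le_of_hasDerivAt_of_zero (g := fun s => f₂ s - f₂ 0)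
    (fun s => (h₃ s).sub_const _) (by simp) (fun s _ => hM s)
  have b₁ := abs_le_of_hasDerivAt_of_zero (g := fun s => f₁ s - f₁ 0 - s * f₂ 0)
    (fun s => (((h₂ s).sub_const (f₁ 0)).sub
      ((hasDerivAt_id s).mul_const (f₂ 0))).congr_deriv (by simp))
    (by simp) b₂
  have b₀ := abs_le_of_hasDerivAt_of_zero
    (g := fun s => f s - f 0 - s * f₁ 0 - s ^ 2 / 2 * f₂ 0)
    (fun s => ((((h₁ s).sub_const (f 0)).sub ((hasDerivAt_id s).mul_const (f₁ 0))).sub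
      ((((hasDerivAt_id s).pow 2).div_const 2).mul_const (f₂ 0))).congr_deriv (by simp))
    (by simp) b₁
  have := b₀ 1 (Set.right_mem_Icc.2 zero_le_one)
  convert this using 2
  ring

variable {ι : Type*} [Fintype ι]

/-- A smooth surrogate for the indicator function of `{x | ∀ i, x i ≤ c}`, with sharpness `β`. -/
noncomputable def softCutoff (β c : ℝ) (x : ι → ℝ) : ℝ :=
  Real.exp (-∑ i, Real.exp (β * (x i - c)))

lemma continuous_softCutoff (β c : ℝ) : Continuous (softCutoff (ι := ι) β c) := by
  unfold softCutoff
  fun_prop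

lemma softCutoff_pos (β c : ℝ) (x : ι → ℝ) : 0 < softCutoff β c x := Real.exp_pos _

lemma softCutoff_le_one (β c : ℝ) (x : ι → ℝ) : softCutoff β c x ≤ 1 := by
  unfold softCutoff
  rw [Real.exp_le_one_iff, neg_nonpos]
  positivity

lemma integrable_softCutoff (β c : ℝ) (μ : Measure (ι → ℝ)) [IsFiniteMeasure μ] :
    Integrable (softCutoff β c) μ :=
  (integrable_const (1 : ℝ)).mono' (continuous_softCutoff β c).aestronglyMeasurable
    (ae_of_all _ fun x => by
      rw [Real.norm_of_nonneg (softCutoff_pos β c x).le]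
      exact softCutoff_le_one β c x)

/-- The second-order Taylor polynomial of `softCutoff β c` at `z`, evaluated at the increment `w`. -/
noncomputable def softCutoffTaylor (β c : ℝ) (z w : ι → ℝ) : ℝ :=
  softCutoff β c z + -(∑ i, β * Real.exp (β * (z i - c)) * w i) * softCutoff β c z +
    ((∑ i, β * Real.exp (β * (z i - c)) * w i) ^ 2 -
      ∑ i, β ^ 2 * Real.exp (β * (z i - c)) * w i ^ 2) * softCutoff β c z / 2

lemma cubic_mul_exp_neg_le {S : ℝ} (hS : 0 ≤ S) :
    (S ^ 3 + 3 * S ^ 2 + S) * Real.exp (-S) ≤ 13 := by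
  have h1 := Real.pow_div_factorial_le_exp S hS 1
  have h2 := Real.pow_div_factorial_le_exp S hS 2
  have h3 := Real.pow_div_factorial_le_exp S hS 3
  norm_num [Nat.factorial] at h1 h2 h3
  rw [Real.exp_neg, ← div_eq_mul_inv, div_le_iff₀ (Real.exp_pos _)]
  linarith

lemma abs_softCutoff_add_sub_taylor_le (β c : ℝ) (z w : ι → ℝ) :
    |softCutoff β c (z + w) - softCutoffTaylor β c z w| ≤ 13 * (|β| * ‖w‖) ^ 3 := by
  set S : ℕ → ℝ → ℝ :=
    fun k s => ∑ i, (β * w i) ^ k * Real.exp (β * (z i + s * w i - c)) with hSdef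
  have hS (k : ℕ) (s : ℝ) : HasDerivAt (S k) (S (k + 1) s) s := by
    refine HasDerivAt.fun_sum fun i _ => ?_
    have h : HasDerivAt (fun s : ℝ => β * (z i + s * w i - c)) (β * w i) s := by
      simpa using (((((hasDerivAt_id s).mul_const (w i)).const_add (z i)).sub_const c).const_mul β)
    exact (h.exp.const_mul ((β * w i) ^ k)).congr_deriv (by ring)
  have hbd (k : ℕ) (s : ℝ) : |S k s| ≤ (|β| * ‖w‖) ^ k * S 0 s := by
    rw [hSdef]
    simp only [pow_zero, one_mul, Finset.mul_sum]
    refine (Finset.abs_sum_le_sum_abs _ _).trans (Finset.sum_le_sum fun i _ => ?_)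
    rw [abs_mul, abs_pow, abs_mul, Real.abs_exp]
    gcongr
    exact norm_le_pi_norm w i
  have h0 (s : ℝ) : 0 ≤ S 0 s := by
    simp only [hSdef]
    positivity
  have key := abs_sub_taylor_two_le (f := fun s => Real.exp (-S 0 s))
    (f₁ := fun s => -S 1 s * Real.exp (-S 0 s))
    (f₂ := fun s => (S 1 s ^ 2 - S 2 s) * Real.exp (-S 0 s))
    (f₃ := fun s => (-S 1 s ^ 3 + 3 * S 1 s * S 2 s - S 3 s) * Real.exp (-S 0 s))
    (M := 13 * (|β| * ‖w‖) ^ 3)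
    (fun s => (hS 0 s).fun_neg.exp.congr_deriv (by ring))
    (fun s => ((hS 1 s).fun_neg.fun_mul (hS 0 s).fun_neg.exp).congr_deriv (by ring))
    (fun s => ((((hS 1 s).fun_pow 2).fun_sub (hS 2 s)).fun_mul
      (hS 0 s).fun_neg.exp).congr_deriv (by norm_num; ring))
    (fun s => by
      set a := |β| * ‖w‖ with ha
      have ha0 : 0 ≤ a := by positivity
      have t := h0 s
      have b1 := hbd 1 s
      have b2 := hbd 2 s
      have b3 := hbd 3 s
      rw [abs_mul, Real.abs_exp]
      have : |-S 1 s ^ 3 + 3 * S 1 s * S 2 s - S 3 s| ≤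
          a ^ 3 * (S 0 s ^ 3 + 3 * S 0 s ^ 2 + S 0 s) := by
        calc _ ≤ |S 1 s| ^ 3 + 3 * |S 1 s| * |S 2 s| + |S 3 s| := by
              refine (abs_sub _ _).trans (add_le_add_left ((abs_add_le _ _).trans ?_) _)
              simp [abs_mul, abs_pow]
          _ ≤ (a ^ 1 * S 0 s) ^ 3 + 3 * (a ^ 1 * S 0 s) * (a ^ 2 * S 0 s) + a ^ 3 * S 0 s := by
              gcongr
          _ = _ := by ring
      calc _ ≤ a ^ 3 * (S 0 s ^ 3 + 3 * S 0 s ^ 2 + S 0 s) * Real.exp (-S 0 s) := by gcongr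
        _ = a ^ 3 * ((S 0 s ^ 3 + 3 * S 0 s ^ 2 + S 0 s) * Real.exp (-S 0 s)) := by ring
        _ ≤ a ^ 3 * 13 := by gcongr; exact cubic_mul_exp_neg_le t
        _ = _ := by ring)
  convert key using 2
  simp only [softCutoffTaylor, softCutoff, hSdef, Pi.add_apply]
  simp [mul_pow, mul_right_comm]

lemma integrable_eval_of_isGaussian (γ : Measure (ι → ℝ)) [IsGaussian γ] (i : ι) :
    Integrable (fun x => x i) γ :=
  IsGaussian.integrable_dual γ (ContinuousLinearMap.proj (R := ℝ) (φ := fun _ : ι => ℝ) i)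

lemma integrable_eval_mul_eval_of_isGaussian (γ : Measure (ι → ℝ)) [IsGaussian γ] (i j : ι) :
    Integrable (fun x => x i * x j) γ :=
  (IsGaussian.memLp_dual γ (ContinuousLinearMap.proj (R := ℝ) (φ := fun _ : ι => ℝ) i) 2
    (by simp)).integrable_mul (IsGaussian.memLp_dual γ
      (ContinuousLinearMap.proj (R := ℝ) (φ := fun _ : ι => ℝ) j) 2 (by simp))

lemma integrable_norm_pow_three_of_isGaussian (γ : Measure (ι → ℝ)) [IsGaussian γ] :
    Integrable (fun x => ‖x‖ ^ 3) γ :=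
  (IsGaussian.memLp_id γ 3 (by simp)).integrable_norm_pow (by simp)

lemma integral_eval_of_isGaussian {γ : Measure (ι → ℝ)} [IsGaussian γ] (h : γ[id] = 0) (i : ι) :
    ∫ x, x i ∂γ = 0 := by
  have := IsGaussian.integral_dual (μ := γ)
    (ContinuousLinearMap.proj (R := ℝ) (φ := fun _ : ι => ℝ) i)
  simp only [id] at h
  simpa [h] using this

lemma softCutoffTaylor_smul (β c r : ℝ) (z w : ι → ℝ) :
    softCutoffTaylor β c z (r • w) = softCutoff β c z +
      -r * softCutoff β c z * ∑ i, β * Real.exp (β * (z i - c)) * w i +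
      r ^ 2 / 2 * softCutoff β c z *
        (∑ i, ∑ j, β ^ 2 * Real.exp (β * (z i - c)) * Real.exp (β * (z j - c)) * (w i * w j) -
          ∑ i, β ^ 2 * Real.exp (β * (z i - c)) * (w i * w i)) := by
  have h1 : ∑ i, ∑ j, β ^ 2 * Real.exp (β * (z i - c)) * Real.exp (β * (z j - c)) * (w i * w j) =
      (∑ i, β * Real.exp (β * (z i - c)) * w i) ^ 2 := by
    refine Eq.trans ?_ (Finset.sum_mul_sum _ _ _ _ |>.symm.trans (sq _).symm)
    exact Finset.sum_congr rfl fun i _ => Finset.sum_congr rfl fun j _ => by ring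
  have h2 : ∑ i, β * Real.exp (β * (z i - c)) * (r • w) i =
      r * ∑ i, β * Real.exp (β * (z i - c)) * w i := by
    rw [Finset.mul_sum]
    exact Finset.sum_congr rfl fun i _ => by simp; ring
  have h3 : ∑ i, β ^ 2 * Real.exp (β * (z i - c)) * (r • w) i ^ 2 =
      r ^ 2 * ∑ i, β ^ 2 * Real.exp (β * (z i - c)) * (w i * w i) := by
    rw [Finset.mul_sum]
    exact Finset.sum_congr rfl fun i _ => by simp; ring
  rw [softCutoffTaylor, h1, h2, h3]
  ring

lemma integrable_softCutoffTaylor_smul (β c r : ℝ) (z : ι → ℝ) (γ : Measure (ι → ℝ))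
    [IsGaussian γ] : Integrable (fun x => softCutoffTaylor β c z (r • x)) γ := by
  simp_rw [softCutoffTaylor_smul]
  refine ((integrable_const _).add (Integrable.const_mul (integrable_finsetSum _ fun i _ =>
    (integrable_eval_of_isGaussian γ i).const_mul _) _)).add (Integrable.const_mul
      (Integrable.sub (integrable_finsetSum _ fun i _ => integrable_finsetSum _ fun j _ =>
        (integrable_eval_mul_eval_of_isGaussian γ i j).const_mul _)
      (integrable_finsetSum _ fun i _ =>
        (integrable_eval_mul_eval_of_isGaussian γ i i).const_mul _)) _)

lemma integral_softCutoffTaylor_smul (β c r : ℝ) (z : ι → ℝ) {γ : Measure (ι → ℝ)}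
    [IsGaussian γ] (h : γ[id] = 0) :
    ∫ x, softCutoffTaylor β c z (r • x) ∂γ = softCutoff β c z +
      r ^ 2 / 2 * softCutoff β c z *
        (∑ i, ∑ j, β ^ 2 * Real.exp (β * (z i - c)) * Real.exp (β * (z j - c)) *
            ∫ x, x i * x j ∂γ -
          ∑ i, β ^ 2 * Real.exp (β * (z i - c)) * ∫ x, x i * x i ∂γ) := by
  have i1 (i : ι) (a : ℝ) : Integrable (fun x => a * x i) γ :=
    (integrable_eval_of_isGaussian γ i).const_mul _
  have i2 (i j : ι) (a : ℝ) : Integrable (fun x => a * (x i * x j)) γ :=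
    (integrable_eval_mul_eval_of_isGaussian γ i j).const_mul _
  simp_rw [softCutoffTaylor_smul]
  rw [integral_add, integral_add, integral_const, integral_const_mul, integral_const_mul,
    integral_sub, integral_finsetSum, integral_finsetSum, integral_finsetSum]
  · simp_rw [integral_finsetSum Finset.univ fun j _ => i2 _ j _, integral_const_mul,
      integral_eval_of_isGaussian h]
    simp
  all_goals intros
  all_goals first
    | exact i1 _ _
    | exact i2 _ _ _
    | exact integrable_finsetSum _ fun j _ => i2 _ _ _
    | exact integrable_finsetSum _ fun i _ => integrable_finsetSum _ fun j _ => i2 _ _ _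
    | exact integrable_const _
    | exact Integrable.const_mul (integrable_finsetSum _ fun i _ => i1 _ _) _
    | exact (integrable_const _).add
        (Integrable.const_mul (integrable_finsetSum _ fun i _ => i1 _ _) _)
    | exact Integrable.const_mul (Integrable.sub (integrable_finsetSum _ fun i _ =>
        integrable_finsetSum _ fun j _ => i2 _ _ _) (integrable_finsetSum _ fun i _ => i2 _ _ _)) _

lemma abs_integral_softCutoff_sub_taylor_le {β r : ℝ} (hβ : 0 ≤ β) (hr : 0 ≤ r) (c : ℝ)
    (z : ι → ℝ) (γ : Measure (ι → ℝ)) [IsGaussian γ] :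
    |∫ x, softCutoff β c (z + r • x) ∂γ - ∫ x, softCutoffTaylor β c z (r • x) ∂γ| ≤
      13 * (β * r) ^ 3 * ∫ x, ‖x‖ ^ 3 ∂γ := by
  have hF : Integrable (fun x => softCutoff β c (z + r • x)) γ :=
    (integrable_const (1 : ℝ)).mono'
      ((continuous_softCutoff β c).comp (by fun_prop)).aestronglyMeasurable
      (ae_of_all _ fun x => by
        rw [Real.norm_of_nonneg (softCutoff_pos _ _ _).le]
        exact softCutoff_le_one _ _ _)
  rw [← integral_sub hF (integrable_softCutoffTaylor_smul β c r z γ), ← integral_const_mul]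
  refine (abs_integral_le_integral_abs).trans (integral_mono_of_nonneg
    (ae_of_all _ fun x => abs_nonneg _)
    ((integrable_norm_pow_three_of_isGaussian γ).const_mul _) (ae_of_all _ fun x => ?_))
  refine (abs_softCutoff_add_sub_taylor_le β c z (r • x)).trans (le_of_eq ?_)
  rw [norm_smul, abs_of_nonneg hβ, Real.norm_of_nonneg hr]
  ring

lemma integral_softCutoff_add_smul_le {β r : ℝ} (hβ : 0 ≤ β) (hr : 0 ≤ r) (c : ℝ) (z : ι → ℝ)
    {γ₁ γ₂ : Measure (ι → ℝ)} [IsGaussian γ₁] [IsGaussian γ₂] (h₁ : γ₁[id] = 0) (h₂ : γ₂[id] = 0)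
    (hdiag : ∀ i, ∫ x, x i * x i ∂γ₁ = ∫ x, x i * x i ∂γ₂)
    (hcov : ∀ i j, i ≠ j → ∫ x, x i * x j ∂γ₁ ≤ ∫ x, x i * x j ∂γ₂) :
    ∫ x, softCutoff β c (z + r • x) ∂γ₁ ≤ ∫ x, softCutoff β c (z + r • x) ∂γ₂ +
      13 * β ^ 3 * (∫ x, ‖x‖ ^ 3 ∂γ₁ + ∫ x, ‖x‖ ^ 3 ∂γ₂) * r ^ 3 := by
  have e₁ := (abs_le.1 (abs_integral_softCutoff_sub_taylor_le hβ hr c z γ₁)).2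
  have e₂ := (abs_le.1 (abs_integral_softCutoff_sub_taylor_le hβ hr c z γ₂)).1
  have hT : ∫ x, softCutoffTaylor β c z (r • x) ∂γ₁ ≤ ∫ x, softCutoffTaylor β c z (r • x) ∂γ₂ := by
    rw [integral_softCutoffTaylor_smul β c r z h₁, integral_softCutoffTaylor_smul β c r z h₂]
    simp_rw [hdiag]
    have := (softCutoff_pos β c z).le
    refine add_le_add_right (mul_le_mul_of_nonneg_left (sub_le_sub_right
      (Finset.sum_le_sum fun i _ => Finset.sum_le_sum fun j _ =>
        mul_le_mul_of_nonneg_left ?_ (by positivity)) _) (by positivity)) _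
    by_cases hij : i = j
    · subst hij
      exact (hdiag i).le
    · exact hcov i j hij
  linarith

lemma map_smul_conv_map_smul {γ : Measure (ι → ℝ)} [IsGaussian γ] (h : γ[id] = 0) {a b : ℝ}
    (ha : 0 ≤ a) (hb : 0 ≤ b) :
    (γ.map (√a • ·)) ∗ (γ.map (√b • ·)) = γ.map (√(a + b) • ·) := by
  have key (s : ℝ) (hs : 0 ≤ s) (L : StrongDual ℝ (ι → ℝ)) :
      charFunDual (γ.map (√s • ·)) L = Complex.exp (-(s * Var[L; γ] : ℝ) / 2) := by
    have : (fun x : ι → ℝ => √s • x) = (√s • ContinuousLinearMap.id ℝ (ι → ℝ) : _ →L[ℝ] _) := by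
      ext; simp
    rw [this, charFunDual_map, IsGaussian.charFunDual_eq_of_integral_eq_zero h]
    have hc : ⇑(L.comp (√s • ContinuousLinearMap.id ℝ (ι → ℝ))) = fun x => √s * L x := by
      ext; simp
    rw [hc, variance_const_mul, Real.sq_sqrt hs]
  have hp (s : ℝ) : IsProbabilityMeasure (γ.map (fun x : ι → ℝ => √s • x)) :=
    Measure.isProbabilityMeasure_map (by fun_prop)
  have := hp a
  have := hp b
  have := hp (a + b)
  refine Measure.ext_of_charFunDual ?_
  ext L
  rw [charFunDual_conv, key a ha, key b hb, key _ (add_nonneg ha hb), ← Complex.exp_add]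
  congr 1
  push_cast
  ring

lemma integral_softCutoff_conv_le {β : ℝ} (hβ : 0 ≤ β) (c : ℝ)
    {γ₁ γ₂ : Measure (ι → ℝ)} [IsGaussian γ₁] [IsGaussian γ₂] (h₁ : γ₁[id] = 0) (h₂ : γ₂[id] = 0)
    (hdiag : ∀ i, ∫ x, x i * x i ∂γ₁ = ∫ x, x i * x i ∂γ₂)
    (hcov : ∀ i j, i ≠ j → ∫ x, x i * x j ∂γ₁ ≤ ∫ x, x i * x j ∂γ₂)
    {a b t : ℝ} (ha : 0 ≤ a) (hb : 0 ≤ b) (ht : 0 ≤ t) :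
    ∫ x, softCutoff β c x ∂((γ₁.map (√(a + t) • ·)) ∗ (γ₂.map (√b • ·))) ≤
      ∫ x, softCutoff β c x ∂((γ₁.map (√a • ·)) ∗ (γ₂.map (√(b + t) • ·))) +
      13 * β ^ 3 * (∫ x, ‖x‖ ^ 3 ∂γ₁ + ∫ x, ‖x‖ ^ 3 ∂γ₂) * √t ^ 3 := by
  have hp₁ (s : ℝ) : IsProbabilityMeasure (γ₁.map (fun x : ι → ℝ => √s • x)) :=
    Measure.isProbabilityMeasure_map (by fun_prop)
  have hp₂ (s : ℝ) : IsProbabilityMeasure (γ₂.map (fun x : ι → ℝ => √s • x)) :=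
    Measure.isProbabilityMeasure_map (by fun_prop)
  have hint (ν : Measure (ι → ℝ)) [IsProbabilityMeasure ν] (γ : Measure (ι → ℝ))
      [IsProbabilityMeasure γ] (s : ℝ) [IsProbabilityMeasure (γ.map (fun x : ι → ℝ => √s • x))] :
      ∫ x, softCutoff β c x ∂(ν ∗ (γ.map (√s • ·))) =
        ∫ z, ∫ x, softCutoff β c (z + √s • x) ∂γ ∂ν := by
    rw [integral_conv (integrable_softCutoff β c _)]
    congr with z
    rw [integral_map (by fun_prop)]
    exact ((continuous_softCutoff β c).comp (by fun_prop)).aestronglyMeasurable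
  have hint' (ν : Measure (ι → ℝ)) [IsProbabilityMeasure ν] (γ : Measure (ι → ℝ))
      [IsProbabilityMeasure γ] (s : ℝ) :
      Integrable (fun z => ∫ x, softCutoff β c (z + √s • x) ∂γ) ν := by
    have : Integrable (fun p : (ι → ℝ) × (ι → ℝ) => softCutoff β c (p.1 + √s • p.2))
        (ν.prod γ) :=
      (integrable_const (1 : ℝ)).mono'
        ((continuous_softCutoff β c).comp (by fun_prop)).aestronglyMeasurable
        (ae_of_all _ fun x => by
          rw [Real.norm_of_nonneg (softCutoff_pos _ _ _).le]
          exact softCutoff_le_one _ _ _)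
    exact this.integral_prod_left
  have e₁ : (γ₁.map (√(a + t) • ·)) ∗ (γ₂.map (√b • ·)) =
      ((γ₁.map (√a • ·)) ∗ (γ₂.map (√b • ·))) ∗ (γ₁.map (√t • ·)) := by
    rw [← map_smul_conv_map_smul h₁ ha ht, Measure.conv_assoc,
      Measure.conv_comm (γ₁.map (√t • ·)), ← Measure.conv_assoc]
  have e₂ : (γ₁.map (√a • ·)) ∗ (γ₂.map (√(b + t) • ·)) =
      ((γ₁.map (√a • ·)) ∗ (γ₂.map (√b • ·))) ∗ (γ₂.map (√t • ·)) := by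
    rw [← map_smul_conv_map_smul h₂ hb ht, Measure.conv_assoc]
  rw [e₁, e₂, hint, hint]
  set ν := (γ₁.map (√a • ·)) ∗ (γ₂.map (√b • ·))
  set K := 13 * β ^ 3 * (∫ x, ‖x‖ ^ 3 ∂γ₁ + ∫ x, ‖x‖ ^ 3 ∂γ₂) * √t ^ 3
  have hK : ∫ _, K ∂ν = K := by simp
  rw [← hK, ← integral_add (hint' ν γ₂ t) (integrable_const _)]
  exact integral_mono (hint' ν γ₁ t) ((hint' ν γ₂ t).add (integrable_const _)) fun z =>
    integral_softCutoff_add_smul_le hβ (Real.sqrt_nonneg t) c z h₁ h₂ hdiag hcov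

/-- Gaussian comparison for the smooth cutoffs, by Lindeberg's replacement argument. -/
lemma integral_softCutoff_le {β : ℝ} (hβ : 0 ≤ β) (c : ℝ)
    {γ₁ γ₂ : Measure (ι → ℝ)} [IsGaussian γ₁] [IsGaussian γ₂] (h₁ : γ₁[id] = 0) (h₂ : γ₂[id] = 0)
    (hdiag : ∀ i, ∫ x, x i * x i ∂γ₁ = ∫ x, x i * x i ∂γ₂)
    (hcov : ∀ i j, i ≠ j → ∫ x, x i * x j ∂γ₁ ≤ ∫ x, x i * x j ∂γ₂) :
    ∫ x, softCutoff β c x ∂γ₁ ≤ ∫ x, softCutoff β c x ∂γ₂ := by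
  set K := 13 * β ^ 3 * (∫ x, ‖x‖ ^ 3 ∂γ₁ + ∫ x, ‖x‖ ^ 3 ∂γ₂)
  have hzero (γ : Measure (ι → ℝ)) [IsProbabilityMeasure γ] :
      γ.map (fun x => √(0 : ℝ) • x) = Measure.dirac 0 := by
    simp [Measure.map_const]
  have hone (γ : Measure (ι → ℝ)) : γ.map (fun x => √(1 : ℝ) • x) = γ := by
    simp
  have hstep (N : ℕ) (hN : 0 < N) (k : ℕ) : k ≤ N →
      ∫ x, softCutoff β c x ∂((γ₁.map (√((k : ℝ) / N) • ·)) ∗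
        (γ₂.map (√(((N : ℝ) - k) / N) • ·))) ≤
      ∫ x, softCutoff β c x ∂γ₂ + k * (K * √(1 / N : ℝ) ^ 3) := by
    have hN' : (0 : ℝ) < N := by exact_mod_cast hN
    induction k with
    | zero =>
      intro _
      simp only [Nat.cast_zero, zero_div, sub_zero, div_self hN'.ne', hzero, hone,
        Measure.dirac_zero_conv, zero_mul, add_zero, le_refl]
    | succ k ih =>
      intro hk
      have hk' : (k : ℝ) + 1 ≤ N := by exact_mod_cast hk
      have h := integral_softCutoff_conv_le hβ c h₁ h₂ hdiag hcov
        (a := (k : ℝ) / N) (b := ((N : ℝ) - (k + 1)) / N) (t := 1 / N) (by positivity)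
        (div_nonneg (by linarith) hN'.le) (by positivity)
      have r₁ : (k : ℝ) / N + 1 / N = ((k + 1 : ℕ) : ℝ) / N := by push_cast; ring
      have r₂ : ((N : ℝ) - (k + 1)) / N + 1 / N = ((N : ℝ) - k) / N := by ring
      rw [r₁, r₂] at h
      have := ih (by omega)
      push_cast at h ⊢
      linarith
  have hN (N : ℕ) : ∫ x, softCutoff β c x ∂γ₁ ≤
      ∫ x, softCutoff β c x ∂γ₂ + K * √(1 / ((N : ℝ) + 1)) := by
    have h := hstep (N + 1) (by omega) (N + 1) le_rfl
    have hp : (0 : ℝ) < (N : ℝ) + 1 := by positivity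
    simp only [Nat.cast_add, Nat.cast_one, sub_self, zero_div, div_self hp.ne', hzero, hone,
      Measure.conv_dirac_zero] at h
    refine h.trans (le_of_eq ?_)
    have hsq : √(1 / ((N : ℝ) + 1)) ^ 2 = 1 / ((N : ℝ) + 1) := Real.sq_sqrt (by positivity)
    rw [pow_succ, hsq]
    field_simp
  have hlim : Tendsto (fun N : ℕ => ∫ x, softCutoff β c x ∂γ₂ + K * √(1 / ((N : ℝ) + 1))) atTop
      (𝓝 (∫ x, softCutoff β c x ∂γ₂ + K * √0)) :=
    ((Real.continuous_sqrt.tendsto 0).comp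
      tendsto_one_div_add_atTop_nhds_zero_nat).const_mul K |>.const_add _
  have := ge_of_tendsto' hlim hN
  simpa using this

/-- **Slepian's inequality** for centred Gaussian vectors, with a margin `η` in the threshold. -/
lemma measure_forall_le_le_of_covariance_le {γ₁ γ₂ : Measure (ι → ℝ)} [IsGaussian γ₁]
    [IsGaussian γ₂] (h₁ : γ₁[id] = 0) (h₂ : γ₂[id] = 0)
    (hdiag : ∀ i, ∫ x, x i * x i ∂γ₁ = ∫ x, x i * x i ∂γ₂)
    (hcov : ∀ i j, i ≠ j → ∫ x, x i * x j ∂γ₁ ≤ ∫ x, x i * x j ∂γ₂) (u : ℝ) {η : ℝ} (hη : 0 < η) :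
    γ₁.real {x | ∀ i, x i ≤ u} ≤ γ₂.real {x | ∀ i, x i ≤ u + η} := by
  have hmeas (v : ℝ) : MeasurableSet {x : ι → ℝ | ∀ i, x i ≤ v} := by
    simp only [Set.ofPred_forall]
    exact MeasurableSet.iInter fun i => measurableSet_le (measurable_pi_apply i) measurable_const
  set c := u + η / 2 with hc
  have hβ (N : ℕ) : Real.exp (-(Fintype.card ι * Real.exp (-(N * (η / 2))))) *
      γ₁.real {x | ∀ i, x i ≤ u} ≤
        γ₂.real {x | ∀ i, x i ≤ u + η} + Real.exp (-Real.exp (N * (η / 2))) := by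
    have low : Real.exp (-(Fintype.card ι * Real.exp (-(N * (η / 2))))) *
        γ₁.real {x | ∀ i, x i ≤ u} ≤ ∫ x, softCutoff N c x ∂γ₁ := by
      have hi : ∫ x, {x : ι → ℝ | ∀ i, x i ≤ u}.indicator
          (fun _ => Real.exp (-(Fintype.card ι * Real.exp (-(N * (η / 2)))))) x ∂γ₁ =
          Real.exp (-(Fintype.card ι * Real.exp (-(N * (η / 2))))) *
            γ₁.real {x | ∀ i, x i ≤ u} := by
        rw [integral_indicator_const _ (hmeas u), smul_eq_mul, mul_comm]
      rw [← hi]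
      refine integral_mono ((integrable_const _).indicator (hmeas u))
        (integrable_softCutoff _ _ _) fun x => ?_
      by_cases hx : x ∈ {x : ι → ℝ | ∀ i, x i ≤ u}
      swap
      · simp only [Set.indicator_of_notMem hx]
        exact (softCutoff_pos _ _ _).le
      simp only [Set.indicator_of_mem hx]
      rw [softCutoff, Real.exp_le_exp, neg_le_neg_iff, ← nsmul_eq_mul]
      refine Finset.sum_le_card_nsmul _ _ _ fun i _ => Real.exp_le_exp.2 ?_
      rw [← mul_neg]
      gcongr
      linarith [hx i]
    have high : ∫ x, softCutoff N c x ∂γ₂ ≤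
        γ₂.real {x | ∀ i, x i ≤ u + η} + Real.exp (-Real.exp (N * (η / 2))) := by
      have hi : ∫ x, ({x : ι → ℝ | ∀ i, x i ≤ u + η}.indicator (fun _ => (1 : ℝ)) x +
          Real.exp (-Real.exp (N * (η / 2)))) ∂γ₂ =
          γ₂.real {x | ∀ i, x i ≤ u + η} + Real.exp (-Real.exp (N * (η / 2))) := by
        rw [integral_add ((integrable_const _).indicator (hmeas _)) (integrable_const _),
          integral_indicator_const _ (hmeas _)]
        simp
      rw [← hi]
      refine integral_mono (integrable_softCutoff _ _ _)
        (((integrable_const _).indicator (hmeas _)).add (integrable_const _)) fun x => ?_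
      by_cases hx : x ∈ {x : ι → ℝ | ∀ i, x i ≤ u + η}
      · simp only [Set.indicator_of_mem hx]
        exact (softCutoff_le_one _ _ _).trans (by linarith [Real.exp_pos (-Real.exp (N * (η / 2)))])
      · simp only [Set.indicator_of_notMem hx, zero_add]
        simp only [Set.mem_ofPred_eq, not_forall, not_le] at hx
        obtain ⟨i, hi⟩ := hx
        rw [softCutoff, Real.exp_le_exp, neg_le_neg_iff]
        refine le_trans (Real.exp_le_exp.2 ?_) (Finset.single_le_sum
          (f := fun i => Real.exp (N * (x i - c))) (fun _ _ => (Real.exp_pos _).le)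
          (Finset.mem_univ i))
        gcongr
        linarith
    exact low.trans ((integral_softCutoff_le N.cast_nonneg c h₁ h₂ hdiag hcov).trans high)
  have hN : Tendsto (fun N : ℕ => (N : ℝ) * (η / 2)) atTop atTop :=
    tendsto_natCast_atTop_atTop.atTop_mul_const (by positivity)
  have l₁ : Tendsto (fun N : ℕ => Real.exp (-(Fintype.card ι * Real.exp (-(N * (η / 2))))) *
      γ₁.real {x | ∀ i, x i ≤ u}) atTop
      (𝓝 (Real.exp (-(Fintype.card ι * 0)) * γ₁.real {x | ∀ i, x i ≤ u})) :=
    ((Real.continuous_exp.tendsto _).comp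
      ((Real.tendsto_exp_neg_atTop_nhds_zero.comp hN).const_mul _).neg).mul_const _
  have l₂ : Tendsto (fun N : ℕ => γ₂.real {x | ∀ i, x i ≤ u + η} +
      Real.exp (-Real.exp (N * (η / 2)))) atTop (𝓝 (γ₂.real {x | ∀ i, x i ≤ u + η} + 0)) :=
    (Real.tendsto_exp_neg_atTop_nhds_zero.comp (Real.tendsto_exp_atTop.comp hN)).const_add _
  simpa using le_of_tendsto_of_tendsto' l₁ l₂ hβ

lemma integral_id_eq_zero_of_forall_eval {γ : Measure (ι → ℝ)} [IsGaussian γ]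
    (h : ∀ i, ∫ x, x i ∂γ = 0) : γ[id] = 0 := by
  ext i
  have := IsGaussian.integral_dual (μ := γ)
    (ContinuousLinearMap.proj (R := ℝ) (φ := fun _ : ι => ℝ) i)
  simp only [ContinuousLinearMap.proj_apply, h i] at this
  simpa using this.symm

instance isGaussian_pi_gaussianReal :
    IsGaussian (Measure.pi fun _ : ι => gaussianReal 0 1) := by
  have hind : iIndepFun (fun (i : ι) (x : ι → ℝ) => x i)
      (Measure.pi fun _ : ι => gaussianReal 0 1) :=
    iIndepFun_pi (X := fun _ x => x) fun _ => aemeasurable_id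
  have := (hind.hasGaussianLaw fun i => ⟨by
    rw [(measurePreserving_eval (fun _ : ι => gaussianReal 0 1) i).map_eq]
    infer_instance⟩).isGaussian_map
  simpa using this

/-- The law of the vector with coordinates `√ε Z + √(1 - ε) Gᵢ`, for independent standard Gaussian
variables `Z` and `Gᵢ`. -/
noncomputable def equicorrelatedGaussian (ι : Type*) [Fintype ι] (ε : ℝ) : Measure (ι → ℝ) :=
  ((gaussianReal 0 1).prod (Measure.pi fun _ : ι => gaussianReal 0 1)).map
    (fun p i => √ε * p.1 + √(1 - ε) * p.2 i)

instance isGaussian_equicorrelatedGaussian (ε : ℝ) :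
    IsGaussian (equicorrelatedGaussian ι ε) := by
  let L : ℝ × (ι → ℝ) →L[ℝ] (ι → ℝ) := ContinuousLinearMap.pi fun i =>
    √ε • ContinuousLinearMap.fst ℝ ℝ (ι → ℝ) +
      √(1 - ε) • (ContinuousLinearMap.proj (R := ℝ) (φ := fun _ : ι => ℝ) i).comp
        (ContinuousLinearMap.snd ℝ ℝ (ι → ℝ))
  exact isGaussian_map (μ := (gaussianReal 0 1).prod (Measure.pi fun _ : ι => gaussianReal 0 1)) L

lemma integral_mul_self_gaussianReal : ∫ x, x * x ∂(gaussianReal 0 1) = 1 := by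
  have := variance_fun_id_gaussianReal (μ := 0) (v := 1)
  rw [variance_of_integral_eq_zero (by fun_prop) (by simp)] at this
  simpa [sq] using this

lemma integral_eval_pi_gaussianReal (i : ι) :
    ∫ x, x i ∂(Measure.pi fun _ : ι => gaussianReal 0 1) = 0 := by
  have := (measurePreserving_eval (fun _ : ι => gaussianReal 0 1) i).map_eq
  have h := integral_map (μ := Measure.pi fun _ : ι => gaussianReal 0 1) (φ := Function.eval i)
    (measurable_pi_apply i).aemeasurable (f := fun x : ℝ => x) (by fun_prop)
  rw [this] at h
  simpa using h.symm

lemma integral_eval_mul_eval_pi_gaussianReal [DecidableEq ι] (i j : ι) :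
    ∫ x, x i * x j ∂(Measure.pi fun _ : ι => gaussianReal 0 1) = if i = j then 1 else 0 := by
  split_ifs with hij
  · subst hij
    have := (measurePreserving_eval (fun _ : ι => gaussianReal 0 1) i).map_eq
    have h := integral_map (μ := Measure.pi fun _ : ι => gaussianReal 0 1) (φ := Function.eval i)
      (measurable_pi_apply i).aemeasurable (f := fun x : ℝ => x * x) (by fun_prop)
    rw [this, integral_mul_self_gaussianReal] at h
    simpa using h.symm
  · have hind : iIndepFun (fun (i : ι) (x : ι → ℝ) => x i)
        (Measure.pi fun _ : ι => gaussianReal 0 1) :=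
      iIndepFun_pi (X := fun _ x => x) fun _ => aemeasurable_id
    rw [(hind.indepFun hij).integral_fun_mul_eq_mul_integral
        (measurable_pi_apply i).aestronglyMeasurable (measurable_pi_apply j).aestronglyMeasurable,
      integral_eval_pi_gaussianReal, zero_mul]

lemma integral_eval_equicorrelatedGaussian (ε : ℝ) (i : ι) :
    ∫ x, x i ∂(equicorrelatedGaussian ι ε) = 0 := by
  have hm : Measurable fun x : ι → ℝ => x i := measurable_pi_apply i
  rw [equicorrelatedGaussian, integral_map (by fun_prop) hm.aestronglyMeasurable]
  have h₁ : Integrable (fun z : ℝ => z) (gaussianReal 0 1) := IsGaussian.integrable_id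
  have h₂ := integrable_eval_of_isGaussian (Measure.pi fun _ : ι => gaussianReal 0 1) i
  rw [integral_add ((h₁.comp_fst _).const_mul _) ((h₂.comp_snd _).const_mul _),
    integral_const_mul, integral_const_mul, integral_fun_fst (fun z : ℝ => z),
    integral_fun_snd (fun x : ι → ℝ => x i), integral_eval_pi_gaussianReal]
  simp

lemma integral_eval_mul_eval_equicorrelatedGaussian [DecidableEq ι] {ε : ℝ} (h0 : 0 ≤ ε)
    (h1 : ε ≤ 1) (i j : ι) :
    ∫ x, x i * x j ∂(equicorrelatedGaussian ι ε) = if i = j then 1 else ε := by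
  rw [equicorrelatedGaussian, integral_map (by fun_prop) (by fun_prop)]
  have h₁ : Integrable (fun z : ℝ => z) (gaussianReal 0 1) := IsGaussian.integrable_id
  have h₁' : Integrable (fun z : ℝ => z * z) (gaussianReal 0 1) :=
    (IsGaussian.memLp_two_id (μ := gaussianReal 0 1)).integrable_mul
      (IsGaussian.memLp_two_id (μ := gaussianReal 0 1))
  have h₂ := integrable_eval_of_isGaussian (Measure.pi fun _ : ι => gaussianReal 0 1)
  have h₂' := integrable_eval_mul_eval_of_isGaussian (Measure.pi fun _ : ι => gaussianReal 0 1)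
  have e (p : ℝ × (ι → ℝ)) : (√ε * p.1 + √(1 - ε) * p.2 i) * (√ε * p.1 + √(1 - ε) * p.2 j) =
      ε * (p.1 * p.1) + √ε * √(1 - ε) * (p.1 * p.2 i) + √ε * √(1 - ε) * (p.1 * p.2 j) +
        (1 - ε) * (p.2 i * p.2 j) := by
    linear_combination (p.1 * p.1) * Real.mul_self_sqrt h0 +
      (p.2 i * p.2 j) * Real.mul_self_sqrt (sub_nonneg.2 h1)
  have i₁ := (h₁'.comp_fst (Measure.pi fun _ : ι => gaussianReal 0 1)).const_mul ε
  have i₂ (k : ι) := (h₁.mul_prod (h₂ k)).const_mul (√ε * √(1 - ε))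
  have i₃ := ((h₂' i j).comp_snd (gaussianReal 0 1)).const_mul (1 - ε)
  simp_rw [e]
  rw [integral_add ((i₁.fun_add (i₂ i)).fun_add (i₂ j)) i₃,
    integral_add (i₁.fun_add (i₂ i)) (i₂ j),
    integral_add i₁ (i₂ i), integral_const_mul, integral_const_mul, integral_const_mul,
    integral_const_mul, integral_fun_fst (fun z : ℝ => z * z),
    integral_fun_snd (fun x : ι → ℝ => x i * x j), integral_prod_mul (fun z : ℝ => z)
      (fun x : ι → ℝ => x i), integral_prod_mul (fun z : ℝ => z) (fun x : ι → ℝ => x j),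
    integral_eval_pi_gaussianReal, integral_eval_pi_gaussianReal,
    integral_eval_mul_eval_pi_gaussianReal, integral_mul_self_gaussianReal]
  split_ifs <;> simp

lemma gaussianReal_Iic_neg_le {A : ℝ} (hA : 0 ≤ A) :
    (gaussianReal 0 1).real (Set.Iic (-A)) ≤ Real.exp (-A ^ 2 / 2) := by
  have h := measure_le_le_exp_mul_mgf (μ := gaussianReal 0 1) (X := fun x : ℝ => x) (-A)
    (t := -A) (by linarith) (integrable_exp_mul_gaussianReal (-A))
  rw [mgf_fun_id_gaussianReal, ← Real.exp_add] at h
  refine h.trans (le_of_eq ?_)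
  congr 1
  simp
  ring

lemma gaussianReal_Iic_le {B : ℝ} (hB : 1 ≤ B) :
    (gaussianReal 0 1).real (Set.Iic B) ≤
      1 - Real.exp (-(3 / 2)) / √(2 * Real.pi) * (Real.exp (-B ^ 2 / 2) / B) := by
  have hB0 : 0 < B := by linarith
  have htail : Real.exp (-(3 / 2)) / √(2 * Real.pi) * (Real.exp (-B ^ 2 / 2) / B) ≤
      (gaussianReal 0 1).real (Set.Ioc B (B + 1 / B)) := by
    rw [measureReal_def, gaussianReal_apply_eq_integral 0 one_ne_zero, ENNReal.toReal_ofReal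
      (integral_nonneg fun x => gaussianPDFReal_nonneg _ _ _)]
    have hc : ∫ _ in Set.Ioc B (B + 1 / B),
        Real.exp (-(3 / 2)) / √(2 * Real.pi) * Real.exp (-B ^ 2 / 2) =
        Real.exp (-(3 / 2)) / √(2 * Real.pi) * (Real.exp (-B ^ 2 / 2) / B) := by
      rw [setIntegral_const, measureReal_def, Real.volume_Ioc, ENNReal.toReal_ofReal (by
        rw [add_sub_cancel_left]; positivity), smul_eq_mul]
      ring
    rw [← hc]
    refine setIntegral_mono_on (integrable_const _) (integrable_gaussianPDFReal _ _).integrableOn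
      measurableSet_Ioc fun x hx => ?_
    rw [gaussianPDFReal, div_eq_inv_mul, mul_assoc, ← Real.exp_add]
    simp only [NNReal.coe_one, mul_one, sub_zero]
    gcongr
    have hx' : x ^ 2 ≤ (B + 1 / B) ^ 2 := pow_le_pow_left₀ (by linarith [hx.1]) hx.2 2
    have hB1 : (1 / B) ^ 2 ≤ 1 := pow_le_one₀ (by positivity) (by rw [div_le_one hB0]; exact hB)
    have : (B + 1 / B) ^ 2 = B ^ 2 + 2 + (1 / B) ^ 2 := by
      field_simp
      ring
    linarith
  have hsub : (gaussianReal 0 1).real (Set.Ioc B (B + 1 / B)) ≤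
      (gaussianReal 0 1).real (Set.Iic B)ᶜ :=
    measureReal_mono fun x hx => by simpa using hx.1
  rw [probReal_compl_eq_one_sub measurableSet_Iic] at hsub
  linarith

lemma equicorrelatedGaussian_forall_le_le {ε v A B : ℝ} (h1 : ε < 1)
    (h : v + √ε * A ≤ √(1 - ε) * B) :
    (equicorrelatedGaussian ι ε).real {x | ∀ i, x i ≤ v} ≤
      (gaussianReal 0 1).real (Set.Iic (-A)) +
        (gaussianReal 0 1).real (Set.Iic B) ^ Fintype.card ι := by
  have hmeas : MeasurableSet {x : ι → ℝ | ∀ i, x i ≤ v} := by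
    simp only [Set.ofPred_forall]
    exact MeasurableSet.iInter fun i => measurableSet_le (measurable_pi_apply i) measurable_const
  rw [equicorrelatedGaussian, map_measureReal_apply (by fun_prop) hmeas]
  set P := (gaussianReal 0 1).prod (Measure.pi fun _ : ι => gaussianReal 0 1)
  have hsub : (fun (p : ℝ × (ι → ℝ)) i => √ε * p.1 + √(1 - ε) * p.2 i) ⁻¹' {x | ∀ i, x i ≤ v} ⊆
      (Set.Iic (-A) ×ˢ Set.univ) ∪ (Set.univ ×ˢ Set.univ.pi fun _ => Set.Iic B) := by
    rintro ⟨z, g⟩ hp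
    by_cases hz : z ≤ -A
    · exact Or.inl ⟨hz, trivial⟩
    · refine Or.inr ⟨trivial, fun i _ => ?_⟩
      have hi : √ε * z + √(1 - ε) * g i ≤ v := hp i
      have hs : 0 < √(1 - ε) := Real.sqrt_pos.2 (by linarith)
      have : √ε * -A ≤ √ε * z := by
        gcongr
        linarith
      exact le_of_mul_le_mul_left (by linarith) hs
  refine (measureReal_mono hsub).trans ((measureReal_union_le _ _).trans ?_)
  rw [measureReal_prod_prod, measureReal_prod_prod, measureReal_def (Measure.pi _) (Set.pi _ _),
    Measure.pi_pi]
  simp [measureReal_def]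

/-- The tail constant `e^{-3/2} / √(2π)` in the lower bound for the Gaussian tail. -/
noncomputable def tailConst : ℝ := Real.exp (-(3 / 2)) / √(2 * Real.pi)

lemma tailConst_pos : 0 < tailConst := by
  unfold tailConst
  positivity

lemma equicorrelatedGaussian_forall_le_sqrt_log_le {n : ℕ} (hn : 2 ≤ n) {ε δ : ℝ} (hε : 0 < ε)
    (hδ : 100 * ε ≤ δ) (hδ' : δ ≤ 1 / 100) :
    (equicorrelatedGaussian (Fin n) ε).real
        {x | ∀ i, x i ≤ √((2 - δ) * Real.log n) + δ * √(Real.log n) / 50} ≤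
      Real.exp (-(tailConst / √2 * (n : ℝ) ^ (δ / 20) / √(Real.log n))) +
        (n : ℝ) ^ (-(δ ^ 2) / (50 * ε)) := by
  have hn0 : (0 : ℝ) < n := by positivity
  have hδ0 : 0 < δ := by linarith
  have hL : 0.6931 < Real.log n := by
    have : Real.log 2 ≤ Real.log n := Real.log_le_log (by norm_num) (by exact_mod_cast hn)
    linarith [Real.log_two_gt_d9]
  have hnexp : (n : ℝ) = Real.exp (Real.log n) := (Real.exp_log hn0).symm
  rw [Real.rpow_def_of_pos hn0, Real.rpow_def_of_pos hn0]
  set L := Real.log n with hLdef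
  have hsL : √L ^ 2 = L := Real.sq_sqrt (by linarith)
  have hs0 : 0 < √L := Real.sqrt_pos.2 (by linarith)
  have hs2 : √(2 : ℝ) ^ 2 = 2 := Real.sq_sqrt (by norm_num)
  have hs2' : 1.414 ≤ √(2 : ℝ) := Real.le_sqrt_of_sq_le (by norm_num)
  set s := √L
  have hu : √((2 - δ) * L) ≤ √2 * (1 - δ / 4) * s := by
    refine Real.sqrt_le_iff.2 ⟨mul_nonneg (mul_nonneg (by positivity) (by linarith)) hs0.le, ?_⟩
    rw [mul_pow, mul_pow, hs2, hsL]
    exact mul_le_mul_of_nonneg_right (by nlinarith) (by linarith)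
  have hε1 : 1 - δ / 100 ≤ √(1 - ε) := Real.le_sqrt_of_sq_le (by nlinarith)
  have hB0 : 0 < √2 * (1 - δ / 20) * s := by
    have : 0 < 1 - δ / 20 := by linarith
    positivity
  have hB2 : (√2 * (1 - δ / 20) * s) ^ 2 = 2 * (1 - δ / 20) ^ 2 * L := by
    rw [mul_pow, mul_pow, hs2, hsL]
  have hB1 : 1 ≤ √2 * (1 - δ / 20) * s := by
    rw [← one_le_sq_iff₀ hB0.le, hB2]
    nlinarith
  have hBle : √2 * (1 - δ / 20) * s ≤ √2 * s := by
    gcongr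
    exact mul_le_of_le_one_right (by positivity) (by linarith)
  have hA : √ε * (δ * s / (5 * √ε)) = δ * s / 5 := by
    have := Real.sqrt_pos.2 hε
    field_simp
  have hmargin : √((2 - δ) * L) + δ * s / 50 + √ε * (δ * s / (5 * √ε)) ≤
      √(1 - ε) * (√2 * (1 - δ / 20) * s) := by
    rw [hA]
    have h₁ : (1 - δ / 100) * (√2 * (1 - δ / 20) * s) ≤ √(1 - ε) * (√2 * (1 - δ / 20) * s) := by
      gcongr
    have h₂ : √2 * (1 - δ / 4) + δ / 50 + δ / 5 ≤ (1 - δ / 100) * (√2 * (1 - δ / 20)) := by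
      nlinarith [mul_le_mul_of_nonneg_right hs2' hδ0.le,
        mul_nonneg (Real.sqrt_nonneg 2) (sq_nonneg δ)]
    have h₃ := mul_le_mul_of_nonneg_right h₂ hs0.le
    linarith
  refine (equicorrelatedGaussian_forall_le_le (by linarith) hmargin).trans ?_
  rw [add_comm, Fintype.card_fin]
  refine add_le_add ?_ ?_
  · have hb := gaussianReal_Iic_le hB1
    rw [← tailConst] at hb
    generalize √2 * (1 - δ / 20) * s = B at *
    have hpow : (gaussianReal 0 1).real (Set.Iic B) ^ n ≤
        Real.exp (-(tailConst * (Real.exp (-B ^ 2 / 2) / B))) ^ n := by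
      refine pow_le_pow_left₀ measureReal_nonneg (hb.trans ?_) n
      linarith [Real.add_one_le_exp (-(tailConst * (Real.exp (-B ^ 2 / 2) / B)))]
    refine hpow.trans ?_
    rw [← Real.exp_nat_mul, Real.exp_le_exp, mul_neg, neg_le_neg_iff]
    have hexp : Real.exp (L * (δ / 20)) ≤ n * Real.exp (-B ^ 2 / 2) := by
      rw [hnexp, ← Real.exp_add, Real.exp_le_exp, hB2]
      nlinarith
    have := tailConst_pos
    calc tailConst / √2 * Real.exp (L * (δ / 20)) / s
        = tailConst * (Real.exp (L * (δ / 20)) / (√2 * s)) := by field_simp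
      _ ≤ tailConst * (n * Real.exp (-B ^ 2 / 2) / B) := by gcongr
      _ = n * (tailConst * (Real.exp (-B ^ 2 / 2) / B)) := by ring
  · refine (gaussianReal_Iic_neg_le (by positivity)).trans (Real.exp_le_exp.2 (le_of_eq ?_))
    rw [div_pow, mul_pow, mul_pow, hsL, Real.sq_sqrt hε.le]
    field_simp
    norm_num

lemma isGaussian_map_of_forall_sum {Ω : Type*} [MeasurableSpace Ω] {μ : Measure Ω}
    {X : ι → Ω → ℝ} (hX : ∀ i, Measurable (X i))
    (h : ∀ t : ι → ℝ, ∃ (m₀ : ℝ) (v : NNReal),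
      μ.map (fun ω => ∑ i, t i * X i ω) = gaussianReal m₀ v) :
    IsGaussian (μ.map fun ω i => X i ω) := by
  classical
  refine isGaussian_of_map_eq_gaussianReal fun L => ?_
  obtain ⟨m, v, hmv⟩ := h fun i => L (Pi.single i 1)
  refine ⟨m, v, ?_⟩
  rw [Measure.map_map (by fun_prop) (by fun_prop), ← hmv]
  congr 1
  ext ω
  have : (fun i => X i ω) = ∑ i, X i ω • (Pi.single i 1 : ι → ℝ) := by
    ext j
    simp [Finset.sum_apply, Pi.single_apply]
  rw [Function.comp_apply, this, map_sum]
  simp [mul_comm]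

end NormalComparison

/-- **Normal comparison (Lemma 4.4).** There are absolute constants `ε₀ > 0` and `c > 0`
such that: if `n ≥ 2`, `0 < ε ≤ ε₀`, and `X_1, …, X_n` are jointly Gaussian, each with
mean zero and variance one, with `E(X_i X_j) ≤ ε` for `i ≠ j`, then for every `δ` with
`100ε ≤ δ ≤ 1/100`,
`P(max_i X_i ≤ √((2−δ) log n)) ≤ exp(−c n^{δ/20}/√(log n)) + n^{−δ²/(50ε)}`. -/
theorem normal_comparison :
    ∃ (ε₀ cst : ℝ), 0 < ε₀ ∧ 0 < cst ∧
      ∀ (Ω : Type) [MeasurableSpace Ω] (μ : Measure Ω) [IsProbabilityMeasure μ]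
        (n : ℕ), 2 ≤ n →
      ∀ (X : Fin n → Ω → ℝ) (ε : ℝ), 0 < ε → ε ≤ ε₀ →
        (∀ i, Measurable (X i)) →
        -- each `X i` is Gaussian with mean zero and variance one
        (∀ i, μ.map (X i) = gaussianReal 0 1) →
        -- the `X i` are jointly Gaussian: every linear combination is Gaussian
        (∀ t : Fin n → ℝ, ∃ (m₀ : ℝ) (v : NNReal),
          μ.map (fun ω => ∑ i, t i * X i ω) = gaussianReal m₀ v) →
        (∀ i j, i ≠ j → ∫ ω, X i ω * X j ω ∂μ ≤ ε) →
      ∀ δ : ℝ, 100 * ε ≤ δ → δ ≤ 1 / 100 →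
        μ {ω | ∀ i : Fin n, X i ω ≤ Real.sqrt ((2 - δ) * Real.log n)} ≤
          ENNReal.ofReal
            (Real.exp (-(cst * (n : ℝ) ^ (δ / 20) / Real.sqrt (Real.log n))) +
              (n : ℝ) ^ (-(δ ^ 2) / (50 * ε))) := by
  refine ⟨1, NormalComparison.tailConst / √2, one_pos,
    div_pos NormalComparison.tailConst_pos (by positivity), ?_⟩
  intro Ω _ μ _ n hn X ε hε _ hX hstd hjoint hcov δ hδ hδ'
  have hG := NormalComparison.isGaussian_map_of_forall_sum hX hjoint
  have hXm : Measurable fun ω i => X i ω := by fun_prop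
  have hmean (i : Fin n) : ∫ x, x i ∂(μ.map fun ω i => X i ω) = 0 := by
    rw [integral_map hXm.aemeasurable (measurable_pi_apply i).aestronglyMeasurable]
    have h := integral_map (μ := μ) (hX i).aemeasurable (f := fun x : ℝ => x) (by fun_prop)
    rw [hstd i] at h
    simpa using h.symm
  have hprod (i j : Fin n) : ∫ x, x i * x j ∂(μ.map fun ω i => X i ω) = ∫ ω, X i ω * X j ω ∂μ :=
    integral_map hXm.aemeasurable
      ((measurable_pi_apply i).mul (measurable_pi_apply j)).aestronglyMeasurable
  have hvar (i : Fin n) : ∫ ω, X i ω * X i ω ∂μ = 1 := by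
    have h := integral_map (μ := μ) (hX i).aemeasurable (f := fun x : ℝ => x * x) (by fun_prop)
    rw [hstd i, NormalComparison.integral_mul_self_gaussianReal] at h
    exact h.symm
  have hε1 : ε ≤ 1 := by linarith
  have hL : 0 < Real.log n := Real.log_pos (by exact_mod_cast hn)
  have hδ0 : 0 < δ := by linarith
  have hslepian := NormalComparison.measure_forall_le_le_of_covariance_le
    (NormalComparison.integral_id_eq_zero_of_forall_eval hmean)
    (NormalComparison.integral_id_eq_zero_of_forall_eval
      (NormalComparison.integral_eval_equicorrelatedGaussian (ι := Fin n) ε))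
    (fun i => by
      rw [hprod, hvar, NormalComparison.integral_eval_mul_eval_equicorrelatedGaussian hε.le hε1,
        if_pos rfl])
    (fun i j hij => by
      rw [hprod, NormalComparison.integral_eval_mul_eval_equicorrelatedGaussian hε.le hε1,
        if_neg hij]
      exact hcov i j hij)
    (√((2 - δ) * Real.log n)) (η := δ * √(Real.log n) / 50) (by positivity)
  have hset : MeasurableSet {x : Fin n → ℝ | ∀ i, x i ≤ √((2 - δ) * Real.log n)} := by
    simp only [Set.ofPred_forall]
    exact MeasurableSet.iInter fun i => measurableSet_le (measurable_pi_apply i) measurable_const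
  rw [map_measureReal_apply hXm hset] at hslepian
  rw [← ofReal_measureReal]
  exact ENNReal.ofReal_le_ofReal (hslepian.trans
    (NormalComparison.equicorrelatedGaussian_forall_le_sqrt_log_le hn hε hδ hδ'))
end

section
/- Let P(x) ∈ ℤ[x] be a polynomial with deg P = d ≥ 2 which is not of the form w(x+c)^d for any w ∈ ℤ and c ∈ ℚ, and such that P(n) ≥ 1 for all n ≥ 1. Then, as N → ∞, ∑_{p prime} #{ (n₁,n₂,n₃,n₄) ∈ {1,…,N}⁴ : P⁺(P(n_i)) = p for i = 1,2,3,4, and P(n₁)P(n₂) = P(n₃)P(n₄) } = o(N²). -/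
open Polynomial Filter Topology

/-- The largest prime factor of `m`, with the convention `P⁺(1) = 1`. -/
def maxPrimeFac (m : ℕ) : ℕ := max 1 (m.primeFactors.sup id)

/-- The Lindeberg-type count: the number of quadruples `(n₁,n₂,n₃,n₄) ∈ {1,…,N}⁴` such
that the largest prime factors `P⁺(P(nᵢ))` are all equal to a common prime `p` and
`P(n₁)P(n₂) = P(n₃)P(n₄)`; this equals
`∑_p #{(n₁,…,n₄) : P⁺(P(nᵢ)) = p ∀i, P(n₁)P(n₂) = P(n₃)P(n₄)}`. -/
def commonLargestPrimeCount (P : Polynomial ℤ) (N : ℕ) : ℕ :=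
  ((Finset.Icc 1 N ×ˢ Finset.Icc 1 N ×ˢ Finset.Icc 1 N ×ˢ Finset.Icc 1 N).filter
    (fun x =>
      (maxPrimeFac (P.eval (x.1 : ℤ)).toNat).Prime ∧
      maxPrimeFac (P.eval (x.1 : ℤ)).toNat = maxPrimeFac (P.eval (x.2.1 : ℤ)).toNat ∧
      maxPrimeFac (P.eval (x.1 : ℤ)).toNat = maxPrimeFac (P.eval (x.2.2.1 : ℤ)).toNat ∧
      maxPrimeFac (P.eval (x.1 : ℤ)).toNat = maxPrimeFac (P.eval (x.2.2.2 : ℤ)).toNat ∧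
      P.eval (x.1 : ℤ) * P.eval (x.2.1 : ℤ) =
        P.eval (x.2.2.1 : ℤ) * P.eval (x.2.2.2 : ℤ))).card

theorem card_filter_eval_eq_le (P : ℤ[X]) (hP : 1 ≤ P.natDegree) (m : ℤ) (s : Finset ℕ) :
    (s.filter fun n : ℕ => P.eval (n : ℤ) = m).card ≤ P.natDegree := by
  by_contra! h
  have h0 : P - C m = 0 := by
    refine Polynomial.eq_zero_of_natDegree_lt_card_of_eval_eq_zero' _
      ((s.filter fun n : ℕ => P.eval (n : ℤ) = m).map Nat.castEmbedding) ?_ ?_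
    · intro x hx
      simp only [Finset.mem_map, Finset.mem_filter, Nat.castEmbedding_apply] at hx
      obtain ⟨n, ⟨-, hn⟩, rfl⟩ := hx
      simp [hn]
    · rw [Finset.card_map, natDegree_sub_C]
      exact h
  rw [sub_eq_zero.mp h0, natDegree_C] at hP
  omega

theorem card_filter_dvd_eval_le (P : ℤ[X]) {p : ℕ} (hp : p.Prime)
    (hlead : ¬ (p : ℤ) ∣ P.leadingCoeff) (N : ℕ) :
    ((Finset.Icc 1 N).filter fun n : ℕ => (p : ℤ) ∣ P.eval (n : ℤ)).card
      ≤ P.natDegree * (N / p + 1) := by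
  have := Fact.mk hp
  have key := Finset.card_le_mul_card_image_of_maps_to
    (s := (Finset.Icc 1 N).filter fun n : ℕ => (p : ℤ) ∣ P.eval (n : ℤ))
    (t := Finset.range (N / p + 1)) (f := fun n => n / p) ?_ P.natDegree ?_
  · simpa using key
  · intro n hn
    simp only [Finset.mem_filter, Finset.mem_Icc] at hn
    simp only [Finset.mem_range]
    exact Nat.lt_succ_of_le (Nat.div_le_div_right hn.1.2)
  · intro k _
    have hQ : P.map (Int.castRingHom (ZMod p)) ≠ 0 := by
      intro h
      apply hlead
      have := congrArg (fun q => coeff q P.natDegree) h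
      simp only [coeff_map, coeff_zero] at this
      exact (ZMod.intCast_zmod_eq_zero_iff_dvd _ _).mp this
    rw [← Finset.card_image_of_injOn (f := fun n : ℕ => (n : ZMod p))]
    · refine (Polynomial.card_le_degree_of_subset_roots
        (p := P.map (Int.castRingHom (ZMod p))) ?_).trans natDegree_map_le
      intro z hz
      simp only [Finset.mem_val, Finset.mem_image, Finset.mem_filter] at hz
      obtain ⟨n, ⟨⟨-, hn⟩, -⟩, rfl⟩ := hz
      rw [mem_roots hQ, IsRoot.def]
      have h2 : ((P.eval (n : ℤ) : ℤ) : ZMod p) = 0 :=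
        (ZMod.intCast_zmod_eq_zero_iff_dvd _ _).mpr hn
      rw [← eq_intCast (Int.castRingHom (ZMod p)), ← eval_map_apply] at h2
      simpa using h2
    · intro a ha b hb hab
      simp only [Finset.coe_filter, Finset.mem_filter, Set.mem_ofPred_eq] at ha hb
      have h1 : a % p = b % p := (ZMod.natCast_eq_natCast_iff' _ _ _).mp hab
      rw [← Nat.div_add_mod a p, ← Nat.div_add_mod b p, ha.2, hb.2, h1]

theorem card_smooth_le (M L : ℕ) (s : Finset ℕ)
    (hs : ∀ m ∈ s, m ≠ 0 ∧ m ≤ 2 ^ L ∧ ∀ p, p.Prime → p ∣ m → p ≤ M) :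
    s.card ≤ (L + 1) ^ (M + 1) := by
  have : s.card ≤ (Fintype.piFinset fun _ : Fin (M + 1) => Finset.range (L + 1)).card := by
    refine Finset.card_le_card_of_injOn (fun m i => m.factorization i) ?_ ?_
    · intro m hm
      obtain ⟨h0, h1, -⟩ := hs m hm
      simp only [Finset.mem_coe, Fintype.mem_piFinset, Finset.mem_range]
      intro i
      by_cases hi : (i : ℕ).Prime
      · exact Nat.lt_succ_of_le (Nat.factorization_le_of_le_pow
          (h1.trans (Nat.pow_le_pow_left hi.two_le L)))
      · rw [Nat.factorization_eq_zero_of_not_prime _ hi]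
        exact Nat.succ_pos L
    · intro m hm m' hm' h
      obtain ⟨h0, -, h2⟩ := hs m hm
      obtain ⟨h0', -, h2'⟩ := hs m' hm'
      refine Nat.eq_of_factorization_eq h0 h0' fun p => ?_
      by_cases hpM : p ≤ M
      · exact congrFun h ⟨p, Nat.lt_succ_of_le hpM⟩
      · have : ∀ k : ℕ, (∀ q, q.Prime → q ∣ k → q ≤ M) → k.factorization p = 0 := by
          intro k hk
          by_cases hp : p.Prime
          · exact Nat.factorization_eq_zero_of_not_dvd fun hd => hpM (hk p hp hd)
          · exact Nat.factorization_eq_zero_of_not_prime _ hp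
        rw [this m h2, this m' h2']
  simpa using this

theorem eq_C_mul_X_add_C_pow_of_comp_linear_eq (P : ℚ[X]) {l m r : ℚ} (hd : 1 ≤ P.natDegree)
    (hr : 0 < r) (hr1 : r ≠ 1) (h : P.comp (C l * X + C m) = C r * P) :
    ∃ c : ℚ, P = C P.leadingCoeff * (X + C c) ^ P.natDegree := by
  have hP0 : P ≠ 0 := by rintro rfl; simp at hd
  have hl0 : l ≠ 0 := by
    rintro rfl
    have := congrArg natDegree h
    rw [natDegree_C_mul hr.ne'] at this
    simp at this
    omega
  have hlin : (C l * X + C m : ℚ[X]).natDegree = 1 := natDegree_linear hl0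
  have hlr : l ^ P.natDegree = r := by
    have := congrArg leadingCoeff h
    rw [leadingCoeff_comp (by rw [hlin]; norm_num), leadingCoeff_mul, leadingCoeff_C,
      leadingCoeff_linear hl0, mul_comm] at this
    exact mul_right_cancel₀ (leadingCoeff_ne_zero.mpr hP0) this
  have habs : |l| ≠ 1 := by
    intro hl
    apply hr1
    have : |l ^ P.natDegree| = 1 := by rw [abs_pow, hl, one_pow]
    rwa [hlr, abs_of_pos hr] at this
  have hl1 : 1 - l ≠ 0 := by
    intro hh
    have : l = 1 := by linarith
    exact habs (by simp [this])
  set e : ℚ := m / (1 - l) with he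
  have hem : l * e + m = e := by rw [he]; field_simp; ring
  set Q := P.comp (X + C e) with hQ
  have hQs : Q.comp (C l * X) = C r * Q := by
    have h1 : Q.comp (C l * X) = (P.comp (C l * X + C m)).comp (X + C e) := by
      rw [hQ, comp_assoc, comp_assoc]
      congr 1
      simp only [add_comp, mul_comp, X_comp, C_comp]
      rw [mul_add, add_assoc, ← C_mul, ← C_add, hem]
    rw [h1, h, mul_comp, C_comp]
  have hcoef : ∀ k, k ≠ P.natDegree → Q.coeff k = 0 := by
    intro k hk
    have := congrArg (fun q => coeff q k) hQs
    simp only [comp_C_mul_X_coeff, coeff_C_mul] at this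
    have h2 : (l ^ k - r) * Q.coeff k = 0 := by linarith
    rcases mul_eq_zero.mp h2 with h3 | h3
    · exfalso
      apply hk
      have h4 : |l| ^ k = |l| ^ P.natDegree := by
        rw [← abs_pow, ← abs_pow, hlr, sub_eq_zero.mp h3]
      exact pow_right_injective₀ (abs_pos.mpr hl0) habs h4
    · exact h3
  have hQd : Q.natDegree = P.natDegree := by simp [hQ, natDegree_comp]
  have hQl : Q.leadingCoeff = P.leadingCoeff := by
    rw [hQ, leadingCoeff_comp (by simp)]; simp
  have hQm : Q = C P.leadingCoeff * X ^ P.natDegree := by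
    ext k
    rw [coeff_C_mul, coeff_X_pow]
    split_ifs with hk
    · rw [hk, mul_one, ← hQl, leadingCoeff, hQd]
    · rw [hcoef k hk, mul_zero]
  refine ⟨-e, ?_⟩
  have h5 : P = Q.comp (X + C (-e)) := by
    rw [hQ, comp_assoc]; simp
  calc P = Q.comp (X + C (-e)) := h5
    _ = _ := by rw [hQm]; simp

theorem abs_sub_mul_pow_le {a b : ℝ} (ha : 0 ≤ a) (hb : 0 ≤ b) (k : ℕ) :
    |a - b| * b ^ k ≤ |a ^ (k + 1) - b ^ (k + 1)| := by
  rcases le_total b a with h | h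
  · rw [abs_of_nonneg (sub_nonneg.mpr h),
      abs_of_nonneg (sub_nonneg.mpr (pow_le_pow_left₀ hb h _)), pow_succ', pow_succ']
    nlinarith [mul_le_mul_of_nonneg_left (pow_le_pow_left₀ hb h k) ha]
  · rw [abs_sub_comm a b, abs_sub_comm (a ^ _), abs_of_nonneg (sub_nonneg.mpr h),
      abs_of_nonneg (sub_nonneg.mpr (pow_le_pow_left₀ ha h _)), pow_succ', pow_succ']
    nlinarith [mul_le_mul_of_nonneg_left (pow_le_pow_left₀ ha h k) ha]

theorem exists_forall_le_of_eventually_le {u : ℕ → ℝ} {A : ℝ} (h : ∀ᶠ n in atTop, u n ≤ A) :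
    ∃ B, ∀ n, u n ≤ B := by
  obtain ⟨B, hB⟩ := Filter.IsBoundedUnder.bddAbove_range (f := u) ⟨A, h⟩
  exact ⟨B, fun n => hB ⟨n, rfl⟩⟩

theorem exists_degree_sub_C_mul_X_add_C_pow_le (Q : ℝ[X]) {e : ℕ} (hQ : Q.natDegree = e + 2) :
    ∃ c : ℝ, (Q - C Q.leadingCoeff * (X + C c) ^ (e + 2)).degree ≤ (X ^ e : ℝ[X]).degree := by
  have hw : Q.leadingCoeff ≠ 0 := by
    rw [Ne, leadingCoeff_eq_zero]; rintro rfl; simp at hQ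
  refine ⟨Q.coeff (e + 1) / ((e + 2) * Q.leadingCoeff), ?_⟩
  rw [degree_X_pow, degree_le_iff_coeff_zero]
  intro k hk
  have hk' : e < k := by exact_mod_cast hk
  rw [coeff_sub, coeff_C_mul, coeff_X_add_C_pow]
  rcases lt_trichotomy k (e + 2) with h | h | h
  · obtain rfl : k = e + 1 := by omega
    have h1 : e + 2 - (e + 1) = 1 := by omega
    rw [h1, Nat.choose_succ_self_right]
    push_cast
    field_simp
    ring
  · subst h
    simp [leadingCoeff, hQ]
  · rw [coeff_eq_zero_of_natDegree_lt (by omega), Nat.choose_eq_zero_of_lt h]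
    simp

theorem exists_linear_approx_root (P : ℤ[X]) (hd : 2 ≤ P.natDegree)
    (hpos : ∀ n : ℕ, 1 ≤ n → 1 ≤ P.eval (n : ℤ)) :
    ∃ (g : ℕ → ℝ) (w c K : ℝ), 0 < w ∧ 1 ≤ K ∧ ∀ n : ℕ, 1 ≤ n →
      0 < g n ∧ ((P.eval (n : ℤ) : ℤ) : ℝ) = w * g n ^ P.natDegree ∧
      (n : ℝ) ≤ K * g n ∧ g n ≤ K * n ∧ |g n - n - c| ≤ K / n := by
  obtain ⟨e, he⟩ : ∃ e, P.natDegree = e + 2 := ⟨P.natDegree - 2, by omega⟩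
  set Q : ℝ[X] := P.map (Int.castRingHom ℝ) with hQdef
  have hQ : Q.natDegree = e + 2 := by
    rw [hQdef, natDegree_map_eq_of_injective (RingHom.injective_int _), he]
  have hQev : ∀ n : ℕ, Q.eval (n : ℝ) = ((P.eval (n : ℤ) : ℤ) : ℝ) := by
    intro n
    have := eval_map_apply (p := P) (Int.castRingHom ℝ) (n : ℤ)
    simpa only [eq_intCast, Int.cast_natCast] using this
  have hQpos : ∀ n : ℕ, 1 ≤ n → 0 < Q.eval (n : ℝ) := by
    intro n hn
    rw [hQev]
    exact_mod_cast (hpos n hn)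
  set w := Q.leadingCoeff with hwdef
  have hw0 : w ≠ 0 := by
    rw [hwdef, Ne, leadingCoeff_eq_zero]; intro h; rw [h] at hQ; simp at hQ
  have hw : 0 < w := by
    rcases lt_or_gt_of_ne hw0 with h | h
    · exfalso
      have ht := (Q.tendsto_atBot_of_leadingCoeff_nonpos
        (natDegree_pos_iff_degree_pos.mp (by omega)) h.le).comp
        (tendsto_natCast_atTop_atTop (R := ℝ))
      obtain ⟨n, hn1, hn2⟩ := ((ht.eventually_lt_atBot 0).and (eventually_ge_atTop 1)).exists
      exact absurd hn1 (not_lt.mpr (hQpos n hn2).le)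
    · exact h
  obtain ⟨c, hc⟩ := exists_degree_sub_C_mul_X_add_C_pow_le Q hQ
  obtain ⟨A, hA⟩ := (isBigO_atTop_of_degree_le _ _ hc).bound
  have hA := (tendsto_natCast_atTop_atTop (R := ℝ)).eventually hA
  simp only [eval_sub, eval_mul, eval_C, eval_pow, eval_add, eval_X, Real.norm_eq_abs] at hA
  set g : ℕ → ℝ := fun n => (Q.eval (n : ℝ) / w) ^ ((1 : ℝ) / (e + 2 : ℕ)) with hg
  have hgpos : ∀ n : ℕ, 1 ≤ n → 0 < g n := fun n hn =>
    Real.rpow_pos_of_pos (div_pos (hQpos n hn) hw) _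
  have hgpow : ∀ n : ℕ, 1 ≤ n → Q.eval (n : ℝ) = w * g n ^ (e + 2) := by
    intro n hn
    rw [hg]
    simp only
    rw [one_div, Real.rpow_inv_natCast_pow (div_pos (hQpos n hn) hw).le (by omega)]
    field_simp
  have hev : ∀ᶠ n : ℕ in atTop, (n : ℝ) * |g n - n - c| ≤ 2 ^ (e + 1) * (|A| / w) := by
    filter_upwards [hA, eventually_ge_atTop 1,
      (tendsto_natCast_atTop_atTop (R := ℝ)).eventually_ge_atTop (2 * |c|)] with n h1 hn h2
    have hn0 : (0 : ℝ) < n := by exact_mod_cast hn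
    have hb : (n : ℝ) / 2 ≤ n + c := by linarith [neg_abs_le c]
    have h3 := abs_sub_mul_pow_le (hgpos n hn).le (by linarith : 0 ≤ (n : ℝ) + c) (e + 1)
    rw [hgpow n hn, ← hwdef, ← mul_sub, abs_mul, abs_of_pos hw,
      abs_of_nonneg (pow_nonneg hn0.le e)] at h1
    have h4 : |g n - (n + c)| * (n / 2) ^ (e + 1) ≤ |A| * n ^ e / w := by
      rw [le_div_iff₀ hw]
      calc _ ≤ |g n - (n + c)| * (n + c) ^ (e + 1) * w := by gcongr
        _ ≤ |g n ^ (e + 2) - (n + c) ^ (e + 2)| * w := by gcongr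
        _ ≤ A * n ^ e := by rw [mul_comm]; exact h1
        _ ≤ _ := by gcongr; exact le_abs_self A
    rw [← sub_sub] at h4
    have h5 : (n : ℝ) ^ e * (n * |g n - n - c|) ≤ n ^ e * (2 ^ (e + 1) * (|A| / w)) := by
      have h6 := mul_le_mul_of_nonneg_left h4 (by positivity : (0 : ℝ) ≤ 2 ^ (e + 1))
      have h7 : (2 : ℝ) ^ (e + 1) * (|g n - n - c| * ((n : ℝ) / 2) ^ (e + 1))
          = n ^ e * (n * |g n - n - c|) := by
        rw [div_pow]; field_simp; ring
      rw [h7] at h6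
      refine h6.trans (le_of_eq ?_)
      ring
    exact le_of_mul_le_mul_left h5 (by positivity)
  obtain ⟨B₁, hB₁⟩ := exists_forall_le_of_eventually_le hev
  have hB₁0 : 0 ≤ B₁ := by simpa using hB₁ 0
  have happ : ∀ n : ℕ, 1 ≤ n → |g n - n - c| ≤ B₁ / n := by
    intro n hn
    have hn0 : (0 : ℝ) < n := by exact_mod_cast hn
    rw [le_div_iff₀ hn0, mul_comm]
    exact hB₁ n
  have happ' : ∀ n : ℕ, 1 ≤ n → |g n - n - c| ≤ B₁ := fun n hn =>
    (happ n hn).trans (div_le_self hB₁0 (by exact_mod_cast hn))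
  have hev2 : ∀ᶠ n : ℕ in atTop, (n : ℝ) / g n ≤ 2 := by
    filter_upwards [eventually_ge_atTop 1,
      (tendsto_natCast_atTop_atTop (R := ℝ)).eventually_ge_atTop (2 * (|c| + B₁))] with n hn h2
    rw [div_le_iff₀ (hgpos n hn)]
    have := (abs_le.mp (happ' n hn)).1
    linarith [neg_abs_le c]
  obtain ⟨B₂, hB₂⟩ := exists_forall_le_of_eventually_le hev2
  refine ⟨g, w, c, 1 + |c| + B₁ + |B₂|, hw, by linarith [abs_nonneg c, abs_nonneg B₂],
    fun n hn => ?_⟩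
  have hn1 : (1 : ℝ) ≤ n := by exact_mod_cast hn
  have hn0 : (0 : ℝ) < n := by linarith
  refine ⟨hgpos n hn, ?_, ?_, ?_, ?_⟩
  · rw [← hQev, he]; exact hgpow n hn
  · rw [← div_le_iff₀ (hgpos n hn)]
    linarith [hB₂ n, le_abs_self B₂, abs_nonneg c]
  · have h1 := (abs_le.mp (happ' n hn)).2
    have h2 := le_abs_self c
    nlinarith [abs_nonneg c, abs_nonneg B₂]
  · refine (happ n hn).trans ?_
    gcongr
    linarith [abs_nonneg c, abs_nonneg B₂]

theorem collinear_of_abs_sub_line_le {a b E L : ℝ} {x y : Fin 3 → ℕ}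
    (h : ∀ i, |(y i : ℝ) - (a * x i + b)| ≤ E) (hx : ∀ i j, (x i : ℝ) - x j ≤ L)
    (hLE : 4 * (L * E) < 1) :
    ((x 1 : ℤ) - x 0) * ((y 2 : ℤ) - y 0) = ((x 2 : ℤ) - x 0) * ((y 1 : ℤ) - y 0) := by
  set e : Fin 3 → ℝ := fun i => (y i : ℝ) - (a * x i + b) with he
  have hdiff : ∀ i j, |e i - e j| ≤ 2 * E := fun i j => by
    have := abs_sub (e i) (e j)
    linarith [h i, h j]
  have hL : ∀ i j, |(x i : ℝ) - x j| ≤ L := fun i j =>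
    abs_le.mpr ⟨by linarith [hx j i], hx i j⟩
  have hE : 0 ≤ E := (abs_nonneg _).trans (h 0)
  have hL0 : 0 ≤ L := (abs_nonneg _).trans (hL 0 0)
  rw [← sub_eq_zero, ← Int.abs_lt_one_iff]
  have key : |(((((x 1 : ℤ) - x 0) * ((y 2 : ℤ) - y 0) - ((x 2 : ℤ) - x 0) * ((y 1 : ℤ) - y 0)) : ℤ)
      : ℝ)| < 1 := by
    have h1 : (((((x 1 : ℤ) - x 0) * ((y 2 : ℤ) - y 0)
        - ((x 2 : ℤ) - x 0) * ((y 1 : ℤ) - y 0)) : ℤ) : ℝ)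
        = ((x 1 : ℝ) - x 0) * (e 2 - e 0) - ((x 2 : ℝ) - x 0) * (e 1 - e 0) := by
      rw [he]; push_cast; ring
    rw [h1]
    calc _ ≤ |((x 1 : ℝ) - x 0) * (e 2 - e 0)| + |((x 2 : ℝ) - x 0) * (e 1 - e 0)| := abs_sub _ _
      _ ≤ L * (2 * E) + L * (2 * E) := by
        rw [abs_mul, abs_mul]
        gcongr
        · exact hL 1 0
        · exact hdiff 2 0
        · exact hL 2 0
        · exact hdiff 1 0
      _ < 1 := by linarith
  exact_mod_cast key

theorem card_le_natDegree_of_collinear (P : ℤ[X]) (hd : 2 ≤ P.natDegree)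
    (hform : ¬ ∃ (w : ℤ) (c : ℚ),
      P.map (Int.castRingHom ℚ) = C (w : ℚ) * (X + C c) ^ P.natDegree)
    {A B : ℤ} (hA : 0 < A) (hB : 0 < B) (hAB : A ≠ B) (s : Finset ℕ) (y : ℕ → ℕ)
    (hs : ∀ x ∈ s, P.eval (y x : ℤ) * A = B * P.eval (x : ℤ))
    (hcol : ∀ x₀ ∈ s, ∀ x₁ ∈ s, ∀ x₂ ∈ s,
      ((x₁ : ℤ) - x₀) * ((y x₂ : ℤ) - y x₀) = ((x₂ : ℤ) - x₀) * ((y x₁ : ℤ) - y x₀)) :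
    s.card ≤ P.natDegree := by
  by_contra! hcard
  obtain ⟨u, hu, v, hv, huv⟩ := Finset.one_lt_card.mp (by omega : 1 < s.card)
  set Q := P.map (Int.castRingHom ℚ) with hQ
  have hQd : Q.natDegree = P.natDegree :=
    natDegree_map_eq_of_injective (RingHom.injective_int _) _
  have hQev : ∀ n : ℕ, Q.eval (n : ℚ) = ((P.eval (n : ℤ) : ℤ) : ℚ) := by
    intro n
    have := eval_map_apply (p := P) (Int.castRingHom ℚ) (n : ℤ)
    simpa only [eq_intCast, Int.cast_natCast] using this
  have huv' : (v : ℚ) - u ≠ 0 := sub_ne_zero.mpr (by exact_mod_cast huv.symm)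
  have hA' : (A : ℚ) ≠ 0 := by exact_mod_cast hA.ne'
  set l : ℚ := ((y v : ℚ) - y u) / (v - u) with hl
  set m : ℚ := y u - l * u with hm
  have hy : ∀ x ∈ s, (y x : ℚ) = l * x + m := by
    intro x hx
    have h1 : ((v : ℚ) - u) * (y x - y u) = (x - u) * (y v - y u) := by
      exact_mod_cast hcol u hu v hv x hx
    rw [hm, hl]
    field_simp
    linarith
  have hcomp : Q.comp (C l * X + C m) = C ((B : ℚ) / A) * Q := by
    rw [← sub_eq_zero]
    refine Polynomial.eq_zero_of_natDegree_lt_card_of_eval_eq_zero' _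
      (s.map Nat.castEmbedding) ?_ ?_
    · intro z hz
      simp only [Finset.mem_map, Nat.castEmbedding_apply] at hz
      obtain ⟨x, hx, rfl⟩ := hz
      have h1 : ((P.eval (y x : ℤ) : ℤ) : ℚ) * A = B * (P.eval (x : ℤ) : ℤ) := by
        exact_mod_cast hs x hx
      rw [← hQev, ← hQev, hy x hx] at h1
      simp only [eval_sub, eval_comp, eval_add, eval_mul, eval_C, eval_X]
      field_simp
      linarith
    · rw [Finset.card_map]
      refine lt_of_le_of_lt (natDegree_sub_le _ _) (max_lt ?_ ?_)
      · refine lt_of_le_of_lt natDegree_comp_le (lt_of_le_of_lt ?_ hcard)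
        rw [hQd]
        exact (Nat.mul_le_mul_left _ natDegree_linear_le).trans (by simp)
      · exact lt_of_le_of_lt (natDegree_C_mul_le _ _) (by rw [hQd]; exact hcard)
  obtain ⟨c, hc⟩ := eq_C_mul_X_add_C_pow_of_comp_linear_eq Q (r := (B : ℚ) / A) (by omega)
    (div_pos (by exact_mod_cast hB) (by exact_mod_cast hA))
    (by rw [Ne, div_eq_one_iff_eq hA']; exact_mod_cast hAB.symm) hcomp
  refine hform ⟨P.leadingCoeff, c, ?_⟩
  have hlc : Q.leadingCoeff = (P.leadingCoeff : ℚ) := by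
    rw [leadingCoeff, hQd, hQ, coeff_map, leadingCoeff, eq_intCast]
  rw [← hlc, ← hQd]
  exact hc

theorem mul_sub_le_of_div_eq {B m x : ℕ} (hm : 1 ≤ m) (hmx : m ≤ x) (hxB : x ≤ B)
    (h : B / m = B / x) : (B : ℝ) * ((x : ℝ) - m) ≤ 2 * (m : ℝ) ^ 2 := by
  obtain ⟨t, rfl⟩ := Nat.exists_eq_add_of_le hmx
  have hk : 1 ≤ B / (m + t) := (Nat.one_le_div_iff (by omega)).mpr hxB
  have h1 : B / (m + t) * (m + t) ≤ B := Nat.div_mul_le_self _ _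
  have h2 : B < (B / (m + t) + 1) * m := by
    rw [← h]; exact Nat.lt_mul_of_div_lt (Nat.lt_succ_self _) (by omega)
  set k := B / (m + t)
  have h3 : k * t ≤ m := by nlinarith
  have h4 : B * t ≤ 2 * m ^ 2 := by
    calc B * t ≤ ((k + 1) * m) * t := Nat.mul_le_mul_right _ h2.le
      _ ≤ 2 * k * m * t := by gcongr; omega
      _ = 2 * m * (k * t) := by ring
      _ ≤ 2 * m * m := by gcongr
      _ = _ := by ring
  push_cast
  rw [add_sub_cancel_left]
  exact_mod_cast h4

theorem exists_card_ratio_points_le (P : ℤ[X]) (hd : 2 ≤ P.natDegree)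
    (hform : ¬ ∃ (w : ℤ) (c : ℚ),
      P.map (Int.castRingHom ℚ) = C (w : ℚ) * (X + C c) ^ P.natDegree)
    (hpos : ∀ n : ℕ, 1 ≤ n → 1 ≤ P.eval (n : ℤ)) :
    ∃ A : ℕ, (∀ a b x y : ℕ, 1 ≤ a → 1 ≤ b → 1 ≤ x → x ≤ y →
        P.eval (y : ℤ) * P.eval (a : ℤ) = P.eval (b : ℤ) * P.eval (x : ℤ) → a ≤ A * b) ∧
      ∀ (N a b : ℕ) (s : Finset ℕ), 1 ≤ a → 1 ≤ b → b ≤ N →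
        P.eval (a : ℤ) ≠ P.eval (b : ℤ) →
        (∀ x ∈ s, b ≤ x ∧ ∃ y, x ≤ y ∧ y ≤ N ∧
          P.eval (y : ℤ) * P.eval (a : ℤ) = P.eval (b : ℤ) * P.eval (x : ℤ)) →
        (s.card : ℝ) ≤ A * (N / b) := by
  obtain ⟨g, w, c, K, hw, hK, hg⟩ := exists_linear_approx_root P hd hpos
  have hmul : ∀ a b x y : ℕ, 1 ≤ a → 1 ≤ b → 1 ≤ x → 1 ≤ y →
      P.eval (y : ℤ) * P.eval (a : ℤ) = P.eval (b : ℤ) * P.eval (x : ℤ) →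
      g y * g a = g b * g x := by
    intro a b x y ha hb hx hy h
    have h1 : ((P.eval (y : ℤ) : ℤ) : ℝ) * (P.eval (a : ℤ) : ℤ)
        = (P.eval (b : ℤ) : ℤ) * (P.eval (x : ℤ) : ℤ) := by exact_mod_cast h
    rw [(hg y hy).2.1, (hg a ha).2.1, (hg b hb).2.1, (hg x hx).2.1] at h1
    have h2 : w ^ 2 * (g y * g a) ^ P.natDegree = w ^ 2 * (g b * g x) ^ P.natDegree := by
      rw [mul_pow, mul_pow]; linarith
    have h3 := mul_left_cancel₀ (pow_ne_zero 2 hw.ne') h2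
    exact (pow_left_inj₀ (mul_pos (hg y hy).1 (hg a ha).1).le
      (mul_pos (hg b hb).1 (hg x hx).1).le (by omega)).mp h3
  have hK0 : 0 < K := by linarith
  set D : ℕ := ⌈16 * K ^ 5⌉₊ + 1 with hD
  have hDK : 16 * K ^ 5 < D := by
    rw [hD]; push_cast; linarith [Nat.le_ceil (16 * K ^ 5)]
  refine ⟨⌈K ^ 4⌉₊ + P.natDegree * (D + 1), ?_, ?_⟩
  · intro a b x y ha hb hx hxy h
    have hy := hx.trans hxy
    have hx0 : (0 : ℝ) < x := by exact_mod_cast hx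
    have hxy' : (x : ℝ) ≤ y := by exact_mod_cast hxy
    have h1 := hmul a b x y ha hb hx hy h
    have h2 : (x : ℝ) * a ≤ x * (K ^ 4 * b) := by
      calc (x : ℝ) * a ≤ y * a := by gcongr
        _ ≤ (K * g y) * (K * g a) := by
          have := (hg y hy).1
          gcongr
          · exact (hg y hy).2.2.1
          · exact (hg a ha).2.2.1
        _ = K ^ 2 * (g b * g x) := by rw [← h1]; ring
        _ ≤ K ^ 2 * ((K * b) * (K * x)) := by
          have := (hg x hx).1
          gcongr
          · exact (hg b hb).2.2.2.1
          · exact (hg x hx).2.2.2.1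
        _ = _ := by ring
    have h3 : (a : ℝ) ≤ K ^ 4 * b := le_of_mul_le_mul_left h2 hx0
    have h4 : (a : ℝ) ≤ ((⌈K ^ 4⌉₊ + P.natDegree * (D + 1) : ℕ) : ℝ) * b := by
      refine h3.trans ?_
      gcongr
      push_cast
      have : (0 : ℝ) ≤ (P.natDegree : ℝ) * (D + 1) := by positivity
      linarith [Nat.le_ceil (K ^ 4)]
    exact_mod_cast h4
  · intro N a b s ha hb hbN hab hs
    have hchoice : ∀ x, ∃ y, x ∈ s → x ≤ y ∧ y ≤ N ∧
        P.eval (y : ℤ) * P.eval (a : ℤ) = P.eval (b : ℤ) * P.eval (x : ℤ) := by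
      intro x
      by_cases hx : x ∈ s
      · obtain ⟨y, hy⟩ := (hs x hx).2
        exact ⟨y, fun _ => hy⟩
      · exact ⟨0, fun h => absurd h hx⟩
    choose y hy using hchoice
    set α := g b / g a with hα
    have hgy : ∀ x ∈ s, g (y x) = α * g x := by
      intro x hx
      have hx1 := hb.trans (hs x hx).1
      have := hmul a b x (y x) ha hb hx1 (hx1.trans (hy x hx).1) (hy x hx).2.2
      have hga := (hg a ha).1.ne'
      rw [hα]
      field_simp
      linarith
    have hα0 : 0 < α := div_pos (hg b hb).1 (hg a ha).1
    have hN0 : (0 : ℝ) < N := by exact_mod_cast hb.trans hbN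
    have hline : ∀ x ∈ s, |(y x : ℝ) - (α * x + (α * c - c))| ≤ 2 * K ^ 5 * N / (x : ℝ) ^ 2 := by
      intro x hx
      have hx1 : 1 ≤ x := hb.trans (hs x hx).1
      have hx0 : (0 : ℝ) < x := by exact_mod_cast hx1
      obtain ⟨hxy, hyN, -⟩ := hy x hx
      have hy1 := hx1.trans hxy
      have hxy' : (x : ℝ) ≤ y x := by exact_mod_cast hxy
      have hyN' : (y x : ℝ) ≤ N := by exact_mod_cast hyN
      obtain ⟨gx0, -, gx1, gx2, gx3⟩ := hg x hx1
      obtain ⟨gy0, -, gy1, gy2, gy3⟩ := hg (y x) hy1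
      have hαl : 1 ≤ K ^ 2 * α := by
        have : (x : ℝ) * 1 ≤ x * (K ^ 2 * α) := by
          calc (x : ℝ) * 1 ≤ y x := by linarith
            _ ≤ K * (α * g x) := by rw [← hgy x hx]; exact gy1
            _ ≤ K * (α * (K * x)) := by gcongr
            _ = _ := by ring
        exact le_of_mul_le_mul_left this hx0
      have hαu : α ≤ K ^ 2 * N / x := by
        rw [le_div_iff₀ hx0]
        calc α * x ≤ α * (K * g x) := by gcongr
          _ = K * g (y x) := by rw [hgy x hx]; ring
          _ ≤ K * (K * N) := by gcongr; exact gy2.trans (by gcongr)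
          _ = _ := by ring
      have h1 : (y x : ℝ) - (α * x + (α * c - c))
          = α * (g x - x - c) - (g (y x) - y x - c) := by rw [hgy x hx]; ring
      rw [h1]
      calc _ ≤ |α * (g x - x - c)| + |g (y x) - y x - c| := abs_sub _ _
        _ ≤ α * (K / x) + 1 * (K / x) := by
          rw [abs_mul, abs_of_pos hα0, one_mul]
          gcongr
          exact gy3.trans (by gcongr)
        _ ≤ α * (K / x) + K ^ 2 * α * (K / x) := by gcongr
        _ = (1 + K ^ 2) * (α * (K / x)) := by ring
        _ ≤ (K ^ 2 + K ^ 2) * (K ^ 2 * N / x * (K / x)) := by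
          gcongr
          exact one_le_pow₀ hK
        _ = _ := by field_simp; ring
    have hfib : ∀ k ∈ Finset.range (D * N / b + 1),
        (s.filter fun x => D * N / x = k).card ≤ P.natDegree := by
      intro k _
      set F := s.filter fun x => D * N / x = k with hF
      rcases F.eq_empty_or_nonempty with h0 | hne
      · rw [h0]; simp
      set m := F.min' hne with hm
      have hmF : m ∈ F := F.min'_mem hne
      have hmin : ∀ x ∈ F, m ≤ x := fun x hx => F.min'_le x hx
      have hFs : ∀ x ∈ F, x ∈ s ∧ D * N / x = k := fun x hx => Finset.mem_filter.mp hx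
      have hm1 : 1 ≤ m := hb.trans (hs m (hFs m hmF).1).1
      have hm0 : (0 : ℝ) < m := by exact_mod_cast hm1
      have hD1 : 1 ≤ D := by omega
      have hDN0 : (0 : ℝ) < D * N := mul_pos (by exact_mod_cast hD1) hN0
      have hspread : ∀ x ∈ F, (x : ℝ) - m ≤ 2 * (m : ℝ) ^ 2 / (D * N) := by
        intro x hx
        have hxN : x ≤ N := (hy x (hFs x hx).1).1.trans (hy x (hFs x hx).1).2.1
        have := mul_sub_le_of_div_eq hm1 (hmin x hx)
          (hxN.trans (Nat.le_mul_of_pos_left N hD1)) ((hFs m hmF).2.trans (hFs x hx).2.symm)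
        rw [le_div_iff₀ hDN0, mul_comm]
        exact_mod_cast this
      refine card_le_natDegree_of_collinear P hd hform (A := P.eval (a : ℤ)) (B := P.eval (b : ℤ))
        (hpos a ha) (hpos b hb) hab F y (fun x hx => (hy x (hFs x hx).1).2.2) ?_
      intro x₀ h₀ x₁ h₁ x₂ h₂
      have hmem : ∀ i, (![x₀, x₁, x₂] : Fin 3 → ℕ) i ∈ F := by
        intro i; fin_cases i <;> assumption
      have := collinear_of_abs_sub_line_le (a := α) (b := α * c - c)
        (E := 2 * K ^ 5 * N / (m : ℝ) ^ 2) (L := 2 * (m : ℝ) ^ 2 / (D * N))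
        (x := ![x₀, x₁, x₂]) (y := fun i => y (![x₀, x₁, x₂] i)) ?_ ?_ ?_
      · simpa using this
      · intro i
        refine (hline _ (hFs _ (hmem i)).1).trans ?_
        have : (m : ℝ) ≤ (![x₀, x₁, x₂] i : ℕ) := by exact_mod_cast hmin _ (hmem i)
        gcongr
      · intro i j
        have : (m : ℝ) ≤ (![x₀, x₁, x₂] j : ℕ) := by exact_mod_cast hmin _ (hmem j)
        linarith [hspread _ (hmem i)]
      · have h1 : 4 * (2 * (m : ℝ) ^ 2 / (D * N) * (2 * K ^ 5 * N / (m : ℝ) ^ 2))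
            = 16 * K ^ 5 / D := by field_simp; ring
        rw [h1, div_lt_one (by exact_mod_cast hD1)]
        exact hDK
    have hcard := Finset.card_le_mul_card_image_of_maps_to
      (s := s) (t := Finset.range (D * N / b + 1)) (f := fun x => D * N / x)
      (fun x hx => Finset.mem_range.mpr
        (Nat.lt_succ_of_le (Nat.div_le_div_left (hs x hx).1 hb))) P.natDegree hfib
    rw [Finset.card_range] at hcard
    have hb0 : (0 : ℝ) < b := by exact_mod_cast hb
    have h1 : (1 : ℝ) ≤ N / b := by rw [one_le_div hb0]; exact_mod_cast hbN
    have h2 : ((D * N / b : ℕ) : ℝ) ≤ D * (N / b) := by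
      refine Nat.cast_div_le.trans (le_of_eq ?_)
      push_cast; ring
    calc (s.card : ℝ) ≤ P.natDegree * ((D * N / b : ℕ) + 1 : ℝ) := by exact_mod_cast hcard
      _ ≤ P.natDegree * (D * (N / b) + N / b) := by gcongr
      _ = P.natDegree * (D + 1) * (N / b) := by ring
      _ ≤ _ := by
        gcongr
        push_cast
        linarith [Nat.cast_nonneg (α := ℝ) ⌈K ^ 4⌉₊]

theorem maxPrimeFac_prime_spec {m p : ℕ} (hp : p.Prime) (hm : m ≠ 0) (h : maxPrimeFac m = p) :
    p ∣ m ∧ ∀ q, q.Prime → q ∣ m → q ≤ p := by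
  have hsup : m.primeFactors.sup id = p := by
    unfold maxPrimeFac at h
    have := hp.two_le
    omega
  constructor
  · have hne : m.primeFactors.Nonempty := by
      rw [Finset.nonempty_iff_ne_empty]
      intro h0
      rw [h0, Finset.sup_empty] at hsup
      exact hp.ne_zero hsup.symm
    obtain ⟨q, hq, hq'⟩ := Finset.exists_mem_eq_sup _ hne id
    rw [hsup] at hq'
    rw [hq']
    exact Nat.dvd_of_mem_primeFactors hq
  · intro q hq hqm
    rw [← hsup]
    exact Finset.le_sup (f := id) (Nat.mem_primeFactors.mpr ⟨hq, hqm, hm⟩)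

theorem tendsto_natLog_pow_div (a d k : ℕ) :
    Tendsto (fun N : ℕ => ((a + d * Nat.log 2 N : ℕ) : ℝ) ^ k / N) atTop (𝓝 0) := by
  have h1 : (fun x : ℝ => (a : ℝ) + d * Real.logb 2 x) =O[atTop] Real.log := by
    refine (Asymptotics.IsBigO.add ?_ ?_)
    · exact (Real.isLittleO_const_log_atTop).isBigO
    · simp only [Real.logb, div_eq_inv_mul]
      exact ((Asymptotics.isBigO_refl _ _).const_mul_left _).const_mul_left _
  have h2 : (fun x : ℝ => ((a : ℝ) + d * Real.logb 2 x) ^ k) =o[atTop] (fun x => x) :=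
    (h1.pow k).trans_isLittleO Real.isLittleO_pow_log_id_atTop
  have h3 := h2.tendsto_div_nhds_zero.comp (tendsto_natCast_atTop_atTop (R := ℝ))
  refine squeeze_zero (fun N => by positivity) (fun N => ?_) h3
  simp only [Function.comp_apply]
  gcongr
  push_cast
  gcongr
  exact Real.natLog_le_logb N 2

theorem eventually_card_maxPrimeFac_eq_le (P : ℤ[X]) (hd : 2 ≤ P.natDegree)
    (hpos : ∀ n : ℕ, 1 ≤ n → 1 ≤ P.eval (n : ℤ)) {ε : ℝ} (hε : 0 < ε) :
    ∀ᶠ N : ℕ in atTop, ∀ p : ℕ, p.Prime →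
      (((Finset.Icc 1 N).filter fun n : ℕ =>
        maxPrimeFac (P.eval (n : ℤ)).toNat = p).card : ℝ) ≤ ε * N := by
  obtain ⟨g, w, _, K, hw, hK, hg⟩ := exists_linear_approx_root P hd hpos
  set d := P.natDegree with hddef
  have hd0 : (0 : ℝ) < d := by exact_mod_cast (by omega : 0 < d)
  set A : ℕ := ⌈w * K ^ d⌉₊ with hA
  have hPA : ∀ n : ℕ, 1 ≤ n → (P.eval (n : ℤ)).toNat ≤ A * n ^ d := by
    intro n hn
    obtain ⟨g0, g1, -, g2, -⟩ := hg n hn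
    have h1 : ((P.eval (n : ℤ) : ℤ) : ℝ) ≤ ((A * n ^ d : ℕ) : ℝ) := by
      rw [g1]; push_cast
      calc w * g n ^ d ≤ w * (K * n) ^ d := by gcongr
        _ = w * K ^ d * n ^ d := by ring
        _ ≤ _ := by gcongr; exact Nat.le_ceil _
    rw [Int.toNat_le]
    exact_mod_cast h1
  obtain ⟨M, hM⟩ := exists_nat_gt (max (2 * d / ε) (P.leadingCoeff.natAbs : ℝ))
  have hM1 : 2 * d / ε < M := (le_max_left _ _).trans_lt hM
  have hM2 : P.leadingCoeff.natAbs < M := by exact_mod_cast (le_max_right _ _).trans_lt hM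
  have hM0 : (0 : ℝ) < M := lt_of_le_of_lt (by positivity) hM1
  have hsm := (tendsto_natLog_pow_div (A + d + 1) d (M + 1)).eventually_lt_const
    (by positivity : 0 < ε / d)
  filter_upwards [hsm, eventually_ge_atTop 1,
    (tendsto_natCast_atTop_atTop (R := ℝ)).eventually_ge_atTop (2 * d / ε)] with N h1 hN h2 p hp
  have hN0 : (0 : ℝ) < N := by exact_mod_cast hN
  have hspec : ∀ n ∈ (Finset.Icc 1 N).filter fun n : ℕ =>
      maxPrimeFac (P.eval (n : ℤ)).toNat = p, (1 ≤ n ∧ n ≤ N) ∧ (P.eval (n : ℤ)).toNat ≠ 0 ∧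
        p ∣ (P.eval (n : ℤ)).toNat ∧ ∀ q, q.Prime → q ∣ (P.eval (n : ℤ)).toNat → q ≤ p := by
    intro n hn
    rw [Finset.mem_filter, Finset.mem_Icc] at hn
    have h0 : (P.eval (n : ℤ)).toNat ≠ 0 := by have := hpos n hn.1.1; omega
    exact ⟨hn.1, h0, maxPrimeFac_prime_spec hp h0 hn.2⟩
  rcases le_or_gt p M with hpM | hpM
  · set s := (Finset.Icc 1 N).filter fun n : ℕ => maxPrimeFac (P.eval (n : ℤ)).toNat = p with hs
    have hc1 : s.card ≤ d * (s.image fun n : ℕ => (P.eval (n : ℤ)).toNat).card := by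
      refine Finset.card_le_mul_card_image s d fun m hm => ?_
      refine le_trans (Finset.card_le_card ?_) (card_filter_eval_eq_le P (by omega) (m : ℤ) s)
      intro n hn
      rw [Finset.mem_filter] at hn ⊢
      refine ⟨hn.1, ?_⟩
      have := hpos n (hspec n hn.1).1.1
      omega
    have hc2 := card_smooth_le M (A + d + d * Nat.log 2 N)
      (s.image fun n : ℕ => (P.eval (n : ℤ)).toNat) (by
        intro m hm
        obtain ⟨n, hn, rfl⟩ := Finset.mem_image.mp hm
        obtain ⟨⟨hn1, hnN⟩, h3, -, h4⟩ := hspec n hn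
        refine ⟨h3, ?_, fun q hq hqm => (h4 q hq hqm).trans hpM⟩
        calc _ ≤ A * n ^ d := hPA n hn1
          _ ≤ 2 ^ A * (2 ^ (Nat.log 2 N + 1)) ^ d := by
            gcongr
            · exact Nat.lt_two_pow_self.le
            · exact hnN.trans (Nat.lt_pow_succ_log_self one_lt_two N).le
          _ = _ := by rw [← pow_mul, ← pow_add]; congr 1; ring)
    have hc3 : (s.card : ℝ) ≤ d * ((A + d + 1 + d * Nat.log 2 N : ℕ) : ℝ) ^ (M + 1) := by
      have := hc1.trans (Nat.mul_le_mul_left d hc2)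
      rw [show A + d + d * Nat.log 2 N + 1 = A + d + 1 + d * Nat.log 2 N by ring] at this
      exact_mod_cast this
    rw [div_lt_div_iff₀ hN0 hd0] at h1
    linarith
  · have hlead : ¬ (p : ℤ) ∣ P.leadingCoeff := by
      intro h
      have h3 := Nat.le_of_dvd (Int.natAbs_pos.mpr (leadingCoeff_ne_zero.mpr
        (by rintro rfl; simp at hddef; omega))) (Int.natCast_dvd.mp h)
      omega
    have hc1 := card_filter_dvd_eval_le P hp hlead N
    have hc2 : ((Finset.Icc 1 N).filter fun n : ℕ =>
        maxPrimeFac (P.eval (n : ℤ)).toNat = p).card ≤ d * (N / p + 1) := by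
      refine le_trans (Finset.card_le_card ?_) hc1
      intro n hn
      obtain ⟨-, h3, h4, -⟩ := hspec n hn
      rw [Finset.mem_filter] at hn ⊢
      refine ⟨hn.1, ?_⟩
      rw [← Int.toNat_of_nonneg (a := P.eval (n : ℤ)) (by omega)]
      exact_mod_cast h4
    have hpM' : (M : ℝ) < p := by exact_mod_cast hpM
    calc _ ≤ (d : ℝ) * ((N / p : ℕ) + 1) := by exact_mod_cast hc2
      _ ≤ d * (N / p + 1) := by gcongr; exact Nat.cast_div_le
      _ ≤ d * (N / (2 * d / ε) + 1) := by gcongr; exact (hM1.trans hpM').le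
      _ = ε * N / 2 + d := by field_simp
      _ ≤ ε * N := by
        rw [div_le_iff₀ hε] at h2
        linarith

/-- The pairs in `{1,…,N}²` at which `P` takes values with a common largest prime factor. -/
def commonLargestPrimePairs (P : Polynomial ℤ) (N : ℕ) : Finset (ℕ × ℕ) :=
  (Finset.Icc 1 N ×ˢ Finset.Icc 1 N).filter fun x =>
    (maxPrimeFac (P.eval (x.1 : ℤ)).toNat).Prime ∧
      maxPrimeFac (P.eval (x.2 : ℤ)).toNat = maxPrimeFac (P.eval (x.1 : ℤ)).toNat

theorem eventually_card_commonLargestPrimePairs_le (P : ℤ[X]) (hd : 2 ≤ P.natDegree)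
    (hpos : ∀ n : ℕ, 1 ≤ n → 1 ≤ P.eval (n : ℤ)) {ε : ℝ} (hε : 0 < ε) :
    ∀ᶠ N : ℕ in atTop, ((commonLargestPrimePairs P N).card : ℝ) ≤ ε * (N : ℝ) ^ 2 := by
  filter_upwards [eventually_card_maxPrimeFac_eq_le P hd hpos hε] with N hN
  rw [Finset.card_eq_sum_card_fiberwise (f := Prod.fst) (t := Finset.Icc 1 N)]
  · push_cast
    refine (Finset.sum_le_card_nsmul _ _ (ε * N) fun a _ => ?_).trans (le_of_eq ?_)
    · by_cases hp : (maxPrimeFac (P.eval (a : ℤ)).toNat).Prime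
      · refine le_trans ?_ (hN _ hp)
        rw [Nat.cast_le]
        refine Finset.card_le_card_of_injOn Prod.snd ?_ ?_
        · rintro ⟨x, y⟩ hx
          simp only [commonLargestPrimePairs, Finset.coe_filter, Finset.mem_filter,
            Finset.mem_product, Set.mem_ofPred_eq] at hx ⊢
          obtain ⟨⟨h1, h2⟩, rfl⟩ := hx
          exact ⟨h1.2, h2.2⟩
        · rintro ⟨x, y⟩ hx ⟨x', y'⟩ hx' h
          simp only [Finset.coe_filter, Set.mem_ofPred_eq] at hx hx' h
          rw [Prod.mk.injEq]
          exact ⟨hx.2.trans hx'.2.symm, h⟩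
      · rw [Finset.filter_eq_empty_iff.mpr]
        · simp only [Finset.card_empty, Nat.cast_zero]; positivity
        · rintro ⟨x, y⟩ hx rfl
          exact hp (Finset.mem_filter.mp hx).2.1
    · rw [Nat.card_Icc, nsmul_eq_mul, Nat.add_sub_cancel]; ring
  · rintro ⟨x, y⟩ hx
    exact (Finset.mem_product.mp (Finset.mem_filter.mp hx).1).1

theorem card_le_two_mul_card_filter {α : Type*} {T : Finset α} (q : α → Prop) [DecidablePred q]
    {σ : α → α} (hσ : Function.Injective σ) (hT : ∀ x ∈ T, σ x ∈ T)
    (hq : ∀ x ∈ T, q x ∨ q (σ x)) : T.card ≤ 2 * (T.filter q).card := by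
  have h : (T.filter fun x => ¬ q x).card ≤ (T.filter q).card := by
    refine Finset.card_le_card_of_injOn σ ?_ hσ.injOn
    intro x hx
    simp only [Finset.coe_filter, Set.mem_ofPred_eq] at hx ⊢
    exact ⟨hT x hx.1, (hq x hx.1).resolve_left hx.2⟩
  have := Finset.card_filter_add_card_filter_not (s := T) q
  omega

/-- The quadruples in `{1,…,N}⁴` with `n₃ ≤ n₄ ≤ n₁` and `P(n₁)P(n₂) = P(n₃)P(n₄)` at which
`P(n₁)`, `P(n₂)`, `P(n₃)` have a common largest prime factor. -/
def orderedQuadruples (P : Polynomial ℤ) (N : ℕ) : Finset (ℕ × ℕ × ℕ × ℕ) :=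
  (Finset.Icc 1 N ×ˢ Finset.Icc 1 N ×ˢ Finset.Icc 1 N ×ˢ Finset.Icc 1 N).filter fun x =>
    (x.1, x.2.1) ∈ commonLargestPrimePairs P N ∧ (x.2.1, x.2.2.1) ∈ commonLargestPrimePairs P N ∧
      P.eval (x.1 : ℤ) * P.eval (x.2.1 : ℤ) = P.eval (x.2.2.1 : ℤ) * P.eval (x.2.2.2 : ℤ) ∧
      x.2.2.1 ≤ x.2.2.2 ∧ x.2.2.2 ≤ x.1

theorem commonLargestPrimeCount_le (P : ℤ[X]) (N : ℕ) :
    commonLargestPrimeCount P N ≤ 8 * (orderedQuadruples P N).card := by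
  unfold commonLargestPrimeCount
  set T := (Finset.Icc 1 N ×ˢ Finset.Icc 1 N ×ˢ Finset.Icc 1 N ×ˢ Finset.Icc 1 N).filter
    (fun x : ℕ × ℕ × ℕ × ℕ =>
      (maxPrimeFac (P.eval (x.1 : ℤ)).toNat).Prime ∧
      maxPrimeFac (P.eval (x.1 : ℤ)).toNat = maxPrimeFac (P.eval (x.2.1 : ℤ)).toNat ∧
      maxPrimeFac (P.eval (x.1 : ℤ)).toNat = maxPrimeFac (P.eval (x.2.2.1 : ℤ)).toNat ∧
      maxPrimeFac (P.eval (x.1 : ℤ)).toNat = maxPrimeFac (P.eval (x.2.2.2 : ℤ)).toNat ∧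
      P.eval (x.1 : ℤ) * P.eval (x.2.1 : ℤ) =
        P.eval (x.2.2.1 : ℤ) * P.eval (x.2.2.2 : ℤ)) with hT
  have h1 : T.card ≤ 2 * (T.filter fun x => x.2.2.1 ≤ x.2.2.2).card := by
    refine card_le_two_mul_card_filter _ (σ := fun x => (x.1, x.2.1, x.2.2.2, x.2.2.1)) ?_ ?_ ?_
    · rintro ⟨a, b, c, e⟩ ⟨a', b', c', e'⟩ h
      simp only [Prod.mk.injEq] at h ⊢
      tauto
    · rintro ⟨a, b, c, e⟩ h
      simp only [hT, Finset.mem_filter, Finset.mem_product] at h ⊢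
      obtain ⟨⟨m1, m2, m3, m4⟩, p1, p2, p3, p4, p5⟩ := h
      exact ⟨⟨m1, m2, m4, m3⟩, p1, p2, p4, p3, by rw [p5, mul_comm]⟩
    · exact fun x _ => le_total _ _
  set T₁ := T.filter fun x => x.2.2.1 ≤ x.2.2.2 with hT₁
  have h2 : T₁.card ≤ 2 * (T₁.filter fun x => x.2.1 ≤ x.1).card := by
    refine card_le_two_mul_card_filter _ (σ := fun x => (x.2.1, x.1, x.2.2.1, x.2.2.2)) ?_ ?_ ?_
    · rintro ⟨a, b, c, e⟩ ⟨a', b', c', e'⟩ h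
      simp only [Prod.mk.injEq] at h ⊢
      tauto
    · rintro ⟨a, b, c, e⟩ h
      simp only [hT₁, hT, Finset.mem_filter, Finset.mem_product] at h ⊢
      obtain ⟨⟨⟨m1, m2, m3, m4⟩, p1, p2, p3, p4, p5⟩, o1⟩ := h
      rw [← p2, ← p3, ← p4]
      exact ⟨⟨⟨m2, m1, m3, m4⟩, p1, rfl, rfl, rfl, by rw [← p5, mul_comm]⟩, o1⟩
    · exact fun x _ => le_total _ _
  set T₂ := T₁.filter fun x => x.2.1 ≤ x.1 with hT₂
  have h3 : T₂.card ≤ 2 * (T₂.filter fun x => x.2.2.2 ≤ x.1).card := by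
    refine card_le_two_mul_card_filter _ (σ := fun x => (x.2.2.2, x.2.2.1, x.2.1, x.1)) ?_ ?_ ?_
    · rintro ⟨a, b, c, e⟩ ⟨a', b', c', e'⟩ h
      simp only [Prod.mk.injEq] at h ⊢
      tauto
    · rintro ⟨a, b, c, e⟩ h
      simp only [hT₂, hT₁, hT, Finset.mem_filter, Finset.mem_product] at h ⊢
      obtain ⟨⟨⟨⟨m1, m2, m3, m4⟩, p1, p2, p3, p4, p5⟩, o1⟩, o2⟩ := h
      rw [← p2, ← p3, ← p4]
      exact ⟨⟨⟨⟨m4, m3, m2, m1⟩, p1, rfl, rfl, rfl, by rw [mul_comm, ← p5, mul_comm]⟩, o2⟩, o1⟩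
    · exact fun x _ => le_total _ _
  have h4 : T₂.filter (fun x => x.2.2.2 ≤ x.1) ⊆ orderedQuadruples P N := by
    rintro ⟨a, b, c, e⟩ h
    simp only [hT₂, hT₁, hT, orderedQuadruples, commonLargestPrimePairs, Finset.mem_filter,
      Finset.mem_product] at h ⊢
    obtain ⟨⟨⟨⟨⟨m1, m2, m3, m4⟩, p1, p2, p3, p4, p5⟩, o1⟩, o2⟩, o3⟩ := h
    rw [← p2, ← p3]
    exact ⟨⟨m1, m2, m3, m4⟩, ⟨⟨m1, m2⟩, p1, rfl⟩, ⟨⟨m2, m3⟩, p1, rfl⟩, p5, o1, o3⟩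
  have := Finset.card_le_card h4
  omega

theorem card_orderedQuadruples_eq_le (P : ℤ[X]) (hd : 2 ≤ P.natDegree)
    (hpos : ∀ n : ℕ, 1 ≤ n → 1 ≤ P.eval (n : ℤ)) (N : ℕ) :
    ((orderedQuadruples P N).filter fun x => P.eval (x.2.1 : ℤ) = P.eval (x.2.2.1 : ℤ)).card
      ≤ P.natDegree ^ 2 * (commonLargestPrimePairs P N).card := by
  refine Finset.card_le_mul_card_image_of_maps_to (f := fun x => (x.1, x.2.1)) ?_ _ ?_
  · intro x hx
    exact (Finset.mem_filter.mp (Finset.mem_filter.mp hx).1).2.1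
  · rintro ⟨a, b⟩ -
    have hroots := fun m => card_filter_eval_eq_le P (by omega : 1 ≤ P.natDegree) m (Finset.Icc 1 N)
    rw [sq]
    refine le_trans ?_ (Nat.mul_le_mul (hroots (P.eval (b : ℤ))) (hroots (P.eval (a : ℤ))))
    rw [← Finset.card_product]
    refine Finset.card_le_card_of_injOn (fun x => x.2.2) ?_ ?_
    · rintro ⟨a', b', c, e⟩ h
      simp only [Finset.mem_coe, Finset.mem_filter, orderedQuadruples, Finset.mem_product,
        Prod.mk.injEq] at h ⊢
      obtain ⟨⟨⟨⟨m1, m2, m3, m4⟩, -, -, p5, -⟩, q⟩, rfl, rfl⟩ := h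
      refine ⟨⟨m3, q.symm⟩, m4, ?_⟩
      rw [← q, mul_comm] at p5
      have := hpos b' (Finset.mem_Icc.mp m2).1
      exact (mul_left_cancel₀ (by omega) p5).symm
    · rintro ⟨a', b', c, e⟩ h ⟨a'', b'', c', e'⟩ h' heq
      simp only [Finset.mem_coe, Finset.mem_filter, Prod.mk.injEq] at h h' heq ⊢
      exact ⟨h.2.1.trans h'.2.1.symm, h.2.2.trans h'.2.2.symm, heq⟩

theorem exists_card_orderedQuadruples_ne_le (P : ℤ[X]) (hd : 2 ≤ P.natDegree)
    (hform : ¬ ∃ (w : ℤ) (c : ℚ),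
      P.map (Int.castRingHom ℚ) = C (w : ℚ) * (X + C c) ^ P.natDegree)
    (hpos : ∀ n : ℕ, 1 ≤ n → 1 ≤ P.eval (n : ℤ)) :
    ∃ K : ℝ, 0 ≤ K ∧ ∀ (δ : ℝ) (N : ℕ), 0 < δ →
      (((orderedQuadruples P N).filter
        fun x => P.eval (x.2.1 : ℤ) ≠ P.eval (x.2.2.1 : ℤ)).card : ℝ)
        ≤ K * (δ * (N : ℝ) ^ 2 + (commonLargestPrimePairs P N).card / δ) := by
  obtain ⟨A, hA1, hA2⟩ := exists_card_ratio_points_le P hd hform hpos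
  set d := P.natDegree with hddef
  refine ⟨d * A * (A + 1), by positivity, fun δ N hδ => ?_⟩
  set U := (orderedQuadruples P N).filter
    fun x => P.eval (x.2.1 : ℤ) ≠ P.eval (x.2.2.1 : ℤ) with hU
  set J := (commonLargestPrimePairs P N).filter fun x => x.1 ≤ A * x.2 with hJ
  have hUspec : ∀ a b c e : ℕ, (a, b, c, e) ∈ U →
      (1 ≤ a ∧ a ≤ N) ∧ 1 ≤ b ∧ (1 ≤ c ∧ c ≤ N) ∧ (1 ≤ e ∧ e ≤ N) ∧
      (b, c) ∈ commonLargestPrimePairs P N ∧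
      P.eval (a : ℤ) * P.eval (b : ℤ) = P.eval (c : ℤ) * P.eval (e : ℤ) ∧ c ≤ e ∧ e ≤ a ∧
      P.eval (b : ℤ) ≠ P.eval (c : ℤ) := by
    intro a b c e h
    simp only [hU, orderedQuadruples, Finset.mem_filter, Finset.mem_product, Finset.mem_Icc] at h
    tauto
  have hmaps : ∀ x ∈ U, (x.2.1, x.2.2.1) ∈ J := by
    rintro ⟨a, b, c, e⟩ h
    obtain ⟨-, hb, hc, he, hbc, heq, -, hea, -⟩ := hUspec a b c e h
    rw [hJ, Finset.mem_filter]
    exact ⟨hbc, hA1 b c e a hb hc.1 he.1 hea heq⟩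
  have hJspec : ∀ b c : ℕ, (b, c) ∈ J → (1 ≤ b ∧ b ≤ N) ∧ (1 ≤ c ∧ c ≤ N) ∧ b ≤ A * c := by
    intro b c h
    simp only [hJ, commonLargestPrimePairs, Finset.mem_filter, Finset.mem_product,
      Finset.mem_Icc] at h
    tauto
  have hfib : ∀ y ∈ J, ((U.filter fun x => (x.2.1, x.2.2.1) = y).card : ℝ)
      ≤ d * (A * (N / (y.2 : ℝ))) := by
    rintro ⟨b, c⟩ hy
    obtain ⟨hb, hc, -⟩ := hJspec b c hy
    set F := U.filter fun x => (x.2.1, x.2.2.1) = (b, c) with hF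
    have hFspec : ∀ a b' c' e : ℕ, (a, b', c', e) ∈ F → (a, b, c, e) ∈ U ∧ b' = b ∧ c' = c := by
      intro a b' c' e h
      simp only [hF, Finset.mem_filter, Prod.mk.injEq] at h
      obtain ⟨h, rfl, rfl⟩ := h
      exact ⟨h, rfl, rfl⟩
    rcases F.eq_empty_or_nonempty with h0 | ⟨⟨a₀, b₀, c₀, e₀⟩, hne⟩
    · rw [h0, Finset.card_empty, Nat.cast_zero]; positivity
    have hbc := (hUspec _ _ _ _ (hFspec _ _ _ _ hne).1).2.2.2.2.2.2.2.2
    set s := F.image fun x => x.2.2.2 with hs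
    have h1 : F.card ≤ d * s.card := by
      refine Finset.card_le_mul_card_image F d fun e he => ?_
      have hPb := hpos b hb.1
      refine le_trans ?_ (card_filter_eval_eq_le P (by omega)
        (P.eval (c : ℤ) * P.eval (e : ℤ) / P.eval (b : ℤ)) (Finset.Icc 1 N))
      refine Finset.card_le_card_of_injOn (fun x => x.1) ?_ ?_
      · rintro ⟨a, b', c', e'⟩ h
        simp only [Finset.mem_coe, Finset.mem_filter] at h ⊢
        obtain ⟨h, rfl⟩ := h
        obtain ⟨ha, -, -, -, -, heq, -⟩ := hUspec _ _ _ _ (hFspec _ _ _ _ h).1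
        exact ⟨Finset.mem_Icc.mpr ha, Int.eq_ediv_of_mul_eq_left (by omega) heq⟩
      · rintro ⟨a, b', c', e'⟩ h ⟨a₂, b₂, c₂, e₂⟩ h₂ heq
        simp only [Finset.mem_coe, Finset.mem_filter] at h h₂ heq
        obtain ⟨-, rfl, rfl⟩ := hFspec _ _ _ _ h.1
        obtain ⟨-, rfl, rfl⟩ := hFspec _ _ _ _ h₂.1
        rw [heq, h.2, h₂.2]
    have h2 := hA2 N b c s hb.1 hc.1 hc.2 hbc (by
      intro e he
      obtain ⟨⟨a, b', c', e'⟩, h, rfl⟩ := Finset.mem_image.mp he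
      obtain ⟨ha, -, -, -, -, heq, hce, hea, -⟩ := hUspec _ _ _ _ (hFspec _ _ _ _ h).1
      exact ⟨hce, a, hea, ha.2, heq⟩)
    calc (F.card : ℝ) ≤ d * s.card := by exact_mod_cast h1
      _ ≤ _ := by gcongr
  have hsmall : ∑ y ∈ J with (y.2 : ℝ) ≤ δ * N, (d * (A * (N / (y.2 : ℝ))) : ℝ)
      ≤ d * A * A * (δ * (N : ℝ) ^ 2) := by
    set I := (Finset.Icc 1 N).filter fun c : ℕ => (c : ℝ) ≤ δ * N with hI
    have hIcard : (I.card : ℝ) ≤ δ * N := by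
      have : I ⊆ Finset.Icc 1 ⌊δ * N⌋₊ := by
        intro c hc
        rw [hI, Finset.mem_filter, Finset.mem_Icc] at hc
        exact Finset.mem_Icc.mpr ⟨hc.1.1, Nat.le_floor hc.2⟩
      have := Finset.card_le_card this
      rw [Nat.card_Icc, Nat.add_sub_cancel] at this
      exact (Nat.cast_le.mpr this).trans (Nat.floor_le (by positivity))
    rw [← Finset.sum_fiberwise_of_maps_to (t := I) (g := fun y => y.2)]
    · calc _ ≤ ∑ c ∈ I, (d * A * A * N : ℝ) := by
            refine Finset.sum_le_sum fun c hc => ?_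
            have hc1 : 1 ≤ c := (Finset.mem_Icc.mp (Finset.mem_filter.mp hc).1).1
            have hc0 : (0 : ℝ) < c := by exact_mod_cast hc1
            refine (Finset.sum_le_card_nsmul _ _ (d * (A * (N / (c : ℝ))) : ℝ) ?_).trans ?_
            · intro y hy
              rw [(Finset.mem_filter.mp hy).2]
            · rw [nsmul_eq_mul]
              have : ((J.filter fun y => (y.2 : ℝ) ≤ δ * N).filter fun y => y.2 = c).card
                  ≤ (Finset.Icc 1 (A * c)).card := by
                refine Finset.card_le_card_of_injOn Prod.fst ?_ ?_
                · rintro ⟨b, c'⟩ h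
                  simp only [Finset.mem_coe, Finset.mem_filter] at h
                  obtain ⟨⟨h, -⟩, rfl⟩ := h
                  obtain ⟨hb, -, hbc⟩ := hJspec b c' h
                  exact Finset.mem_coe.mpr (Finset.mem_Icc.mpr ⟨hb.1, hbc⟩)
                · rintro ⟨b, c'⟩ h ⟨b₂, c₂⟩ h₂ heq
                  simp only [Finset.mem_coe, Finset.mem_filter] at h h₂ heq
                  rw [heq, h.2, h₂.2]
              rw [Nat.card_Icc, Nat.add_sub_cancel] at this
              calc _ ≤ ((A * c : ℕ) : ℝ) * (d * (A * (N / (c : ℝ)))) := by gcongr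
                _ = _ := by push_cast; field_simp
        _ = I.card * (d * A * A * N) := by rw [Finset.sum_const, nsmul_eq_mul]
        _ ≤ δ * N * (d * A * A * N) := by gcongr
        _ = _ := by ring
    · rintro ⟨b, c⟩ h
      rw [Finset.mem_filter] at h
      rw [hI, Finset.mem_filter, Finset.mem_Icc]
      exact ⟨(hJspec b c h.1).2.1, h.2⟩
  have hlarge : ∑ y ∈ J with ¬ (y.2 : ℝ) ≤ δ * N, (d * (A * (N / (y.2 : ℝ))) : ℝ)
      ≤ d * A * ((commonLargestPrimePairs P N).card / δ) := by
    refine (Finset.sum_le_card_nsmul _ _ (d * (A * (1 / δ)) : ℝ) ?_).trans ?_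
    · rintro ⟨b, c⟩ h
      rw [Finset.mem_filter, not_le] at h
      have hc0 : (0 : ℝ) < c := by exact_mod_cast (hJspec b c h.1).2.1.1
      gcongr d * (A * ?_)
      rw [div_le_div_iff₀ hc0 hδ]
      linarith [h.2]
    · rw [nsmul_eq_mul]
      have : ((J.filter fun y => ¬ (y.2 : ℝ) ≤ δ * N).card : ℝ)
          ≤ (commonLargestPrimePairs P N).card := by
        exact_mod_cast Finset.card_le_card
          ((Finset.filter_subset _ _).trans (Finset.filter_subset _ _))
      calc _ ≤ ((commonLargestPrimePairs P N).card : ℝ) * (d * (A * (1 / δ))) := by gcongr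
        _ = _ := by ring
  rw [Finset.card_eq_sum_card_fiberwise hmaps]
  push_cast
  calc _ ≤ ∑ y ∈ J, (d * (A * (N / (y.2 : ℝ))) : ℝ) := Finset.sum_le_sum hfib
    _ ≤ d * A * A * (δ * (N : ℝ) ^ 2) + d * A * ((commonLargestPrimePairs P N).card / δ) := by
      rw [← Finset.sum_filter_add_sum_filter_not J (fun y => (y.2 : ℝ) ≤ δ * N)]
      exact add_le_add hsmall hlarge
    _ ≤ _ := by
      have h1 : (0 : ℝ) ≤ d * A * (δ * (N : ℝ) ^ 2) := by positivity
      have h2 : (0 : ℝ) ≤ d * A * A * ((commonLargestPrimePairs P N).card / δ) := by positivity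
      linarith

/-- For `P ∈ ℤ[x]` of degree `d ≥ 2`, not of the form `w(x+c)^d` (`w ∈ ℤ`, `c ∈ ℚ`), and
with `P(n) ≥ 1` for `n ≥ 1`, one has
`∑_p #{(n₁,…,n₄) ∈ [N]⁴ : P⁺(P(nᵢ)) = p ∀i, P(n₁)P(n₂) = P(n₃)P(n₄)} = o(N²)`. -/
theorem common_largest_prime_count_little_o
    (P : Polynomial ℤ) (d : ℕ) (hd : 2 ≤ d) (hdeg : P.natDegree = d)
    (hform : ¬ ∃ (w : ℤ) (c : ℚ),
      P.map (Int.castRingHom ℚ) = C (w : ℚ) * (X + C c) ^ d)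
    (hpos : ∀ n : ℕ, 1 ≤ n → 1 ≤ P.eval (n : ℤ)) :
    Tendsto (fun N : ℕ => (commonLargestPrimeCount P N : ℝ) / (N : ℝ) ^ 2)
      atTop (𝓝 0) := by
  subst hdeg
  obtain ⟨K, hK, hne⟩ := exists_card_orderedQuadruples_ne_le P hd hform hpos
  set B : ℝ := 8 * ((P.natDegree : ℝ) ^ 2 + K) with hB
  have hB0 : 0 < B := by
    have : (0 : ℝ) < P.natDegree := by exact_mod_cast (by omega : 0 < P.natDegree)
    positivity
  have hcount : ∀ (δ : ℝ) (N : ℕ), 0 < δ → δ ≤ 1 → (commonLargestPrimeCount P N : ℝ)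
      ≤ B * (δ * (N : ℝ) ^ 2 + (commonLargestPrimePairs P N).card / δ) := by
    intro δ N hδ hδ1
    have h1 := commonLargestPrimeCount_le P N
    rw [← Finset.card_filter_add_card_filter_not (s := orderedQuadruples P N)
      (fun x => P.eval (x.2.1 : ℤ) = P.eval (x.2.2.1 : ℤ))] at h1
    have h2 : (((orderedQuadruples P N).filter
        fun x => P.eval (x.2.1 : ℤ) = P.eval (x.2.2.1 : ℤ)).card : ℝ)
        ≤ (P.natDegree : ℝ) ^ 2 * (δ * (N : ℝ) ^ 2 + (commonLargestPrimePairs P N).card / δ) := by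
      have h3 : (((orderedQuadruples P N).filter
          fun x => P.eval (x.2.1 : ℤ) = P.eval (x.2.2.1 : ℤ)).card : ℝ)
          ≤ (P.natDegree : ℝ) ^ 2 * (commonLargestPrimePairs P N).card := by
        exact_mod_cast card_orderedQuadruples_eq_le P hd hpos N
      refine h3.trans ?_
      gcongr
      have h4 : ((commonLargestPrimePairs P N).card : ℝ)
          ≤ (commonLargestPrimePairs P N).card / δ := le_div_self (by positivity) hδ hδ1
      have h5 : 0 ≤ δ * (N : ℝ) ^ 2 := by positivity
      linarith
    have h1' := (Nat.cast_le (α := ℝ)).mpr h1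
    push_cast at h1'
    refine h1'.trans ?_
    rw [hB, mul_assoc, add_mul]
    gcongr
    exact hne δ N hδ
  rw [Metric.tendsto_atTop']
  intro ε hε
  set δ : ℝ := min 1 (ε / (3 * B)) with hδdef
  have hδ : 0 < δ := lt_min one_pos (by positivity)
  have hδ' : 3 * B * δ ≤ ε := by
    have := min_le_right 1 (ε / (3 * B))
    rw [le_div_iff₀ (by positivity)] at this
    linarith
  obtain ⟨N₀, hN₀⟩ := eventually_atTop.mp
    (eventually_card_commonLargestPrimePairs_le P hd hpos (by positivity : 0 < δ ^ 2))
  refine ⟨N₀, fun N hN => ?_⟩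
  have hN0 : (0 : ℝ) < N := by exact_mod_cast lt_of_le_of_lt (Nat.zero_le _) hN
  rw [Real.dist_0_eq_abs, abs_of_nonneg (by positivity), div_lt_iff₀ (by positivity)]
  calc (commonLargestPrimeCount P N : ℝ)
      ≤ B * (δ * (N : ℝ) ^ 2 + (commonLargestPrimePairs P N).card / δ) :=
        hcount δ N hδ (min_le_left _ _)
    _ ≤ B * (δ * (N : ℝ) ^ 2 + δ ^ 2 * (N : ℝ) ^ 2 / δ) := by gcongr; exact hN₀ N hN.le
    _ = 2 * B * δ * (N : ℝ) ^ 2 := by field_simp; ring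
    _ < 3 * B * δ * (N : ℝ) ^ 2 := by gcongr; norm_num
    _ ≤ ε * (N : ℝ) ^ 2 := by gcongr
end
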